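/- Let k be a positive integer with k ≡ 0 (mod 4). Then the sequence 0 → J_{k,2}(O_K) → J_{k,2} × J_{k,4} → M_k × S_{k+2} → 0 is exact, where the first map is φ ↦ (π_1 φ, π_{1+i} φ) and the second is (φ₁, φ₂) ↦ Λ(2)φ₁ − Λ(4)φ₂ with Λ(m) := D_0 + (2/m)D_2. That is: π_1 × π_{1+i} is injective, its image equals the kernel of Λ(2) − Λ(4), and Λ(2) − Λ(4) is surjective. -/

import Mathlib

noncomputable section

open Complex

/-- `τ` lies in the upper half plane. -/
def UHP (τ : ℂ) : Prop := 0 < τ.im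

/-- `eC w = exp(2 π i w)`. -/
def eC (w : ℂ) : ℂ := Complex.exp (2 * (Real.pi : ℂ) * Complex.I * w)

/-- Entries of a matrix in `SL(2, ℤ)`, as complex numbers. -/
def Ma (M : Matrix.SpecialLinearGroup (Fin 2) ℤ) : ℂ := ((M.1 0 0 : ℤ) : ℂ)
def Mb (M : Matrix.SpecialLinearGroup (Fin 2) ℤ) : ℂ := ((M.1 0 1 : ℤ) : ℂ)
def Mc (M : Matrix.SpecialLinearGroup (Fin 2) ℤ) : ℂ := ((M.1 1 0 : ℤ) : ℂ)
def Md (M : Matrix.SpecialLinearGroup (Fin 2) ℤ) : ℂ := ((M.1 1 1 : ℤ) : ℂ)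

/-- Hermitian Jacobi form of weight `k` and index `m` for the Hermitian Jacobi group over
`ℤ[i]`.  A form is a function `φ : ℂ → ℂ → ℂ → ℂ`, all conditions being imposed for `τ`
in the upper half plane.  Units `ε ∈ ℤ[i]ˣ = {1, -1, i, -i}`, and the elliptic variables
`λ = p + q i`, `μ = u + v i` range over `ℤ[i]`.  The Fourier expansion is indexed by
`n ∈ ℕ` and `r = (a + b i)/2 ∈ O_K^♯ = (i/2)ℤ[i]`, supported on `N(r) ≤ n m`,
i.e. `a² + b² ≤ 4 n m`. -/
structure IsHJF (k m : ℕ) (φ : ℂ → ℂ → ℂ → ℂ) : Prop where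
  holo : DifferentiableOn ℂ (fun p : ℂ × ℂ × ℂ => φ p.1 p.2.1 p.2.2) {p | UHP p.1}
  transf : ∀ ε : ℂ, ε ∈ ({1, -1, Complex.I, -Complex.I} : Set ℂ) →
    ∀ M : Matrix.SpecialLinearGroup (Fin 2) ℤ, ∀ τ z₁ z₂ : ℂ, UHP τ →
      φ ((Ma M * τ + Mb M) / (Mc M * τ + Md M))
        (ε * z₁ / (Mc M * τ + Md M))
        ((starRingEnd ℂ) ε * z₂ / (Mc M * τ + Md M))
      = ε ^ k * (Mc M * τ + Md M) ^ k *
          eC ((m : ℂ) * Mc M * z₁ * z₂ / (Mc M * τ + Md M)) * φ τ z₁ z₂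
  ellip : ∀ p q u v : ℤ, ∀ τ z₁ z₂ : ℂ, UHP τ →
      φ τ (z₁ + ((p : ℂ) + (q : ℂ) * Complex.I) * τ + ((u : ℂ) + (v : ℂ) * Complex.I))
          (z₂ + ((p : ℂ) - (q : ℂ) * Complex.I) * τ + ((u : ℂ) - (v : ℂ) * Complex.I))
      = eC (-(m : ℂ) * (((p : ℂ) ^ 2 + (q : ℂ) ^ 2) * τ
          + ((p : ℂ) - (q : ℂ) * Complex.I) * z₁
          + ((p : ℂ) + (q : ℂ) * Complex.I) * z₂)) * φ τ z₁ z₂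
  fourier : ∃ c : ℕ → ℤ → ℤ → ℂ,
      (∀ (n : ℕ) (a b : ℤ), 4 * (n : ℤ) * m < a ^ 2 + b ^ 2 → c n a b = 0) ∧
      ∀ τ z₁ z₂ : ℂ, UHP τ →
        HasSum (fun p : ℕ × ℤ × ℤ => c p.1 p.2.1 p.2.2 *
          eC ((p.1 : ℂ) * τ + (((p.2.1 : ℂ) + (p.2.2 : ℂ) * Complex.I) / 2) * z₁
            + (((p.2.1 : ℂ) - (p.2.2 : ℂ) * Complex.I) / 2) * z₂)) (φ τ z₁ z₂)

/-- Classical Jacobi form of weight `k` and index `m` for `SL(2,ℤ) ⋉ ℤ²`. -/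
structure IsJF (k m : ℕ) (φ : ℂ → ℂ → ℂ) : Prop where
  holo : DifferentiableOn ℂ (fun p : ℂ × ℂ => φ p.1 p.2) {p | UHP p.1}
  transf : ∀ M : Matrix.SpecialLinearGroup (Fin 2) ℤ, ∀ τ z : ℂ, UHP τ →
      φ ((Ma M * τ + Mb M) / (Mc M * τ + Md M)) (z / (Mc M * τ + Md M))
      = (Mc M * τ + Md M) ^ k *
          eC ((m : ℂ) * Mc M * z ^ 2 / (Mc M * τ + Md M)) * φ τ z
  ellip : ∀ p q : ℤ, ∀ τ z : ℂ, UHP τ →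
      φ τ (z + (p : ℂ) * τ + (q : ℂ))
      = eC (-(m : ℂ) * ((p : ℂ) ^ 2 * τ + 2 * (p : ℂ) * z)) * φ τ z
  fourier : ∃ c : ℕ → ℤ → ℂ,
      (∀ (n : ℕ) (r : ℤ), 4 * (n : ℤ) * m < r ^ 2 → c n r = 0) ∧
      ∀ τ z : ℂ, UHP τ →
        HasSum (fun p : ℕ × ℤ => c p.1 p.2 * eC ((p.1 : ℂ) * τ + (p.2 : ℂ) * z)) (φ τ z)

/-- Modular form of weight `k` for `SL(2,ℤ)`. -/
structure IsMF (k : ℕ) (f : ℂ → ℂ) : Prop where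
  holo : DifferentiableOn ℂ f {τ | UHP τ}
  transf : ∀ M : Matrix.SpecialLinearGroup (Fin 2) ℤ, ∀ τ : ℂ, UHP τ →
      f ((Ma M * τ + Mb M) / (Mc M * τ + Md M)) = (Mc M * τ + Md M) ^ k * f τ
  bounded : ∃ A B : ℝ, ∀ τ : ℂ, B ≤ τ.im → ‖f τ‖ ≤ A

/-- Cusp form of weight `k` for `SL(2,ℤ)`. -/
structure IsCF (k : ℕ) (f : ℂ → ℂ) : Prop where
  holo : DifferentiableOn ℂ f {τ | UHP τ}
  transf : ∀ M : Matrix.SpecialLinearGroup (Fin 2) ℤ, ∀ τ : ℂ, UHP τ →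
      f ((Ma M * τ + Mb M) / (Mc M * τ + Md M)) = (Mc M * τ + Md M) ^ k * f τ
  decay : ∀ ε : ℝ, 0 < ε → ∃ B : ℝ, ∀ τ : ℂ, B ≤ τ.im → ‖f τ‖ ≤ ε

/-- `M_w(SL(2,ℤ), ω̄)` for the character `ω` of `SL(2,ℤ)` with `ω(T) = ω(S) = i`:
holomorphic functions on the upper half plane, bounded at infinity, with
`f|_w T = -i f` and `f|_w S = -i f`. -/
structure IsMFOmegaBar (w : ℕ) (f : ℂ → ℂ) : Prop where
  holo : DifferentiableOn ℂ f {τ | UHP τ}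
  transT : ∀ τ : ℂ, UHP τ → f (τ + 1) = -Complex.I * f τ
  transS : ∀ τ : ℂ, UHP τ → f (-1 / τ) = -Complex.I * τ ^ w * f τ
  bounded : ∃ A B : ℝ, ∀ τ : ℂ, B ≤ τ.im → ‖f τ‖ ≤ A

/-- Hermitian theta function `θ^H_{m,s}` of index `m` with characteristic
`s = (a + b i)/2 ∈ O_K^♯`; the sum is over `r = s + m (g₁ + g₂ i) ∈ s + m ℤ[i]`. -/
def thetaH (m : ℕ) (a b : ℤ) (τ z₁ z₂ : ℂ) : ℂ :=
  ∑' g : ℤ × ℤ,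
    eC ((((a : ℂ) + 2 * m * g.1) ^ 2 + ((b : ℂ) + 2 * m * g.2) ^ 2) / (4 * m) * τ
      + (((a : ℂ) + 2 * m * g.1) + ((b : ℂ) + 2 * m * g.2) * Complex.I) / 2 * z₁
      + (((a : ℂ) + 2 * m * g.1) - ((b : ℂ) + 2 * m * g.2) * Complex.I) / 2 * z₂)

/-- Classical theta function `θ_{m,μ}(τ,z) = Σ_{r ≡ μ mod 2m} e(r²τ/(4m) + r z)`. -/
def thetaJ (m : ℕ) (μ : ℤ) (τ z : ℂ) : ℂ :=
  ∑' g : ℤ, eC (((μ : ℂ) + 2 * m * g) ^ 2 / (4 * m) * τ + ((μ : ℂ) + 2 * m * g) * z)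

/-- `h` is the family of theta components of `φ` (for index `m`): the `h_{a,b}` depend
only on `(a, b) mod 2m` and `φ = Σ_{s ∈ O_K^♯ / m O_K} h_s θ^H_{m,s}`. -/
def HasThetaDecomp (m : ℕ) (φ : ℂ → ℂ → ℂ → ℂ) (h : ℤ → ℤ → ℂ → ℂ) : Prop :=
  (∀ (a b : ℤ) (τ : ℂ), h (a + 2 * m) b τ = h a b τ ∧ h a (b + 2 * m) τ = h a b τ) ∧
  ∀ τ z₁ z₂ : ℂ, UHP τ →
    φ τ z₁ z₂ = ∑ a ∈ Finset.range (2 * m), ∑ b ∈ Finset.range (2 * m),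
      h (a : ℤ) (b : ℤ) τ * thetaH m (a : ℤ) (b : ℤ) τ z₁ z₂

/-- `ϑ₀(τ) = Σ_{r ∈ ℤ} e(r² τ)`. -/
def theta0C (τ : ℂ) : ℂ := ∑' r : ℤ, eC ((r : ℂ) ^ 2 * τ)

/-- `ϑ₁(τ) = Σ_{r odd} e(r² τ / 4)`. -/
def theta1C (τ : ℂ) : ℂ := ∑' r : ℤ, eC ((2 * (r : ℂ) + 1) ^ 2 * τ / 4)

/-- `ξ = ϑ₁ ϑ₀' − ϑ₀ ϑ₁'`. -/
def xiC (τ : ℂ) : ℂ := theta1C τ * deriv theta0C τ - theta0C τ * deriv theta1C τ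

/-- Taylor coefficient `χ_{α,β}(τ)` of `φ(τ, z₁, z₂)` around `z₁ = z₂ = 0`. -/
def chiHJF (φ : ℂ → ℂ → ℂ → ℂ) (α β : ℕ) (τ : ℂ) : ℂ :=
  (1 / ((α.factorial : ℂ) * (β.factorial : ℂ))) *
    iteratedDeriv α (fun z₁ => iteratedDeriv β (fun z₂ => φ τ z₁ z₂) 0) 0

/-- `D₀ : J_{k,m} → M_k`, `ψ ↦ ψ(·, 0)`. -/
def D0J (ψ : ℂ → ℂ → ℂ) : ℂ → ℂ := fun τ => ψ τ 0

/-- `D₂ : J_{k,m} → S_{k+2}`, `D₂ψ = (2k/(2πi)²) ψ₂ − (2m/(2πi)) ψ₀'`, where `ψ_ν` are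
the Taylor coefficients of `ψ` around `z = 0`. -/
def D2J (k m : ℕ) (ψ : ℂ → ℂ → ℂ) : ℂ → ℂ := fun τ =>
  (2 * (k : ℂ) / (2 * (Real.pi : ℂ) * Complex.I) ^ 2) *
      ((1 / 2) * iteratedDeriv 2 (fun z => ψ τ z) 0)
    - (2 * (m : ℂ) / (2 * (Real.pi : ℂ) * Complex.I)) * deriv (fun t => ψ t 0) τ

/-- Normalized Eisenstein series `E₄`. -/
def E4C (τ : ℂ) : ℂ :=
  1 + 240 * ∑' n : ℕ, ((ArithmeticFunction.sigma 3) n : ℂ) * eC ((n : ℂ) * τ)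

/-- Normalized Eisenstein series `E₆`. -/
def E6C (τ : ℂ) : ℂ :=
  1 - 504 * ∑' n : ℕ, ((ArithmeticFunction.sigma 5) n : ℂ) * eC ((n : ℂ) * τ)

/-- `f` agrees on the upper half plane with a polynomial in `E₄` and `E₆²` that is
homogeneous of weight `k - v`, i.e. supported on `4a + 12b + v = k`. -/
def IsE4E6sqPoly (v k : ℕ) (f : ℂ → ℂ) : Prop :=
  ∃ lam : ℕ × ℕ → ℂ, ∀ τ : ℂ, UHP τ →
    f τ = ∑ p ∈ (Finset.range (k + 1) ×ˢ Finset.range (k + 1)).filter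
        (fun p => 4 * p.1 + 12 * p.2 + v = k),
      lam p * E4C τ ^ p.1 * E6C τ ^ (2 * p.2)

/-- The slash action `φ|_{k,m} M` of `M ∈ SL(2,ℤ)` on functions `ℂ → ℂ → ℂ → ℂ`. -/
def slashHJF (k m : ℕ) (φ : ℂ → ℂ → ℂ → ℂ) (M : Matrix.SpecialLinearGroup (Fin 2) ℤ)
    (τ z₁ z₂ : ℂ) : ℂ :=
  ((Mc M * τ + Md M) ^ k)⁻¹ *
    eC (-(m : ℂ) * Mc M * z₁ * z₂ / (Mc M * τ + Md M)) *
    φ ((Ma M * τ + Mb M) / (Mc M * τ + Md M)) (z₁ / (Mc M * τ + Md M)) (z₂ / (Mc M * τ + Md M))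

/-- Hermitian Jacobi form of weight `k` and index `m` for the congruence subgroup `Γ₀(N)`,
with at each cusp a Fourier expansion supported on `(n, r) ∈ ℚ_{≥0} × O_K^♯`
with `N(r) ≤ n m`. -/
structure IsHJFLevel (k m N : ℕ) (φ : ℂ → ℂ → ℂ → ℂ) : Prop where
  holo : DifferentiableOn ℂ (fun p : ℂ × ℂ × ℂ => φ p.1 p.2.1 p.2.2) {p | UHP p.1}
  transf : ∀ ε : ℂ, ε ∈ ({1, -1, Complex.I, -Complex.I} : Set ℂ) →
    ∀ M : Matrix.SpecialLinearGroup (Fin 2) ℤ, (N : ℤ) ∣ M.1 1 0 →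
    ∀ τ z₁ z₂ : ℂ, UHP τ →
      φ ((Ma M * τ + Mb M) / (Mc M * τ + Md M))
        (ε * z₁ / (Mc M * τ + Md M))
        ((starRingEnd ℂ) ε * z₂ / (Mc M * τ + Md M))
      = ε ^ k * (Mc M * τ + Md M) ^ k *
          eC ((m : ℂ) * Mc M * z₁ * z₂ / (Mc M * τ + Md M)) * φ τ z₁ z₂
  ellip : ∀ p q u v : ℤ, ∀ τ z₁ z₂ : ℂ, UHP τ →
      φ τ (z₁ + ((p : ℂ) + (q : ℂ) * Complex.I) * τ + ((u : ℂ) + (v : ℂ) * Complex.I))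
          (z₂ + ((p : ℂ) - (q : ℂ) * Complex.I) * τ + ((u : ℂ) - (v : ℂ) * Complex.I))
      = eC (-(m : ℂ) * (((p : ℂ) ^ 2 + (q : ℂ) ^ 2) * τ
          + ((p : ℂ) - (q : ℂ) * Complex.I) * z₁
          + ((p : ℂ) + (q : ℂ) * Complex.I) * z₂)) * φ τ z₁ z₂
  cusp : ∀ M : Matrix.SpecialLinearGroup (Fin 2) ℤ,
      ∃ c : ℚ → ℤ → ℤ → ℂ,
        (∀ (n : ℚ) (a b : ℤ),
          ¬ (0 ≤ n ∧ ((a : ℚ) ^ 2 + (b : ℚ) ^ 2) ≤ 4 * n * m) → c n a b = 0) ∧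
        ∀ τ z₁ z₂ : ℂ, UHP τ →
          HasSum (fun p : ℚ × ℤ × ℤ => c p.1 p.2.1 p.2.2 *
            eC ((p.1 : ℂ) * τ + (((p.2.1 : ℂ) + (p.2.2 : ℂ) * Complex.I) / 2) * z₁
              + (((p.2.1 : ℂ) - (p.2.2 : ℂ) * Complex.I) / 2) * z₂))
            (slashHJF k m φ M τ z₁ z₂)

/-- Theta constant `x`. -/
def thConstX (τ : ℂ) : ℂ := ∑' n : ℤ, eC ((n : ℂ) ^ 2 * τ / 2)

/-- Theta constant `y`. -/
def thConstY (τ : ℂ) : ℂ := ∑' n : ℤ, (-1 : ℂ) ^ n * eC ((n : ℂ) ^ 2 * τ / 2)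

/-- Theta constant `z`. -/
def thConstZ (τ : ℂ) : ℂ := ∑' n : ℤ, eC (((n : ℂ) + 1 / 2) ^ 2 * τ / 2)

theorem eC_add (a b : ℂ) : eC (a + b) = eC a * eC b := by
  simp [eC, mul_add, Complex.exp_add]

theorem eC_zero : eC 0 = 1 := by simp [eC]

theorem eC_ne (a : ℂ) : eC a ≠ 0 := Complex.exp_ne_zero _

theorem eC_int (n : ℤ) : eC n = 1 := by
  rw [eC, show 2 * (Real.pi : ℂ) * I * n = n * (2 * Real.pi * I) by ring]
  exact Complex.exp_int_mul_two_pi_mul_I n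

theorem eC_nat (n : ℕ) : eC n = 1 := by exact_mod_cast eC_int n

theorem eC_one : eC 1 = 1 := by exact_mod_cast eC_int 1

theorem eC_neg (a : ℂ) : eC (-a) = (eC a)⁻¹ := by simp [eC, Complex.exp_neg]

theorem eC_nat_mul (n : ℕ) (a : ℂ) : eC (n * a) = eC a ^ n := by
  rw [eC, eC, ← Complex.exp_nat_mul]; ring_nf

theorem eC_diff : Differentiable ℂ eC := by
  unfold eC; fun_prop

theorem eC_congr {a b : ℂ} (n : ℤ) (h : a = b + n) : eC a = eC b := by
  rw [h, eC_add, eC_int, mul_one]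

theorem eC_hasDerivAt (c z : ℂ) : HasDerivAt (fun z => eC (c * z)) (2 * Real.pi * I * c * eC (c * z)) z := by
  have h := (((hasDerivAt_id z).const_mul c).const_mul (2 * (Real.pi:ℂ) * I)).cexp
  refine HasDerivAt.congr_deriv h ?_
  simp only [id, eC]
  ring

theorem eC_norm (a : ℂ) : ‖eC a‖ = Real.exp (-(2 * Real.pi * a.im)) := by
  rw [eC, Complex.norm_exp]; simp

/-- Fourier coefficient. -/
def FC (a : ℤ) (f : ℂ → ℂ) : ℂ := ∫ x in (0:ℝ)..1, f x * eC (-(a * x))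

theorem FC_hasSum {ι : Type*} [Countable ι] (c : ι → ℂ) (r : ι → ℤ) (f : ℂ → ℂ)
    (h : ∀ x : ℝ, HasSum (fun i => c i * eC (r i * x)) (f x)) (a : ℤ) :
    HasSum (fun i => if r i = a then c i else 0) (FC a f) := by
  have hs : Summable (fun i => ‖c i‖) := by
    have := (h 0).summable.norm
    simpa [eC_zero] using this
  have hn : ∀ (r : ℤ) (x : ℝ), ‖eC (r * x)‖ = 1 := by
    intro r x; rw [eC_norm]; simp
  have h1 : ∀ i, ∫ x in (0:ℝ)..1, c i * eC (r i * x) * eC (-(a * x)) = if r i = a then c i else 0 := by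
    intro i
    have : ∀ x : ℝ, c i * eC (r i * x) * eC (-(a * x)) = c i * Complex.exp ((2 * Real.pi * I * (r i - a)) * x) := by
      intro x; rw [mul_assoc, ← eC_add, eC]; ring_nf
    simp_rw [this]
    rw [intervalIntegral.integral_const_mul]
    split_ifs with hra
    · subst hra; simp
    · have hne : (2 * Real.pi * I * ((r i:ℂ) - a)) ≠ 0 := by
        have : (r i:ℂ) - a ≠ 0 := by
          rw [sub_ne_zero]; exact_mod_cast hra
        simp [this, Real.pi_ne_zero]
      rw [integral_exp_mul_complex hne]
      have : Complex.exp (2 * Real.pi * I * ((r i:ℂ) - a)) = 1 := by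
        have := eC_int (r i - a)
        rw [eC] at this; push_cast at this; exact this
      simp [this]
  have h2 := intervalIntegral.hasSum_integral_of_dominated_convergence (a := 0) (b := 1) (μ := MeasureTheory.volume)
    (F := fun i (x:ℝ) => c i * eC (r i * x) * eC (-(a * x)))
    (f := fun x => f x * eC (-(a * x))) (fun i _ => ‖c i‖) ?_ ?_ ?_ ?_ ?_
  · simp_rw [h1] at h2
    exact h2
  · intro i
    apply Continuous.aestronglyMeasurable
    unfold eC; fun_prop
  · intro i; filter_upwards with x _
    rw [norm_mul, norm_mul, hn, ← neg_mul]
    have := hn (-a) x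
    push_cast at this
    rw [this]; simp
  · filter_upwards with x _ using hs
  · simp
  · filter_upwards with x _
    exact (h x).mul_right _

theorem FC_add (a : ℤ) (f g : ℂ → ℂ) (hf : Differentiable ℂ f) (hg : Differentiable ℂ g) :
    FC a (fun z => f z + g z) = FC a f + FC a g := by
  unfold FC
  rw [← intervalIntegral.integral_add]
  · simp_rw [add_mul]
  · apply Continuous.intervalIntegrable
    have := hf.continuous; have := eC_diff.continuous; fun_prop
  · apply Continuous.intervalIntegrable
    have := hg.continuous; have := eC_diff.continuous; fun_prop

theorem FC_const_mul (a : ℤ) (c : ℂ) (f : ℂ → ℂ) :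
    FC a (fun z => c * f z) = c * FC a f := by
  unfold FC
  rw [← intervalIntegral.integral_const_mul]
  simp_rw [mul_assoc]

theorem FC_sum {ι : Type*} (s : Finset ι) (a : ℤ) (f : ι → ℂ → ℂ) (hf : ∀ i, Differentiable ℂ (f i)) :
    FC a (fun z => ∑ i ∈ s, f i z) = ∑ i ∈ s, FC a (f i) := by
  unfold FC
  simp_rw [Finset.sum_mul]
  rw [intervalIntegral.integral_finsetSum]
  intro i _
  apply Continuous.intervalIntegrable
  have := (hf i).continuous; have := eC_diff.continuous; fun_prop

theorem entire_eq_zero_of_real (f : ℂ → ℂ) (hf : Differentiable ℂ f) (h : ∀ x : ℝ, f x = 0) : ∀ z, f z = 0 := by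
  have ha : AnalyticOnNhd ℂ f Set.univ := fun z _ => hf.analyticAt z
  have h1 : ∃ᶠ z in nhdsWithin (0:ℂ) {0}ᶜ, f z = 0 := by
    have ht : Filter.Tendsto (fun n : ℕ => (((1:ℝ)/(n+1) : ℝ) : ℂ)) Filter.atTop (nhdsWithin (0:ℂ) {0}ᶜ) := by
      rw [tendsto_nhdsWithin_iff]
      constructor
      · have := (Complex.continuous_ofReal.tendsto 0).comp tendsto_one_div_add_atTop_nhds_zero_nat
        simpa [Function.comp_def] using this
      · filter_upwards with n
        simp only [Set.mem_compl_iff, Set.mem_singleton_iff, Complex.ofReal_eq_zero]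
        positivity
    exact ht.frequently (Filter.Frequently.of_forall fun n => h _)
  have := ha.eqOn_zero_of_preconnected_of_frequently_eq_zero isPreconnected_univ (Set.mem_univ 0) h1
  intro z; exact this (Set.mem_univ z)

theorem FC_inj (f : ℂ → ℂ) (hf : Differentiable ℂ f) (hp : ∀ z, f (z + 1) = f z)
    (h : ∀ a, FC a f = 0) : ∀ z, f z = 0 := by
  apply entire_eq_zero_of_real f hf
  have hper : Function.Periodic (fun x : ℝ => f x) 1 := by
    intro x; simp [hp]
  have : Fact (0 < (1:ℝ)) := ⟨one_pos⟩
  let g : C(AddCircle (1:ℝ), ℂ) := ⟨hper.lift, by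
    apply continuous_coinduced_dom.mpr
    change Continuous (fun x : ℝ => f x)
    exact hf.continuous.comp Complex.continuous_ofReal⟩
  have hc : ∀ n, fourierCoeff g n = 0 := by
    intro n
    rw [fourierCoeff_eq_intervalIntegral g n 0]
    have := h n
    unfold FC at this
    simp only [one_div, inv_one, one_smul, zero_add]
    rw [← this]
    congr 1
    ext x
    simp only [smul_eq_mul]
    rw [mul_comm]
    congr 1
    rw [fourier_coe_apply, eC]
    congr 1; push_cast; ring
  have hsum : HasSum (fun i => fourierCoeff g i • fourier i) g :=
    hasSum_fourier_series_of_summable (by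
      have : fourierCoeff g = 0 := by ext n; exact hc n
      rw [this]; exact summable_zero)
  have hg : g = 0 := by
    refine hsum.unique ?_
    simp only [hc, zero_smul]
    exact hasSum_zero
  intro x
  have : g (x : AddCircle (1:ℝ)) = 0 := by rw [hg]; rfl
  exact this

theorem shift_int (h : ℂ → ℂ) (hh : Differentiable ℂ h) (hp : ∀ z, h (z + 1) = h z) (w : ℂ) :
    ∫ x in (0:ℝ)..1, h (x + w) = ∫ x in (0:ℝ)..1, h x := by
  have h1 : ∫ x in (0:ℝ)..1, h (x + w) = ∫ x in (0:ℝ)..1, h (x + w.im * I) := by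
    have hper : Function.Periodic (fun x : ℝ => h (x + w.im * I)) 1 := by
      intro x
      have := hp (x + w.im * I)
      simp only
      rw [← this]; push_cast; ring_nf
    have e1 : ∫ x in (0:ℝ)..1, h (x + w) = ∫ x in (0:ℝ)..1, (fun x : ℝ => h (x + w.im * I)) (x + w.re) := by
      congr 1; ext x
      simp only
      congr 1
      push_cast
      nth_rw 1 [← Complex.re_add_im w]; ring
    rw [e1, intervalIntegral.integral_comp_add_right (fun x : ℝ => h (x + w.im * I))]
    have := hper.intervalIntegral_add_eq w.re 0
    rw [zero_add] at this ⊢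
    rw [add_comm 1 w.re]; exact this
  rw [h1]
  have h2 := Complex.integral_boundary_rect_eq_zero_of_differentiableOn h 0 (1 + w.im * I) hh.differentiableOn
  simp at h2
  have h3 : ∀ y : ℝ, h (1 + y * I) = h (y * I) := by intro y; rw [add_comm, hp]
  simp_rw [h3] at h2
  have h4 : (∫ x in (0:ℝ)..1, h x) - ∫ x in (0:ℝ)..1, h (x + w.im * I) = 0 := by
    linear_combination h2
  exact (sub_eq_zero.mp h4).symm

/-- Elliptic transformation law of index `m` for the lattice `ℤτ+ℤ`. -/
structure IsV (m : ℕ) (τ : ℂ) (f : ℂ → ℂ) : Prop where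
  diff : Differentiable ℂ f
  per : ∀ z, f (z + 1) = f z
  qper : ∀ z, f (z + τ) = eC (-m * (τ + 2 * z)) * f z

theorem IsV.add {m τ f g} (hf : IsV m τ f) (hg : IsV m τ g) : IsV m τ (fun z => f z + g z) where
  diff := hf.diff.add hg.diff
  per z := by simp only [hf.per, hg.per]
  qper z := by simp only [hf.qper, hg.qper]; ring

theorem IsV.const_mul {m τ f} (c : ℂ) (hf : IsV m τ f) : IsV m τ (fun z => c * f z) where
  diff := hf.diff.const_mul c
  per z := by simp only [hf.per]
  qper z := by simp only [hf.qper]; ring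

theorem IsV.sub {m τ f g} (hf : IsV m τ f) (hg : IsV m τ g) : IsV m τ (fun z => f z - g z) := by
  have := hf.add (hg.const_mul (-1))
  simpa [sub_eq_add_neg] using this

theorem IsV.zero {m τ} : IsV m τ (fun _ => 0) where
  diff := by fun_prop
  per z := rfl
  qper z := by simp

theorem IsV.sum {ι : Type*} {m τ} (s : Finset ι) (f : ι → ℂ → ℂ) (hf : ∀ i ∈ s, IsV m τ (f i)) :
    IsV m τ (fun z => ∑ i ∈ s, f i z) := by
  classical
  induction s using Finset.induction_on with
  | empty => simpa using IsV.zero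
  | insert a s ha ih =>
    simp only [Finset.sum_insert ha]
    exact (hf a (by simp)).add (ih fun i hi => hf i (by simp [hi]))

theorem IsV.mul {m n τ f g} (hf : IsV m τ f) (hg : IsV n τ g) : IsV (m + n) τ (fun z => f z * g z) where
  diff := hf.diff.mul hg.diff
  per z := by simp only [hf.per, hg.per]
  qper z := by
    simp only [hf.qper, hg.qper]
    push_cast
    rw [show -((m:ℂ) + n) * (τ + 2 * z) = -m * (τ + 2 * z) + -n * (τ + 2 * z) by ring, eC_add]; ring

theorem IsV.one {τ} : IsV 0 τ (fun _ => 1) where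
  diff := by fun_prop
  per z := rfl
  qper z := by simp [eC_zero]

theorem IsV.pow {m τ f} (hf : IsV m τ f) (n : ℕ) : IsV (m * n) τ (fun z => f z ^ n) := by
  induction n with
  | zero => simpa using IsV.one
  | succ n ih => simpa [pow_succ, mul_add] using ih.mul hf

theorem IsV.per_int {m τ f} (hf : IsV m τ f) (q : ℤ) (z : ℂ) : f (z + q) = f z := by
  have : Function.Periodic f 1 := hf.per
  simpa using (this.int_mul q) z

theorem IsV.law {m τ f} (hf : IsV m τ f) (p q : ℤ) (z : ℂ) :
    f (z + p * τ + q) = eC (-m * (p ^ 2 * τ + 2 * p * z)) * f z := by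
  rw [hf.per_int]
  induction p using Int.induction_on generalizing z with
  | zero => simp [eC_zero]
  | succ i ih =>
    have h1 := hf.qper (z + i * τ)
    have h2 := ih z
    push_cast at h1 h2 ⊢
    rw [show z + ((i:ℂ) + 1) * τ = z + i * τ + τ by ring, h1, h2, ← mul_assoc, ← eC_add]
    congr 2; ring
  | pred i ih =>
    have h1 := hf.qper (z + (-(i:ℂ) - 1) * τ)
    have h2 := ih z
    push_cast at h1 h2 ⊢
    rw [show z + (-(i:ℂ) - 1) * τ + τ = z + -i * τ by ring, h2] at h1
    have h3 : f (z + (-(i:ℂ) - 1) * τ) = eC (-(-m * (τ + 2 * (z + (-(i:ℂ) - 1) * τ)))) *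
        (eC (-m * ((-(i:ℂ)) ^ 2 * τ + 2 * -(i:ℂ) * z)) * f z) := by
      rw [h1, ← mul_assoc, ← eC_add]; simp [eC_zero]
    rw [h3, ← mul_assoc, ← eC_add]
    congr 2; ring

theorem IsV.FC_shift {m τ f} (hf : IsV m τ f) (a : ℤ) :
    FC a f = eC (-(m + a) * τ) * FC (a + 2 * m) f := by
  have hd := hf.diff
  have he := eC_diff
  have h := shift_int (fun z => f z * eC (-(a * z))) (by fun_prop) (by
    intro z; simp only [hf.per]; congr 1
    exact eC_congr (-a) (by push_cast; ring)) τ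
  rw [FC, ← h, FC, ← intervalIntegral.integral_const_mul]
  congr 1; ext x
  simp only [hf.qper]
  rw [mul_right_comm, ← eC_add, mul_left_comm, ← eC_add, mul_comm]
  congr 2; push_cast; ring

theorem FC_neg (f : ℂ → ℂ) (_ : Differentiable ℂ f) (hp : ∀ z, f (z + 1) = f z) (a : ℤ) :
    FC (-a) f = FC a (fun z => f (-z)) := by
  have he := eC_diff
  have h1 := intervalIntegral.integral_comp_neg (a := 0) (b := 1) (fun x : ℝ => f x * eC (a * x))
  have hper : Function.Periodic (fun x : ℝ => f x * eC (a * x)) 1 := by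
    intro x
    simp only
    push_cast
    rw [hp]; congr 1
    exact eC_congr a (by ring)
  have h2 := hper.intervalIntegral_add_eq (-1) 0
  simp only [FC]
  simp at h1 h2 ⊢
  rw [← h2, ← h1]

theorem IsV.inj {m τ f} (hm : 0 < m) (hf : IsV m τ f)
    (h : ∀ a : ℤ, -m < a → a ≤ m → FC a f = 0) : ∀ z, f z = 0 := by
  apply FC_inj f hf.diff hf.per
  have hiff : ∀ a : ℤ, FC a f = 0 ↔ FC (a + 2 * m) f = 0 := by
    intro a; rw [hf.FC_shift a]; simp [eC_ne]
  have hiff2 : ∀ (j a : ℤ), FC a f = 0 ↔ FC (a + 2 * m * j) f = 0 := by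
    intro j
    induction j using Int.induction_on with
    | zero => simp
    | succ i ih => intro a; rw [ih a, hiff]; ring_nf
    | pred i ih => intro a; rw [ih a, hiff (a + 2 * m * (-(i:ℤ) - 1))]; ring_nf
  intro a
  have h1 := Int.emod_add_mul_ediv a (2 * m)
  rw [← h1, ← hiff2]
  have h2 := Int.emod_nonneg a (b := 2 * m) (by omega)
  have h3 := Int.emod_lt_of_pos a (b := 2 * m) (by omega)
  by_cases h4 : a % (2 * m) ≤ m
  · exact h _ (by omega) h4
  · rw [hiff2 (-1)]
    exact h _ (by omega) (by omega)

theorem IsV.inj_even {m τ f} (hm : 0 < m) (hf : IsV m τ f) (he : ∀ z, f (-z) = f z)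
    (h : ∀ a : ℕ, a ≤ m → FC a f = 0) : ∀ z, f z = 0 := by
  apply hf.inj hm
  intro a h1 h2
  rcases le_or_gt 0 a with h3 | h3
  · lift a to ℕ using h3
    exact h a (by omega)
  · obtain ⟨b, rfl⟩ : ∃ b, a = -b := ⟨-a, by simp⟩
    rw [FC_neg f hf.diff hf.per]
    simp_rw [he]
    lift b to ℕ using (by omega)
    exact h b (by omega)

theorem IsV.inj_odd {τ f} (hf : IsV 2 τ f) (ho : ∀ z, f (-z) = -f z)
    (h : FC 1 f = 0) : ∀ z, f z = 0 := by
  have hn : ∀ a, FC (-a) f = -FC a f := by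
    intro a
    rw [FC_neg f hf.diff hf.per]
    simp_rw [ho]
    have := FC_const_mul a (-1) f
    simpa using this
  apply hf.inj (by norm_num)
  intro a h1 h2
  have : a = -1 ∨ a = 0 ∨ a = 1 ∨ a = 2 := by push_cast at h1 h2; omega
  rcases this with rfl | rfl | rfl | rfl
  · rw [hn, h, neg_zero]
  · have := hn 0
    simp only [neg_zero] at this
    linear_combination (1/2) * this
  · exact h
  · have h3 := hf.FC_shift (-2)
    have h4 := hn 2
    norm_num [eC_zero] at h3
    rw [h4] at h3
    linear_combination (-1/2) * h3

theorem Mdet (M : Matrix.SpecialLinearGroup (Fin 2) ℤ) : Ma M * Md M - Mb M * Mc M = 1 := by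
  have := M.2
  rw [Matrix.det_fin_two] at this
  unfold Ma Mb Mc Md
  exact_mod_cast this

theorem Mj_ne (M : Matrix.SpecialLinearGroup (Fin 2) ℤ) {τ : ℂ} (hτ : UHP τ) : Mc M * τ + Md M ≠ 0 := by
  intro h
  have hi := congrArg Complex.im h
  have hr := congrArg Complex.re h
  have hd := Mdet M
  simp [Mc, Md] at hi hr
  rcases hi with hi | hi
  · simp [hi] at hr
    simp [Mc, Md, hi, hr] at hd
  · exact absurd hi hτ.ne'

theorem IsV.slash {m} (M : Matrix.SpecialLinearGroup (Fin 2) ℤ) {τ f} (hτ : UHP τ)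
    (hf : IsV m ((Ma M * τ + Mb M) / (Mc M * τ + Md M)) f) :
    IsV m τ (fun z => eC (-m * Mc M * z ^ 2 / (Mc M * τ + Md M)) * f (z / (Mc M * τ + Md M))) := by
  have hj := Mj_ne M hτ
  have hd := Mdet M
  have hdiff := hf.diff
  have hec := eC_diff
  refine ⟨by fun_prop, ?_, ?_⟩
  · intro z
    have h1 := hf.law (-M.1 1 0) (M.1 0 0) (z / (Mc M * τ + Md M))
    rw [show z / (Mc M * τ + Md M) + ((-M.1 1 0 : ℤ):ℂ) * ((Ma M * τ + Mb M) / (Mc M * τ + Md M)) + ((M.1 0 0 : ℤ) : ℂ)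
      = (z + 1) / (Mc M * τ + Md M) by
        change z / (Mc M * τ + Md M) + ((-M.1 1 0 : ℤ):ℂ) * ((Ma M * τ + Mb M) / (Mc M * τ + Md M)) + Ma M = _
        rw [show ((-M.1 1 0 : ℤ):ℂ) = - Mc M by simp [Mc]]
        field_simp
        linear_combination hd] at h1
    rw [h1, ← mul_assoc, ← eC_add]
    congr 1
    apply eC_congr (-m * M.1 1 0 * M.1 0 0)
    push_cast
    change _ = _ + -(m:ℂ) * Mc M * Ma M
    rw [show ((M.1 1 0 : ℤ):ℂ) = Mc M from rfl]
    field_simp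
    linear_combination (m * Mc M) * hd
  · intro z
    have h1 := hf.law (M.1 1 1) (-M.1 0 1) (z / (Mc M * τ + Md M))
    rw [show z / (Mc M * τ + Md M) + ((M.1 1 1 : ℤ):ℂ) * ((Ma M * τ + Mb M) / (Mc M * τ + Md M)) + ((-M.1 0 1 : ℤ) : ℂ)
      = (z + τ) / (Mc M * τ + Md M) by
        change z / (Mc M * τ + Md M) + Md M * ((Ma M * τ + Mb M) / (Mc M * τ + Md M)) + ((-M.1 0 1 : ℤ) : ℂ) = _
        rw [show ((-M.1 0 1 : ℤ):ℂ) = - Mb M by simp [Mb]]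
        field_simp
        linear_combination τ * hd] at h1
    rw [h1, ← mul_assoc, ← eC_add, ← mul_assoc, ← eC_add]
    congr 1
    apply eC_congr (-m * M.1 1 1 * M.1 0 1)
    push_cast
    change _ = _ + -(m:ℂ) * Md M * Mb M
    rw [show ((M.1 1 1 : ℤ):ℂ) = Md M from rfl]
    field_simp
    linear_combination (-m * Md M * τ) * hd

theorem UHP_smul (M : Matrix.SpecialLinearGroup (Fin 2) ℤ) {τ : ℂ} (hτ : UHP τ) :
    UHP ((Ma M * τ + Mb M) / (Mc M * τ + Md M)) := by
  have h : ((Ma M * τ + Mb M) / (Mc M * τ + Md M)) = ((M • (⟨τ, hτ⟩ : UpperHalfPlane) : UpperHalfPlane) : ℂ) := by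
    rw [UpperHalfPlane.specialLinearGroup_apply]
    simp [Ma, Mb, Mc, Md]
  rw [h]
  exact (M • (⟨τ, hτ⟩ : UpperHalfPlane) : UpperHalfPlane).2

/-- second derivative at zero -/
def d2 (f : ℂ → ℂ) : ℂ := deriv (deriv f) 0

theorem iteratedDeriv_two_eq (f : ℂ → ℂ) : iteratedDeriv 2 f 0 = d2 f := by
  rw [iteratedDeriv_succ, iteratedDeriv_one]; rfl

theorem diff_deriv {f : ℂ → ℂ} (hf : Differentiable ℂ f) : Differentiable ℂ (deriv f) := by
  have h : DifferentiableOn ℂ f Set.univ := hf.differentiableOn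
  exact differentiableOn_univ.mp (h.deriv isOpen_univ)

theorem d2_add {f g : ℂ → ℂ} (hf : Differentiable ℂ f) (hg : Differentiable ℂ g) :
    d2 (fun z => f z + g z) = d2 f + d2 g := by
  unfold d2
  have : deriv (fun z => f z + g z) = fun z => deriv f z + deriv g z := by
    ext z; exact deriv_fun_add (hf z) (hg z)
  rw [this, deriv_fun_add (diff_deriv hf 0) (diff_deriv hg 0)]

theorem d2_mul {f g : ℂ → ℂ} (hf : Differentiable ℂ f) (hg : Differentiable ℂ g) :
    d2 (fun z => f z * g z) = d2 f * g 0 + 2 * (deriv f 0 * deriv g 0) + f 0 * d2 g := by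
  unfold d2
  have : deriv (fun z => f z * g z) = fun z => deriv f z * g z + f z * deriv g z := by
    ext z; exact deriv_fun_mul (hf z) (hg z)
  have hf' := diff_deriv hf
  have hg' := diff_deriv hg
  rw [this, deriv_fun_add (by fun_prop) (by fun_prop),
    deriv_fun_mul (hf' 0) (hg 0), deriv_fun_mul (hf 0) (hg' 0)]
  ring

theorem d2_const_mul {f : ℂ → ℂ} (c : ℂ) (hf : Differentiable ℂ f) :
    d2 (fun z => c * f z) = c * d2 f := by
  have := d2_mul (f := fun _ => c) (by fun_prop) hf
  rw [this]; simp [d2]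

theorem deriv_even {f : ℂ → ℂ} (he : ∀ z, f (-z) = f z) : deriv f 0 = 0 := by
  have h1 : deriv (fun z => f (-z)) 0 = - deriv f (-0) := deriv_comp_neg f 0
  simp_rw [he] at h1
  rw [neg_zero] at h1
  linear_combination (1/2) * h1

theorem d2_mul_even {f g : ℂ → ℂ} (hf : Differentiable ℂ f) (hg : Differentiable ℂ g) (he : ∀ z, f (-z) = f z) :
    d2 (fun z => f z * g z) = d2 f * g 0 + f 0 * d2 g := by
  rw [d2_mul hf hg, deriv_even he]; ring

theorem d2_comp_mul {f : ℂ → ℂ} (c : ℂ) : d2 (fun z => f (c * z)) = c ^ 2 * d2 f := by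
  unfold d2
  have h1 : deriv (fun z => f (c * z)) = fun z => c * deriv f (c * z) := by
    ext z; exact deriv_comp_mul_left c f z
  rw [h1, deriv_const_mul_field, deriv_comp_mul_left]
  simp; ring

def g0 (τ z : ℂ) : ℂ := jacobiTheta₂ (2 * z) (2 * τ)
def g1 (τ z : ℂ) : ℂ := eC z * jacobiTheta₂ (2 * z + τ) (2 * τ)

theorem UHP_two {τ : ℂ} (h : UHP τ) : 0 < (2 * τ).im := by
  simpa [UHP] using h

theorem g0_hasSum {τ : ℂ} (h : UHP τ) (z : ℂ) :
    HasSum (fun n : ℤ => eC (n ^ 2 * τ + (2 * n) * z)) (g0 τ z) := by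
  have := hasSum_jacobiTheta₂_term (2 * z) (UHP_two h)
  refine (congrArg (fun F => HasSum F _) (funext fun n => ?_)).mpr this
  rw [jacobiTheta₂_term, eC]; ring_nf

theorem g1_hasSum {τ : ℂ} (h : UHP τ) (z : ℂ) :
    HasSum (fun n : ℤ => eC (n * (n + 1) * τ + (2 * n + 1) * z)) (g1 τ z) := by
  have := (hasSum_jacobiTheta₂_term (2 * z + τ) (UHP_two h)).mul_left (eC z)
  refine (congrArg (fun F => HasSum F _) (funext fun n => ?_)).mpr this
  rw [jacobiTheta₂_term, eC, eC, ← Complex.exp_add]; ring_nf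

theorem g0_even (τ z : ℂ) : g0 τ (-z) = g0 τ z := by
  rw [g0, mul_neg, jacobiTheta₂_neg_left, g0]

theorem g1_even (τ z : ℂ) : g1 τ (-z) = g1 τ z := by
  rw [g1, g1, show 2 * z + τ = 2 * z - τ + 2 * τ by ring, jacobiTheta₂_add_left', ← mul_assoc,
    show 2 * -z + τ = -(2 * z - τ) by ring, jacobiTheta₂_neg_left]
  congr 1
  rw [eC, eC, ← Complex.exp_add]; ring_nf

theorem jT_diff {τ : ℂ} (h : 0 < τ.im) : Differentiable ℂ (fun z => jacobiTheta₂ z τ) := by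
  intro z; exact differentiableAt_jacobiTheta₂_fst z h

theorem g0_V {τ : ℂ} (h : UHP τ) : IsV 1 τ (g0 τ) where
  diff := (jT_diff (UHP_two h)).comp (differentiable_id.const_mul 2)
  per z := by
    rw [g0, show 2 * (z + 1) = 2 * z + 1 + 1 by ring, jacobiTheta₂_add_left, jacobiTheta₂_add_left, g0]
  qper z := by
    rw [g0, mul_add, jacobiTheta₂_add_left', g0, eC]; congr 2; push_cast; ring

theorem g1_V {τ : ℂ} (h : UHP τ) : IsV 1 τ (g1 τ) where
  diff := by
    have h1 : Differentiable ℂ (fun z : ℂ => jacobiTheta₂ (2 * z + τ) (2 * τ)) :=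
      (jT_diff (UHP_two h)).comp ((differentiable_id.const_mul 2).add_const τ)
    exact eC_diff.mul h1
  per z := by
    rw [g1, show 2 * (z + 1) + τ = 2 * z + τ + 1 + 1 by ring, jacobiTheta₂_add_left, jacobiTheta₂_add_left, g1,
      eC_add, eC_one, mul_one]
  qper z := by
    rw [g1, show 2 * (z + τ) + τ = 2 * z + τ + 2 * τ by ring, jacobiTheta₂_add_left', g1, ← mul_assoc, ← mul_assoc]
    congr 1
    rw [eC, eC, eC, ← Complex.exp_add, ← Complex.exp_add]; congr 1; push_cast; ring

theorem g0_FC {τ : ℂ} (h : UHP τ) : FC 0 (g0 τ) = 1 ∧ FC 1 (g0 τ) = 0 := by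
  have hs := FC_hasSum (fun n : ℤ => eC (n ^ 2 * τ)) (fun n => 2 * n) (g0 τ) (by
    intro x
    have := g0_hasSum h x
    simp_rw [eC_add] at this
    simpa using this)
  constructor
  · refine (hs 0).unique ?_
    have := hasSum_ite_eq (0:ℤ) (1:ℂ)
    convert this using 2 with n
    by_cases hn : n = 0
    · simp [hn, eC_zero]
    · simp [hn]
  · refine (hs 1).unique ?_
    have : ∀ n : ℤ, ¬ (2 * n = 1) := by intro n; omega
    simp [this, hasSum_zero]

theorem g1_FC {τ : ℂ} (h : UHP τ) : FC 0 (g1 τ) = 0 ∧ FC 1 (g1 τ) = 1 := by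
  have hs := FC_hasSum (fun n : ℤ => eC (n * (n + 1) * τ)) (fun n => 2 * n + 1) (g1 τ) (by
    intro x
    have := g1_hasSum h x
    simp_rw [eC_add] at this
    simpa using this)
  constructor
  · refine (hs 0).unique ?_
    have : ∀ n : ℤ, ¬ (2 * n + 1 = 0) := by intro n; omega
    simp [this, hasSum_zero]
  · refine (hs 1).unique ?_
    have := hasSum_ite_eq (0:ℤ) (1:ℂ)
    convert this using 2 with n
    by_cases hn : n = 0
    · simp [hn, eC_zero]
    · simp [hn]

theorem V1_decomp {τ : ℂ} (h : UHP τ) {v : ℂ → ℂ} (hv : IsV 1 τ v) (he : ∀ z, v (-z) = v z) (z : ℂ) :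
    v z = FC 0 v * g0 τ z + FC 1 v * g1 τ z := by
  have h0 := (g0_V h).const_mul (-FC 0 v)
  have h1 := (g1_V h).const_mul (-FC 1 v)
  have h3 := (hv.add h0).add h1
  have := h3.inj_even one_pos (by intro z; simp only [he, g0_even, g1_even]) (by
    intro a ha
    rw [FC_add _ _ _ (hv.add h0).diff h1.diff, FC_add _ _ _ hv.diff h0.diff, FC_const_mul, FC_const_mul]
    interval_cases a
    · simp only [Nat.cast_zero, (g0_FC h).1, (g1_FC h).1]; ring
    · simp only [Nat.cast_one, (g0_FC h).2, (g1_FC h).2]; ring) z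
  linear_combination this

def Tt (τ z : ℂ) : ℂ := jacobiTheta₂ (z + τ / 2 + 1 / 2) τ

theorem Tt_diff {τ : ℂ} (h : UHP τ) : Differentiable ℂ (Tt τ) :=
  (jT_diff h).comp ((differentiable_id.add_const _).add_const _)

theorem Tt_per (τ z : ℂ) : Tt τ (z + 1) = Tt τ z := by
  rw [Tt, show z + 1 + τ / 2 + 1 / 2 = z + τ / 2 + 1 / 2 + 1 by ring, jacobiTheta₂_add_left, Tt]

theorem exp_neg_pi : Complex.exp (-(Real.pi * I)) = -1 := by
  rw [Complex.exp_neg, Complex.exp_pi_mul_I]; norm_num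

theorem Tt_qper (τ z : ℂ) : Tt τ (z + τ) = - eC (-τ - z) * Tt τ z := by
  rw [Tt, show z + τ + τ / 2 + 1 / 2 = z + τ / 2 + 1 / 2 + τ by ring, jacobiTheta₂_add_left', Tt]
  congr 1
  rw [show -(Real.pi:ℂ) * I * (τ + 2 * (z + τ / 2 + 1 / 2)) = 2 * Real.pi * I * (-τ - z) + (-(Real.pi * I)) by ring,
    Complex.exp_add, exp_neg_pi, eC]; ring

theorem Tt_neg (τ z : ℂ) : Tt τ (-z) = - eC z * Tt τ z := by
  have h1 : Tt τ (-z) = jacobiTheta₂ (z - τ / 2 + 1 / 2) τ := by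
    rw [Tt, ← jacobiTheta₂_neg_left, ← jacobiTheta₂_add_left]; congr 1; ring
  have h2 : Tt τ z = - eC (-z) * jacobiTheta₂ (z - τ / 2 + 1 / 2) τ := by
    rw [Tt, show z + τ / 2 + 1 / 2 = z - τ / 2 + 1 / 2 + τ by ring, jacobiTheta₂_add_left']
    congr 1
    rw [show -(Real.pi:ℂ) * I * (τ + 2 * (z - τ / 2 + 1 / 2)) = 2 * Real.pi * I * (- z) + (-(Real.pi * I)) by ring,
      Complex.exp_add, exp_neg_pi, eC]; ring
  rw [h1, h2, eC_neg]
  field_simp [eC_ne z]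

theorem Tt_zero (τ : ℂ) : Tt τ 0 = 0 := by
  have := Tt_neg τ 0
  rw [neg_zero, eC_zero] at this
  linear_combination (1/2) * this

theorem Tt_ne {τ : ℂ} (h : UHP τ) : ∃ u, Tt τ u ≠ 0 := by
  by_contra! hc
  have hs := FC_hasSum (fun n : ℤ => eC (n ^ 2 * τ / 2)) (fun n => n) (fun z => jacobiTheta₂ z τ) (by
    intro x
    convert hasSum_jacobiTheta₂_term x h using 2 with n
    rw [jacobiTheta₂_term, ← eC_add, eC]; congr 1; ring) 0
  have h1 : FC 0 (fun z => jacobiTheta₂ z τ) = 0 := by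
    have : (fun z => jacobiTheta₂ z τ) = fun _ => 0 := by
      ext z
      have := hc (z - τ / 2 - 1 / 2)
      rw [Tt] at this
      rw [← this]; congr 1; ring
    rw [this]; simp [FC]
  rw [h1] at hs
  have h2 := hasSum_ite_eq (0:ℤ) (1:ℂ)
  have : (0:ℂ) = 1 := hs.unique (by
    convert h2 using 2 with n
    by_cases hn : n = 0 <;> simp [hn, eC_zero])
  exact zero_ne_one this

def Du (τ u z : ℂ) : ℂ := eC z * (Tt τ (z + u) * Tt τ (z - u))

theorem Du_V {τ : ℂ} (h : UHP τ) (u : ℂ) : IsV 1 τ (Du τ u) where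
  diff := by
    have := Tt_diff h
    have := eC_diff
    unfold Du; fun_prop
  per z := by
    rw [Du, Du, eC_add, eC_one, show z + 1 + u = z + u + 1 by ring, show z + 1 - u = z - u + 1 by ring, Tt_per, Tt_per,
      mul_one]
  qper z := by
    rw [Du, Du, show z + τ + u = z + u + τ by ring, show z + τ - u = z - u + τ by ring, Tt_qper, Tt_qper]
    have : eC (-(1:ℕ) * (τ + 2 * z)) * eC z = eC (z + τ) * eC (-τ - (z + u)) * eC (-τ - (z - u)) := by
      rw [← eC_add, ← eC_add, ← eC_add]; congr 1; push_cast; ring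
    linear_combination (-Tt τ (z + u) * Tt τ (z - u)) * this

theorem Du_even (τ u z : ℂ) : Du τ u (-z) = Du τ u z := by
  rw [Du, Du, show -z + u = -(z - u) by ring, show -z - u = -(z + u) by ring, Tt_neg, Tt_neg]
  have : eC z = eC (-z) * eC (z - u) * eC (z + u) := by
    rw [← eC_add, ← eC_add]; congr 1; ring
  linear_combination (-Tt τ (z + u) * Tt τ (z - u)) * this

theorem Du_zero (τ u : ℂ) : Du τ u 0 = - eC u * Tt τ u ^ 2 := by
  rw [Du, zero_add, zero_sub, Tt_neg, eC_zero]; ring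

theorem Du_deriv {τ : ℂ} (h : UHP τ) (u : ℂ) : deriv (Du τ u) u = eC u * Tt τ (2 * u) * deriv (Tt τ) 0 := by
  have ht := Tt_diff h
  have he := eC_diff
  have h1 : deriv (Du τ u) u = deriv (fun z => (eC z * Tt τ (z + u)) * Tt τ (z - u)) u := by
    congr 1; ext z; rw [Du]; ring
  rw [h1, deriv_fun_mul (by fun_prop) (by fun_prop), sub_self, Tt_zero, deriv_comp_sub_const, sub_self,
    ← two_mul]; ring

theorem Tt_deriv_ne {τ : ℂ} (h : UHP τ) : deriv (Tt τ) 0 ≠ 0 := by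
  intro h0
  have hg0 := (g0_V h).diff
  have hg1 := (g1_V h).diff
  have ht := Tt_diff h
  have hg0' := diff_deriv hg0
  have hg1' := diff_deriv hg1
  set W : ℂ → ℂ := fun u => g0 τ u * deriv (g1 τ) u - g1 τ u * deriv (g0 τ) u with hW
  have hWd : Differentiable ℂ W := by rw [hW]; fun_prop
  have hTW : ∀ u, Tt τ u ≠ 0 → W u = 0 := by
    intro u hu
    have hd := V1_decomp h (Du_V h u) (Du_even τ u)
    set α := FC 0 (Du τ u)
    set β := FC 1 (Du τ u)
    have e1 : α * g0 τ u + β * g1 τ u = 0 := by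
      rw [← hd, Du, sub_self, Tt_zero]; ring
    have e2 : α * deriv (g0 τ) u + β * deriv (g1 τ) u = 0 := by
      have h1 := Du_deriv h u
      rw [h0, mul_zero] at h1
      rw [show Du τ u = fun z => α * g0 τ z + β * g1 τ z from funext hd] at h1
      rw [deriv_fun_add (by fun_prop) (by fun_prop), deriv_const_mul_field, deriv_const_mul_field] at h1
      exact h1
    by_contra hne
    have hα : α = 0 := by
      have : α * W u = 0 := by
        simp only [hW]; linear_combination deriv (g1 τ) u * e1 - g1 τ u * e2
      exact (mul_eq_zero.mp this).resolve_right hne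
    have hβ : β = 0 := by
      have : β * W u = 0 := by
        simp only [hW]; linear_combination g0 τ u * e2 - deriv (g0 τ) u * e1
      exact (mul_eq_zero.mp this).resolve_right hne
    have := hd 0
    rw [hα, hβ, Du_zero] at this
    simp [eC_ne, hu] at this
  obtain ⟨u, hu⟩ := Tt_ne h
  -- a ball where Tt ≠ 0
  have hopen : ∀ (f : ℂ → ℂ), Differentiable ℂ f → ∀ w, (∀ᶠ z in nhds w, f z = 0) → ∀ z, f z = 0 := by
    intro f hf w hw z
    have ha : AnalyticOnNhd ℂ f Set.univ := fun z _ => hf.analyticAt z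
    exact ha.eqOn_zero_of_preconnected_of_eventuallyEq_zero isPreconnected_univ (Set.mem_univ w) hw (Set.mem_univ z)
  have hW0 : ∀ z, W z = 0 := by
    apply hopen W hWd u
    filter_upwards [ht.continuous.continuousAt.eventually_ne hu] with z hz using hTW z hz
  have hg0ne : ∃ w, g0 τ w ≠ 0 := by
    by_contra! hc
    have h1 := (g0_FC h).1
    rw [show g0 τ = fun _ => 0 from funext hc] at h1
    simp [FC] at h1
  obtain ⟨w, hw⟩ := hg0ne
  obtain ⟨ε, hε, hball⟩ := Metric.eventually_nhds_iff_ball.mp (hg0.continuous.continuousAt.eventually_ne hw)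
  have hconst : ∀ z ∈ Metric.ball w ε, g1 τ z / g0 τ z = g1 τ w / g0 τ w := by
    intro z hz
    refine Metric.isOpen_ball.is_const_of_deriv_eq_zero (convex_ball w ε).isPreconnected (f := fun z => g1 τ z / g0 τ z) ?_ ?_ hz (Metric.mem_ball_self hε)
    · exact fun z hz => ((hg1 z).div (hg0 z) (hball z hz)).differentiableWithinAt
    · intro z hz
      rw [deriv_fun_div (hg1 z) (hg0 z) (hball z hz)]
      have := hW0 z
      simp only [hW] at this
      rw [show deriv (g1 τ) z * g0 τ z - g1 τ z * deriv (g0 τ) z = 0 by linear_combination this]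
      simp
  have hdep : ∀ z, g0 τ w * g1 τ z + (- g1 τ w) * g0 τ z = 0 := by
    apply hopen _ (by fun_prop) w
    filter_upwards [Metric.ball_mem_nhds w hε] with z hz
    have := hconst z hz
    have hz' := hball z hz
    field_simp at this
    linear_combination this
  have : FC 1 (fun z => g0 τ w * g1 τ z + (- g1 τ w) * g0 τ z) = 0 := by
    simp_rw [hdep]; simp [FC]
  rw [FC_add _ _ _ (by fun_prop) (by fun_prop), FC_const_mul, FC_const_mul, (g0_FC h).2, (g1_FC h).2] at this
  apply hw
  linear_combination this

def Wd (τ : ℂ) : ℂ := g0 τ 0 * d2 (g1 τ) - g1 τ 0 * d2 (g0 τ)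

theorem Wd_ne {τ : ℂ} (h : UHP τ) : Wd τ ≠ 0 := by
  intro h0
  have hg0 := (g0_V h).diff
  have hg1 := (g1_V h).diff
  have ht := Tt_diff h
  have he := eC_diff
  have hd2 : ∀ v : ℂ → ℂ, IsV 1 τ v → (∀ z, v (-z) = v z) → d2 v = FC 0 v * d2 (g0 τ) + FC 1 v * d2 (g1 τ) := by
    intro v hv hev
    conv_lhs => rw [show v = fun z => FC 0 v * g0 τ z + FC 1 v * g1 τ z from funext (V1_decomp h hv hev)]
    rw [d2_add (by fun_prop) (by fun_prop), d2_const_mul _ hg0, d2_const_mul _ hg1]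
  obtain ⟨u, hu⟩ := Tt_ne h
  have a1 := V1_decomp h (Du_V h 0) (Du_even τ 0) 0
  have a2 := hd2 _ (Du_V h 0) (Du_even τ 0)
  have b1 := V1_decomp h (Du_V h u) (Du_even τ u) 0
  have b2 := hd2 _ (Du_V h u) (Du_even τ u)
  have c1 : d2 (Du τ 0) = 2 * deriv (Tt τ) 0 ^ 2 := by
    rw [show Du τ 0 = fun z => eC z * (Tt τ z * Tt τ z) from funext fun z => by rw [Du, add_zero, sub_zero],
      d2_mul he (by fun_prop), d2_mul ht ht, deriv_fun_mul (ht 0) (ht 0), Tt_zero, eC_zero]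
    ring
  have c2 : Du τ 0 0 = 0 := by rw [Du_zero, Tt_zero]; simp
  have key : Du τ u 0 * d2 (Du τ 0) = 0 := by
    have : Du τ u 0 * d2 (Du τ 0) - Du τ 0 0 * d2 (Du τ u) =
      (FC 0 (Du τ u) * FC 1 (Du τ 0) - FC 1 (Du τ u) * FC 0 (Du τ 0)) * Wd τ := by
      rw [a1, a2, b1, b2, Wd]; ring
    rw [h0, c2] at this
    linear_combination this
  rw [c1, Du_zero] at key
  simp [eC_ne, hu, Tt_deriv_ne h] at key

theorem entire_zero_of_nhds (f : ℂ → ℂ) (hf : Differentiable ℂ f) (w : ℂ)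
    (hw : ∀ᶠ z in nhds w, f z = 0) (z : ℂ) : f z = 0 := by
  have ha : AnalyticOnNhd ℂ f Set.univ := fun z _ => hf.analyticAt z
  exact ha.eqOn_zero_of_preconnected_of_eventuallyEq_zero isPreconnected_univ (Set.mem_univ w) hw (Set.mem_univ z)

theorem t_infinite {a b : ℂ → ℂ} (ha : Differentiable ℂ a) (hb : Differentiable ℂ b)
    (ha0 : a 0 = 0) (hb0 : b 0 = 1) (hne : ∃ z, a z ≠ 0) :
    ((fun z => a z / b z) '' {z | b z ≠ 0}).Infinite := by
  have hb0' : b 0 ≠ 0 := by rw [hb0]; exact one_ne_zero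
  obtain ⟨ε, hε, hball⟩ := Metric.eventually_nhds_iff_ball.mp (hb.continuous.continuousAt.eventually_ne hb0')
  have hsub : (fun z => a z / b z) '' Metric.ball 0 ε ⊆ (fun z => a z / b z) '' {z | b z ≠ 0} :=
    Set.image_mono hball
  refine Set.Infinite.mono hsub ?_
  have hc : ContinuousOn (fun z => a z / b z) (Metric.ball 0 ε) :=
    ha.continuous.continuousOn.div hb.continuous.continuousOn hball
  refine ((convex_ball (0:ℂ) ε).isPreconnected.image _ hc).infinite_of_nontrivial ?_
  by_contra hnt
  rw [Set.not_nontrivial_iff] at hnt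
  obtain ⟨w, hw⟩ := hne
  apply hw
  apply entire_zero_of_nhds a ha 0
  filter_upwards [Metric.ball_mem_nhds 0 hε] with z hz
  have h1 := hnt (Set.mem_image_of_mem _ hz) (Set.mem_image_of_mem _ (Metric.mem_ball_self hε))
  simp only [ha0, zero_div] at h1
  exact (div_eq_zero_iff.mp h1).resolve_right (hball z hz)

theorem poly_indep {a b : ℂ → ℂ} (ha : Differentiable ℂ a) (hb : Differentiable ℂ b)
    (ha0 : a 0 = 0) (hb0 : b 0 = 1) (hne : ∃ z, a z ≠ 0) (m : ℕ) (p : Fin (m + 1) → ℂ)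
    (h : ∀ z, ∑ i : Fin (m + 1), p i * (a z ^ (i:ℕ) * b z ^ (m - i)) = 0) : p = 0 := by
  have hinf := t_infinite ha hb ha0 hb0 hne
  let P : Polynomial ℂ := ∑ i : Fin (m + 1), Polynomial.C (p i) * Polynomial.X ^ (i:ℕ)
  have hP : P = 0 := by
    apply Polynomial.eq_zero_of_infinite_isRoot
    refine hinf.mono ?_
    rintro _ ⟨z, hz, rfl⟩
    simp only [Set.mem_ofPred_eq] at hz
    have h1 : b z ^ m * P.eval (a z / b z) = 0 := by
      rw [← h z]
      simp only [P, Polynomial.eval_finsetSum, Finset.mul_sum]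
      apply Finset.sum_congr rfl
      intro i _
      simp only [Polynomial.eval_mul, Polynomial.eval_C, Polynomial.eval_pow, Polynomial.eval_X]
      have : b z ^ m = b z ^ (m - (i:ℕ)) * b z ^ (i:ℕ) := by
        rw [← pow_add]; congr 1; omega
      rw [this, div_pow]
      field_simp
    exact (mul_eq_zero.mp h1).resolve_left (pow_ne_zero _ hz)
  ext i
  have := congrArg (fun Q => Polynomial.coeff Q (i:ℕ)) hP
  simp only [P, Polynomial.finsetSum_coeff, Polynomial.coeff_C_mul_X_pow, Polynomial.coeff_zero] at this
  rw [Finset.sum_eq_single i] at this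
  · simpa using this
  · intro j _ hj
    rw [if_neg]
    intro hc; exact hj (Fin.ext hc.symm)
  · simp

def aT (τ z : ℂ) : ℂ := (2 * g0 τ 0 / Wd τ) * g1 τ z + (-(2 * g1 τ 0 / Wd τ)) * g0 τ z
def bT (τ z : ℂ) : ℂ := (d2 (g1 τ) / Wd τ) * g0 τ z + (-(d2 (g0 τ) / Wd τ)) * g1 τ z

theorem aT_V {τ : ℂ} (h : UHP τ) : IsV 1 τ (aT τ) := ((g1_V h).const_mul _).add ((g0_V h).const_mul _)
theorem bT_V {τ : ℂ} (h : UHP τ) : IsV 1 τ (bT τ) := ((g0_V h).const_mul _).add ((g1_V h).const_mul _)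
theorem aT_even (τ z : ℂ) : aT τ (-z) = aT τ z := by simp only [aT, g0_even, g1_even]
theorem bT_even (τ z : ℂ) : bT τ (-z) = bT τ z := by simp only [bT, g0_even, g1_even]
theorem aT_zero (τ : ℂ) : aT τ 0 = 0 := by rw [aT]; ring
theorem bT_zero {τ : ℂ} (h : UHP τ) : bT τ 0 = 1 := by
  have := Wd_ne h
  rw [bT]; field_simp; rw [Wd]; ring
theorem aT_d2 {τ : ℂ} (h : UHP τ) : d2 (aT τ) = 2 := by
  have := Wd_ne h
  have hg0 := (g0_V h).diff
  have hg1 := (g1_V h).diff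
  unfold aT
  rw [d2_add (by fun_prop) (by fun_prop), d2_const_mul _ hg0, d2_const_mul _ hg1]
  field_simp; rw [Wd]; ring
theorem bT_d2 {τ : ℂ} (h : UHP τ) : d2 (bT τ) = 0 := by
  have hg0 := (g0_V h).diff
  have hg1 := (g1_V h).diff
  unfold bT
  rw [d2_add (by fun_prop) (by fun_prop), d2_const_mul _ hg0, d2_const_mul _ hg1]
  ring
theorem aT_ne {τ : ℂ} (h : UHP τ) : ∃ z, aT τ z ≠ 0 := by
  by_contra! hc
  have := aT_d2 h
  rw [show aT τ = fun _ => 0 from funext hc] at this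
  simp [d2] at this

theorem V1_taylor {τ : ℂ} (h : UHP τ) {v : ℂ → ℂ} (hv : IsV 1 τ v) (he : ∀ z, v (-z) = v z) (z : ℂ) :
    v z = v 0 * bT τ z + d2 v / 2 * aT τ z := by
  have hg0 := (g0_V h).diff
  have hg1 := (g1_V h).diff
  have hd := V1_decomp h hv he
  have hd2 : d2 v = FC 0 v * d2 (g0 τ) + FC 1 v * d2 (g1 τ) := by
    conv_lhs => rw [show v = fun z => FC 0 v * g0 τ z + FC 1 v * g1 τ z from funext hd]
    rw [d2_add (by fun_prop) (by fun_prop), d2_const_mul _ hg0, d2_const_mul _ hg1]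
  have hw := Wd_ne h
  rw [hd z, hd 0, hd2, aT, bT]
  field_simp
  rw [Wd]; ring

/-- the basis functions `a^i b^(m-i)` -/
def bas (m : ℕ) (i : ℕ) (τ z : ℂ) : ℂ := aT τ z ^ i * bT τ z ^ (m - i)

theorem bas_V {m i : ℕ} (hi : i ≤ m) {τ : ℂ} (h : UHP τ) : IsV m τ (bas m i τ) := by
  have := ((aT_V h).pow i).mul ((bT_V h).pow (m - i))
  rw [one_mul, one_mul, Nat.add_sub_cancel' hi] at this
  exact this

theorem bas_even (m i : ℕ) (τ z : ℂ) : bas m i τ (-z) = bas m i τ z := by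
  simp only [bas, aT_even, bT_even]

def Mat (m : ℕ) (τ : ℂ) : Matrix (Fin (m + 1)) (Fin (m + 1)) ℂ :=
  Matrix.of fun r i => FC ((r : ℕ) : ℤ) (bas m i τ)

theorem Mat_det_ne {m : ℕ} (hm : 0 < m) {τ : ℂ} (h : UHP τ) : (Mat m τ).det ≠ 0 := by
  intro h0
  obtain ⟨p, hp, hMp⟩ := Matrix.exists_mulVec_eq_zero_iff.mpr h0
  apply hp
  have hV : IsV m τ (fun z => ∑ i : Fin (m + 1), p i * bas m i τ z) :=
    IsV.sum _ _ fun i _ => (bas_V (by omega) h).const_mul _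
  apply poly_indep (aT_V h).diff (bT_V h).diff (aT_zero τ) (bT_zero h) (aT_ne h) m p
  change ∀ z, ∑ i : Fin (m + 1), p i * bas m i τ z = 0
  refine hV.inj_even hm (by intro z; simp only [bas_even]) ?_
  intro r hr
  have h1 := congrFun hMp ⟨r, by omega⟩
  rw [FC_sum _ _ _ (fun i => ((bas_V (by omega) h).const_mul _).diff)]
  simp only [FC_const_mul]
  simp only [Matrix.mulVec, dotProduct, Mat, Matrix.of_apply, Pi.zero_apply] at h1
  rw [← h1]
  exact Finset.sum_congr rfl fun i _ => mul_comm _ _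

/-- coefficient vector -/
def coefV (m : ℕ) (τ : ℂ) (v : ℂ → ℂ) : Fin (m + 1) → ℂ :=
  ((Mat m τ).det)⁻¹ • ((Mat m τ).adjugate.mulVec (fun r => FC ((r : ℕ) : ℤ) v))

theorem coefV_spec {m : ℕ} (hm : 0 < m) {τ : ℂ} (h : UHP τ) {v : ℂ → ℂ} (hv : IsV m τ v)
    (he : ∀ z, v (-z) = v z) (z : ℂ) : v z = ∑ i : Fin (m + 1), coefV m τ v i * bas m i τ z := by
  have hdet := Mat_det_ne hm h
  have hmul : (Mat m τ).mulVec (coefV m τ v) = fun r : Fin (m + 1) => FC ((r : ℕ) : ℤ) v := by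
    rw [coefV, Matrix.mulVec_smul, Matrix.mulVec_mulVec, Matrix.mul_adjugate, Matrix.smul_mulVec,
      Matrix.one_mulVec, smul_smul, inv_mul_cancel₀ hdet, one_smul]
  have hV : IsV m τ (fun z => ∑ i : Fin (m + 1), coefV m τ v i * bas m i τ z) :=
    IsV.sum _ _ fun i _ => (bas_V (by omega) h).const_mul _
  have hneg := hV.const_mul (-1)
  have := (hv.add hneg).inj_even hm (by intro z; simp only [bas_even, he]) (by
    intro r hr
    have h1 := congrFun hmul ⟨r, by omega⟩
    rw [FC_add _ _ _ hv.diff hneg.diff, FC_const_mul,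
      FC_sum _ _ _ (fun i => ((bas_V (by omega) h).const_mul _).diff)]
    simp only [FC_const_mul]
    simp only [Matrix.mulVec, dotProduct, Mat, Matrix.of_apply] at h1
    rw [← h1]
    simp_rw [mul_comm (coefV m τ v _)]
    ring) z
  linear_combination this

theorem uniq_two {τ : ℂ} (h : UHP τ) (F : ℂ → ℂ → ℂ) (hsym : ∀ x y, F x y = F y x)
    (hV : ∀ y, IsV 2 τ (fun x => F x y)) (he : ∀ x y, F (-x) y = F x y)
    (h0 : ∀ x, F x 0 = 0) (hd : ∀ x, F x x = 0) : ∀ x y, F x y = 0 := by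
  have hinf := t_infinite (aT_V h).diff (bT_V h).diff (aT_zero τ) (bT_zero h) (aT_ne h)
  have hex : ∀ y, ∃ P1 P2 : ℂ, ∀ x, F x y = P1 * (aT τ x * bT τ x) + P2 * aT τ x ^ 2 := by
    intro y
    have h1 := coefV_spec (by norm_num) h (hV y) (fun x => he x y)
    refine ⟨coefV 2 τ (fun x => F x y) 1, coefV 2 τ (fun x => F x y) 2, ?_⟩
    have hz := h1 0
    rw [Fin.sum_univ_three] at hz
    simp [bas, aT_zero, bT_zero h, hsym 0 y, h0] at hz
    intro x
    rw [h1 x, Fin.sum_univ_three]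
    simp [bas, ← hz]
  choose P1 P2 hP using hex
  -- points with ab ≠ 0
  have hrel : ∀ y, aT τ y ≠ 0 → bT τ y ≠ 0 → ∀ x, F x y * bT τ y = P2 y * aT τ x * (aT τ x * bT τ y - aT τ y * bT τ x) := by
    intro y hay hby x
    have h1 := hd y
    rw [hP] at h1
    have h2 : P1 y * bT τ y = - P2 y * aT τ y := by
      apply mul_left_cancel₀ hay
      linear_combination h1
    rw [hP]
    linear_combination (aT τ x * bT τ x) * h2
  have hQ : ∀ x y, aT τ x ≠ 0 → bT τ x ≠ 0 → aT τ y ≠ 0 → bT τ y ≠ 0 → aT τ x / bT τ x ≠ aT τ y / bT τ y →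
      P2 y / (aT τ y * bT τ y) = - (P2 x / (aT τ x * bT τ x)) := by
    intro x y hax hbx hay hby hne
    have h1 := hrel y hay hby x
    have h2 := hrel x hax hbx y
    rw [hsym y x] at h2
    have h3 : aT τ x * bT τ y - aT τ y * bT τ x ≠ 0 := by
      intro hc; apply hne
      rw [div_eq_div_iff hbx hby]; linear_combination hc
    have h4 : (P2 y * (aT τ x * bT τ x) + P2 x * (aT τ y * bT τ y)) = 0 := by
      apply mul_left_cancel₀ h3
      linear_combination (-bT τ x) * h1 + bT τ y * h2
    field_simp
    linear_combination h4
  have hzero : ∀ y, aT τ y ≠ 0 → bT τ y ≠ 0 → ∀ x, F x y = 0 := by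
    intro y hay hby
    obtain ⟨_, ⟨x, hbx, rfl⟩, hx⟩ := hinf.exists_notMem_finset {0, aT τ y / bT τ y}
    obtain ⟨_, ⟨w, hbw, rfl⟩, hw⟩ := hinf.exists_notMem_finset {0, aT τ y / bT τ y, aT τ x / bT τ x}
    simp only [Finset.mem_insert, Finset.mem_singleton, not_or, div_eq_zero_iff] at hx hw
    have q1 := hQ x y hx.1.1 hbx hay hby hx.2
    have q2 := hQ w y hw.1.1 hbw hay hby hw.2.1
    have q3 := hQ w x hw.1.1 hbw hx.1.1 hbx hw.2.2
    have q4 : P2 y / (aT τ y * bT τ y) = 0 := by linear_combination (1/2) * (q1 + q2 - q3)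
    have q5 : P2 y = 0 := by
      rcases div_eq_zero_iff.mp q4 with q | q
      · exact q
      · exact absurd q (mul_ne_zero hay hby)
    intro x'
    have := hrel y hay hby x'
    rw [q5] at this
    have h6 : F x' y * bT τ y = 0 := by linear_combination this
    exact (mul_eq_zero.mp h6).resolve_right hby
  obtain ⟨_, ⟨w, hbw, rfl⟩, hw⟩ := hinf.exists_notMem_finset {0}
  simp only [Finset.mem_singleton, div_eq_zero_iff, not_or] at hw
  intro x y
  have hdf : Differentiable ℂ (fun y => F x y) := by
    have := (hV x).diff
    simp_rw [hsym _ x] at this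
    exact this
  apply entire_zero_of_nhds (fun y => F x y) hdf w
  filter_upwards [(aT_V h).diff.continuous.continuousAt.eventually_ne hw.1,
    (bT_V h).diff.continuous.continuousAt.eventually_ne hbw] with y h1 h2 using hzero y h1 h2 x

theorem regroup {J ι X : Type} (w : J → ℂ) (φ : J → ι) (χ : ι → X → ℂ) (S : Set X) (F : X → ℂ)
    (h : ∀ p ∈ S, HasSum (fun j => w j * χ (φ j) p) (F p)) :
    ∃ e : ι → ℂ, (∀ k, (∀ j, φ j = k → w j = 0) → e k = 0) ∧
      ∀ p ∈ S, HasSum (fun k => e k * χ k p) (F p) := by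
  refine ⟨fun k => ∑' j : φ ⁻¹' {k}, w j, ?_, ?_⟩
  · intro k hk
    refine (tsum_congr (fun j : φ ⁻¹' {k} => hk j.1 j.2)).trans tsum_zero
  · intro p hp
    refine (congrArg (fun F => HasSum F _) (funext fun k => ?_)).mpr ((h p hp).tsum_fiberwise φ)
    rw [← tsum_mul_right]
    refine tsum_congr fun j => ?_
    have : φ j.1 = k := j.2
    rw [this]

def chi (i : ℕ × ℤ × ℤ) (τ x y : ℂ) : ℂ := eC (i.1 * τ + i.2.1 * x + i.2.2 * y)

theorem chi_add (i j : ℕ × ℤ × ℤ) (τ x y : ℂ) : chi (i + j) τ x y = chi i τ x y * chi j τ x y := by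
  unfold chi; rw [← eC_add]; congr 1; simp only [Prod.fst_add, Prod.snd_add]; push_cast; ring

def FS (F : ℂ → ℂ → ℂ → ℂ) : Prop := ∃ c : ℕ × ℤ × ℤ → ℂ, ∀ τ x y, UHP τ →
  HasSum (fun i => c i * chi i τ x y) (F τ x y)

theorem FS_of {J : Type} (w : J → ℂ) (φ : J → ℕ × ℤ × ℤ) {F : ℂ → ℂ → ℂ → ℂ}
    (h : ∀ τ x y, UHP τ → HasSum (fun j => w j * chi (φ j) τ x y) (F τ x y)) : FS F := by
  obtain ⟨e, -, he⟩ := regroup w φ (fun i (p : ℂ × ℂ × ℂ) => chi i p.1 p.2.1 p.2.2) {p | UHP p.1}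
    (fun p => F p.1 p.2.1 p.2.2) (fun p hp => h _ _ _ hp)
  exact ⟨e, fun τ x y hτ => he (τ, x, y) hτ⟩

theorem FS.congr {F G : ℂ → ℂ → ℂ → ℂ} (hF : FS F) (h : ∀ τ x y, UHP τ → G τ x y = F τ x y) : FS G := by
  obtain ⟨c, hc⟩ := hF
  exact ⟨c, fun τ x y hτ => by rw [h τ x y hτ]; exact hc τ x y hτ⟩

theorem FS.add {F G : ℂ → ℂ → ℂ → ℂ} (hF : FS F) (hG : FS G) : FS (fun τ x y => F τ x y + G τ x y) := by
  obtain ⟨c, hc⟩ := hF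
  obtain ⟨d, hd⟩ := hG
  exact ⟨fun i => c i + d i, fun τ x y hτ => by
    simpa only [add_mul] using (hc τ x y hτ).add (hd τ x y hτ)⟩

theorem FS.mul {F G : ℂ → ℂ → ℂ → ℂ} (hF : FS F) (hG : FS G) : FS (fun τ x y => F τ x y * G τ x y) := by
  obtain ⟨c, hc⟩ := hF
  obtain ⟨d, hd⟩ := hG
  refine FS_of (J := (ℕ × ℤ × ℤ) × (ℕ × ℤ × ℤ)) (fun j => c j.1 * d j.2) (fun j => j.1 + j.2) ?_
  intro τ x y hτ
  have h1 := (hc τ x y hτ)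
  have h2 := (hd τ x y hτ)
  have h3 := summable_mul_of_summable_norm h1.summable.norm h2.summable.norm
  have h4 := h1.mul h2 h3
  refine (congrArg (fun F => HasSum F _) (funext fun k => ?_)).mpr h4
  rw [chi_add]; ring

theorem FS.const (a : ℂ) : FS (fun _ _ _ => a) := by
  refine FS_of (J := Unit) (fun _ => a) (fun _ => 0) ?_
  intro τ x y _
  simp [chi, eC_zero]

theorem FS.pow {F : ℂ → ℂ → ℂ → ℂ} (hF : FS F) (n : ℕ) : FS (fun τ x y => F τ x y ^ n) := by
  induction n with
  | zero => simpa using FS.const 1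
  | succ n ih => simpa only [pow_succ] using ih.mul hF

theorem FS.sum {ι : Type} (s : Finset ι) (F : ι → ℂ → ℂ → ℂ → ℂ) (hF : ∀ i ∈ s, FS (F i)) :
    FS (fun τ x y => ∑ i ∈ s, F i τ x y) := by
  classical
  induction s using Finset.induction_on with
  | empty => simpa using FS.const 0
  | insert a s ha ih =>
    simp only [Finset.sum_insert ha]
    exact (hF a (by simp)).add (ih fun i hi => hF i (by simp [hi]))

theorem FS.swap {F : ℂ → ℂ → ℂ → ℂ} (hF : FS F) : FS (fun τ x y => F τ y x) := by
  obtain ⟨c, hc⟩ := hF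
  refine FS_of c (fun i => (i.1, i.2.2, i.2.1)) ?_
  intro τ x y hτ
  refine (congrArg (fun F => HasSum F _) (funext fun k => ?_)).mpr (hc τ y x hτ)
  unfold chi; congr 2; simp only; ring

/-- holomorphic one-periodic functions with a limit at the cusp -/
structure IsR (f : ℂ → ℂ) (l : ℂ) : Prop where
  holo : DifferentiableOn ℂ f {τ | UHP τ}
  per : ∀ τ, UHP τ → f (τ + 1) = f τ
  lim : Filter.Tendsto f (Filter.comap Complex.im Filter.atTop) (nhds l)

theorem IsR.const (a : ℂ) : IsR (fun _ => a) a := ⟨by fun_prop, fun _ _ => rfl, tendsto_const_nhds⟩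
theorem IsR.add {f g l l'} (hf : IsR f l) (hg : IsR g l') : IsR (fun τ => f τ + g τ) (l + l') :=
  ⟨hf.holo.add hg.holo, fun τ h => by simp only [hf.per τ h, hg.per τ h], hf.lim.add hg.lim⟩
theorem IsR.mul {f g l l'} (hf : IsR f l) (hg : IsR g l') : IsR (fun τ => f τ * g τ) (l * l') :=
  ⟨hf.holo.mul hg.holo, fun τ h => by simp only [hf.per τ h, hg.per τ h], hf.lim.mul hg.lim⟩
theorem IsR.const_mul {f l} (a : ℂ) (hf : IsR f l) : IsR (fun τ => a * f τ) (a * l) := (IsR.const a).mul hf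
theorem IsR.inv {f l} (hf : IsR f l) (h0 : ∀ τ, UHP τ → f τ ≠ 0) (hl : l ≠ 0) : IsR (fun τ => (f τ)⁻¹) l⁻¹ :=
  ⟨hf.holo.inv h0, fun τ h => by simp only [hf.per τ h], hf.lim.inv₀ hl⟩
theorem IsR.pow {f l} (hf : IsR f l) (n : ℕ) : IsR (fun τ => f τ ^ n) (l ^ n) :=
  ⟨hf.holo.pow n, fun τ h => by simp only [hf.per τ h], hf.lim.pow n⟩
theorem IsR.sum {ι : Type} (s : Finset ι) (f : ι → ℂ → ℂ) (l : ι → ℂ) (hf : ∀ i ∈ s, IsR (f i) (l i)) :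
    IsR (fun τ => ∑ i ∈ s, f i τ) (∑ i ∈ s, l i) := by
  classical
  induction s using Finset.induction_on with
  | empty => simpa using IsR.const 0
  | insert a s ha ih =>
    simp only [Finset.sum_insert ha]
    exact (hf a (by simp)).add (ih fun i hi => hf i (by simp [hi]))
theorem IsR.prod {ι : Type} (s : Finset ι) (f : ι → ℂ → ℂ) (l : ι → ℂ) (hf : ∀ i ∈ s, IsR (f i) (l i)) :
    IsR (fun τ => ∏ i ∈ s, f i τ) (∏ i ∈ s, l i) := by
  classical
  induction s using Finset.induction_on with
  | empty => simpa using IsR.const 1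
  | insert a s ha ih =>
    simp only [Finset.prod_insert ha]
    exact (hf a (by simp)).mul (ih fun i hi => hf i (by simp [hi]))
theorem UHP_ev : ∀ᶠ τ in Filter.comap Complex.im Filter.atTop, UHP τ :=
  Filter.tendsto_comap.eventually (Filter.eventually_gt_atTop 0)
instance : (Filter.comap Complex.im Filter.atTop).NeBot :=
  Filter.comap_neBot (fun t ht => by
    obtain ⟨a, ha⟩ := (Filter.mem_atTop_sets.mp ht)
    exact ⟨⟨0, a⟩, ha a le_rfl⟩)
theorem UHP_open : IsOpen {τ | UHP τ} := isOpen_lt continuous_const Complex.continuous_im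
theorem UHP_add1 {τ : ℂ} (h : UHP τ) : UHP (τ + 1) := by simpa [UHP] using h
theorem IsR.congr {f g l} (hf : IsR f l) (h : ∀ τ, UHP τ → g τ = f τ) : IsR g l :=
  ⟨hf.holo.congr h, fun τ ht => by rw [h _ (UHP_add1 ht), h _ ht, hf.per τ ht],
    hf.lim.congr' (UHP_ev.mono fun τ ht => (h τ ht).symm)⟩
theorem IsR.lim_unique {f l l'} (hf : IsR f l) (hf' : IsR f l') : l = l' := tendsto_nhds_unique hf.lim hf'.lim

theorem IsR.det {n : ℕ} (A : ℂ → Matrix (Fin n) (Fin n) ℂ) (L : Matrix (Fin n) (Fin n) ℂ)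
    (h : ∀ i j, IsR (fun τ => A τ i j) (L i j)) : IsR (fun τ => (A τ).det) L.det := by
  simp only [Matrix.det_apply']
  exact IsR.sum _ _ _ fun σ _ => (IsR.prod _ _ _ fun i _ => h _ _).const_mul _

theorem IsR_of {J : Type} (w : J → ℂ) (n : J → ℕ) {f : ℂ → ℂ}
    (h : ∀ τ, UHP τ → HasSum (fun j => w j * eC (n j * τ)) (f τ)) :
    IsR f (∑' j, if n j = 0 then w j else 0) := by
  have he := eC_diff
  have hb : ∀ y : ℝ, 0 < y → ∀ τ : ℂ, y ≤ τ.im → ∀ j, ‖w j * eC (n j * τ)‖ ≤ ‖w j * eC (n j * (y * I))‖ := by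
    intro y hy τ hτ j
    rw [norm_mul, norm_mul, eC_norm, eC_norm]
    gcongr ?_ * Real.exp ?_
    simp
    gcongr
  have hs : ∀ y : ℝ, 0 < y → Summable fun j => ‖w j * eC (n j * (y * I))‖ := fun y hy =>
    (h (y * I) (by simpa [UHP] using hy)).summable.norm
  refine ⟨?_, ?_, ?_⟩
  · intro τ hτ
    have hτ' : 0 < τ.im := hτ
    have hU : IsOpen {t : ℂ | τ.im / 2 < t.im} := isOpen_lt continuous_const Complex.continuous_im
    have h1 := differentiableOn_tsum_of_summable_norm (hs (τ.im / 2) (by positivity))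
      (F := fun j t => w j * eC (n j * t)) (U := {t : ℂ | τ.im / 2 < t.im})
      (fun j => by
        have : Differentiable ℂ fun t => w j * eC (n j * t) := by fun_prop
        exact this.differentiableOn)
      hU (fun j t ht => hb _ (by positivity) t (le_of_lt ht) j)
    have h2 : DifferentiableAt ℂ f τ := by
      refine (h1.differentiableAt (hU.mem_nhds (by simp; linarith))).congr_of_eventuallyEq ?_
      filter_upwards [UHP_open.mem_nhds hτ] with t ht
      exact (h t ht).tsum_eq.symm
    exact h2.differentiableWithinAt
  · intro τ hτ
    refine (h _ (UHP_add1 hτ)).unique ?_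
    refine (congrArg (fun F => HasSum F _) (funext fun k => ?_)).mpr (h τ hτ)
    congr 1
    exact eC_congr (n k) (by push_cast; ring)
  · have h1 : Filter.Tendsto (fun τ => ∑' j, w j * eC (n j * τ)) (Filter.comap Complex.im Filter.atTop)
        (nhds (∑' j, if n j = 0 then w j else 0)) := by
      refine tendsto_tsum_of_dominated_convergence (hs 1 one_pos) ?_ ?_
      · intro j
        by_cases hj : n j = 0
        · simp [hj, eC_zero]
        · simp only [hj, if_false]
          have : Filter.Tendsto (fun τ => eC (n j * τ)) (Filter.comap Complex.im Filter.atTop) (nhds 0) := by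
            rw [tendsto_zero_iff_norm_tendsto_zero]
            simp only [eC_norm]
            refine Real.tendsto_exp_neg_atTop_nhds_zero.comp ?_
            have : ∀ τ : ℂ, 2 * Real.pi * ((n j : ℂ) * τ).im = (2 * Real.pi * n j) * τ.im := by
              intro τ; simp; ring
            simp only [this]
            have hp : 0 < 2 * Real.pi * n j := by
              have := Nat.pos_of_ne_zero hj
              have := Real.pi_pos
              positivity
            exact (Filter.tendsto_id.const_mul_atTop hp).comp Filter.tendsto_comap
          simpa using this.const_mul (w j)
      · filter_upwards [Filter.tendsto_comap.eventually (Filter.eventually_ge_atTop (1:ℝ))] with τ hτ j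
        exact hb 1 one_pos τ hτ j
    refine h1.congr' (UHP_ev.mono fun τ ht => (h τ ht).tsum_eq)

theorem IsR.qser {f l} (hf : IsR f l) : ∃ c : ℕ → ℂ, ∀ τ, UHP τ → HasSum (fun n => c n * eC (n * τ)) (f τ) := by
  let g : UpperHalfPlane → ℂ := fun t => f t
  have h1 : Function.Periodic (g ∘ UpperHalfPlane.ofComplex) ((1:ℝ):ℂ) := by
    intro t
    simp only [Function.comp, g]
    by_cases ht : UHP t
    · rw [UpperHalfPlane.ofComplex_apply_of_im_pos ht, UpperHalfPlane.ofComplex_apply_of_im_pos (by simpa [UHP] using ht)]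
      simpa using hf.per t ht
    · have ht' : t.im ≤ 0 := not_lt.mp ht
      rw [UpperHalfPlane.ofComplex_apply_of_im_nonpos ht', UpperHalfPlane.ofComplex_apply_of_im_nonpos (by simpa using ht')]
  have h2 : MDifferentiable (modelWithCornersSelf ℂ ℂ) (modelWithCornersSelf ℂ ℂ) g := by
    rw [UpperHalfPlane.mdifferentiable_iff]
    refine hf.holo.congr ?_
    intro t ht
    simp only [Function.comp, g]
    rw [UpperHalfPlane.ofComplex_apply_of_im_pos ht]
  have h3 : UpperHalfPlane.IsBoundedAtImInfty g := by
    rw [UpperHalfPlane.isBoundedAtImInfty_iff]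
    obtain ⟨M, hM⟩ := hf.lim.norm.isBoundedUnder_le
    have hM : ∀ᶠ τ in Filter.comap Complex.im Filter.atTop, ‖f τ‖ ≤ M := by simpa using hM
    rw [Filter.eventually_comap] at hM
    obtain ⟨A, hA⟩ := Filter.eventually_atTop.mp hM
    exact ⟨M, A, fun z hz => hA _ hz z rfl⟩
  refine ⟨fun n => (UpperHalfPlane.qExpansion 1 g).coeff n, fun τ hτ => ?_⟩
  have := UpperHalfPlane.hasSum_qExpansion (f := g) one_pos h1 h2 h3 ⟨τ, hτ⟩
  refine (congrArg (fun F => HasSum F _) (funext fun k => ?_)).mpr this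
  rw [smul_eq_mul, eC_nat_mul]
  congr 2
  simp [eC, Function.Periodic.qParam]

theorem FS_of_R {f l} (hf : IsR f l) : FS (fun τ _ _ => f τ) := by
  obtain ⟨c, hc⟩ := hf.qser
  refine FS_of c (fun n => (n, 0, 0)) ?_
  intro τ x y hτ
  simpa [chi] using hc τ hτ

theorem hasSum_dz {ι : Type} (c : ι → ℂ) (r : ι → ℤ) (f : ℂ → ℂ)
    (h : ∀ z : ℂ, HasSum (fun i => c i * eC (r i * z)) (f z)) (z : ℂ) :
    HasSum (fun i => (c i * (2 * Real.pi * I * r i)) * eC (r i * z)) (deriv f z) := by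
  have he := eC_diff
  have hU : IsOpen {t : ℂ | |t.im - z.im| < 1} :=
    isOpen_lt ((Complex.continuous_im.sub continuous_const).abs) continuous_const
  have h1 := hasSum_deriv_of_summable_norm (z := z) (F := fun i t => c i * eC (r i * t))
    (u := fun i => ‖c i * eC (r i * (z + I))‖ + ‖c i * eC (r i * (z - I))‖)
    ((h (z + I)).summable.norm.add (h (z - I)).summable.norm)
    (fun i => by
        have : Differentiable ℂ fun t => c i * eC (r i * t) := by fun_prop
        exact this.differentiableOn) hU (by
      intro i w hw
      simp only [Set.mem_ofPred_eq, abs_lt] at hw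
      simp only [norm_mul, eC_norm, ← mul_add]
      gcongr
      have e1 : ∀ t : ℂ, ((r i : ℂ) * t).im = r i * t.im := by intro t; simp
      simp only [e1, Complex.add_im, Complex.sub_im, Complex.I_im]
      have hp := Real.pi_pos
      rcases le_total 0 (r i) with hr | hr
      · have hr : (0:ℝ) ≤ r i := by exact_mod_cast hr
        refine le_trans ?_ (le_add_of_nonneg_left (Real.exp_pos _).le)
        apply Real.exp_le_exp.mpr
        have : (r i:ℝ) * (z.im - 1) ≤ r i * w.im := by gcongr; linarith
        nlinarith
      · have hr : (r i:ℝ) ≤ 0 := by exact_mod_cast hr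
        refine le_trans ?_ (le_add_of_nonneg_right (Real.exp_pos _).le)
        apply Real.exp_le_exp.mpr
        have : (r i:ℝ) * (z.im + 1) ≤ r i * w.im := by nlinarith
        nlinarith) (by simp)
  have h2 : (fun w => ∑' i, c i * eC (r i * w)) = f := funext fun w => (h w).tsum_eq
  rw [h2] at h1
  refine (congrArg (fun F => HasSum F _) (funext fun k => ?_)).mpr h1
  rw [((eC_hasDerivAt (r k) z).const_mul (c k)).deriv]; ring

theorem hasSum_d2 {ι : Type} (c : ι → ℂ) (r : ι → ℤ) (f : ℂ → ℂ)
    (h : ∀ z : ℂ, HasSum (fun i => c i * eC (r i * z)) (f z)) :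
    HasSum (fun i => c i * (2 * Real.pi * I * r i) ^ 2) (d2 f) := by
  have := hasSum_dz _ r _ (hasSum_dz c r f h) 0
  refine (congrArg (fun F => HasSum F _) (funext fun k => ?_)).mpr this
  rw [mul_zero, eC_zero]; ring

theorem FS.lim {F : ℂ → ℂ → ℂ → ℂ} (hF : FS F) : ∃ l : ℂ → ℂ → ℂ,
    (∀ x y, IsR (fun τ => F τ x y) (l x y)) ∧
    (∀ a y, IsR (fun τ => FC a (fun x => F τ x y)) (FC a (fun x => l x y))) ∧
    (∀ y, IsR (fun τ => d2 (fun x => F τ x y)) (d2 (fun x => l x y))) := by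
  obtain ⟨c, hc⟩ := hF
  have hI : UHP I := by simp [UHP]
  let l : ℂ → ℂ → ℂ := fun x y => ∑' i : ℕ × ℤ × ℤ, if i.1 = 0 then c i * eC (i.2.1 * x + i.2.2 * y) else 0
  have hl : ∀ x y, HasSum (fun i : ℕ × ℤ × ℤ => if i.1 = 0 then c i * eC (i.2.1 * x + i.2.2 * y) else 0) (l x y) := by
    intro x y
    apply Summable.hasSum
    refine Summable.of_norm_bounded (hc I x y hI).summable.norm ?_
    intro i
    split_ifs with h
    · apply le_of_eq; simp [chi, h]
    · simp only [norm_zero]; positivity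
  have hly : ∀ y x, HasSum (fun i : ℕ × ℤ × ℤ => (if i.1 = 0 then c i * eC (i.2.2 * y) else 0) * eC (i.2.1 * x)) (l x y) := by
    intro y x
    refine (congrArg (fun F => HasSum F _) (funext fun k => ?_)).mpr (hl x y)
    split_ifs
    · rw [eC_add]; ring
    · simp
  have hFy : ∀ τ, UHP τ → ∀ y x, HasSum (fun i : ℕ × ℤ × ℤ => (c i * eC (i.2.2 * y) * eC (i.1 * τ)) * eC (i.2.1 * x)) (F τ x y) := by
    intro τ hτ y x
    refine (congrArg (fun F => HasSum F _) (funext fun k => ?_)).mpr (hc τ x y hτ)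
    rw [chi, eC_add, eC_add]; ring
  refine ⟨l, ?_, ?_, ?_⟩
  · intro x y
    refine IsR_of (fun i : ℕ × ℤ × ℤ => c i * eC (i.2.1 * x + i.2.2 * y)) (fun i => i.1) ?_
    intro τ hτ
    refine (congrArg (fun F => HasSum F _) (funext fun k => ?_)).mpr (hc τ x y hτ)
    rw [chi, mul_assoc, ← eC_add]; congr 2; ring
  · intro a y
    have h1 := FC_hasSum _ (fun i : ℕ × ℤ × ℤ => i.2.1) (fun x => l x y) (fun x => hly y x) a
    rw [← h1.tsum_eq]
    have h2 := IsR_of (fun i : ℕ × ℤ × ℤ => if i.2.1 = a then c i * eC (i.2.2 * y) else 0) (fun i => i.1)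
      (f := fun τ => FC a (fun x => F τ x y)) (by
        intro τ hτ
        have := FC_hasSum _ (fun i : ℕ × ℤ × ℤ => i.2.1) (fun x => F τ x y) (fun x => hFy τ hτ y x) a
        refine (congrArg (fun F => HasSum F _) (funext fun k => ?_)).mpr this
        simp only [ite_mul, zero_mul])
    convert h2 using 1
    refine tsum_congr fun i => ?_
    split_ifs <;> rfl
  · intro y
    have h1 := hasSum_d2 _ (fun i : ℕ × ℤ × ℤ => i.2.1) (fun x => l x y) (fun x => hly y x)
    rw [← h1.tsum_eq]
    have h2 := IsR_of (fun i : ℕ × ℤ × ℤ => c i * eC (i.2.2 * y) * (2 * Real.pi * I * i.2.1) ^ 2) (fun i => i.1)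
      (f := fun τ => d2 (fun x => F τ x y)) (by
        intro τ hτ
        have := hasSum_d2 _ (fun i : ℕ × ℤ × ℤ => i.2.1) (fun x => F τ x y) (fun x => hFy τ hτ y x)
        refine (congrArg (fun F => HasSum F _) (funext fun k => ?_)).mpr this
        ring)
    convert h2 using 1
    refine tsum_congr fun i => ?_
    split_ifs
    · rfl
    · simp

structure FSl (F : ℂ → ℂ → ℂ → ℂ) (l : ℂ → ℂ → ℂ) : Prop where
  fs : FS F
  lim : ∀ x y, IsR (fun τ => F τ x y) (l x y)

theorem FSl.FC {F l} (h : FSl F l) (a : ℤ) (y : ℂ) :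
    IsR (fun τ => FC a (fun x => F τ x y)) (FC a (fun x => l x y)) := by
  obtain ⟨l', h1, h2, h3⟩ := h.fs.lim
  have : l = l' := by ext x y; exact (h.lim x y).lim_unique (h1 x y)
  rw [this]; exact h2 a y
theorem FSl.d2 {F l} (h : FSl F l) (y : ℂ) :
    IsR (fun τ => d2 (fun x => F τ x y)) (d2 (fun x => l x y)) := by
  obtain ⟨l', h1, h2, h3⟩ := h.fs.lim
  have : l = l' := by ext x y; exact (h.lim x y).lim_unique (h1 x y)
  rw [this]; exact h3 y
theorem FSl.add {F l G l'} (h : FSl F l) (h' : FSl G l') :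
    FSl (fun τ x y => F τ x y + G τ x y) (fun x y => l x y + l' x y) :=
  ⟨h.fs.add h'.fs, fun x y => (h.lim x y).add (h'.lim x y)⟩
theorem FSl.mul {F l G l'} (h : FSl F l) (h' : FSl G l') :
    FSl (fun τ x y => F τ x y * G τ x y) (fun x y => l x y * l' x y) :=
  ⟨h.fs.mul h'.fs, fun x y => (h.lim x y).mul (h'.lim x y)⟩
theorem FSl.pow {F l} (h : FSl F l) (n : ℕ) :
    FSl (fun τ x y => F τ x y ^ n) (fun x y => l x y ^ n) :=
  ⟨h.fs.pow n, fun x y => (h.lim x y).pow n⟩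
theorem FSl.swap {F l} (h : FSl F l) :
    FSl (fun τ x y => F τ y x) (fun x y => l y x) :=
  ⟨h.fs.swap, fun x y => (h.lim y x)⟩
theorem FSl_of_R {f l} (h : IsR f l) : FSl (fun τ _ _ => f τ) (fun _ _ => l) :=
  ⟨FS_of_R h, fun _ _ => h⟩

theorem natAbs_c (m : ℤ) (h : 0 ≤ m) : ((m.natAbs : ℕ) : ℂ) = (m : ℂ) := by
  obtain ⟨k, rfl⟩ := Int.eq_ofNat_of_zero_le h
  simp

theorem g0_FSl : FSl (fun τ x _ => g0 τ x) (fun _ _ => 1) := by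
  constructor
  · refine FS_of (J := ℤ) (fun _ => 1) (fun n => ((n ^ 2).natAbs, 2 * n, 0)) ?_
    intro τ x y hτ
    refine (congrArg (fun F => HasSum F _) (funext fun n => ?_)).mpr (g0_hasSum hτ x)
    rw [chi, one_mul]
    congr 1
    have : (((n ^ 2).natAbs : ℕ) : ℂ) = n ^ 2 := by
      rw [natAbs_c _ (by positivity)]; push_cast; rfl
    simp only [this]; push_cast; ring
  · intro x y
    have := IsR_of (J := ℤ) (fun n => eC ((2 * n) * x)) (fun n => (n ^ 2).natAbs) (f := fun τ => g0 τ x) (by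
      intro τ hτ
      refine (congrArg (fun F => HasSum F _) (funext fun n => ?_)).mpr (g0_hasSum hτ x)
      have : (((n ^ 2).natAbs : ℕ) : ℂ) = n ^ 2 := by
        rw [natAbs_c _ (by positivity)]; push_cast; rfl
      rw [this, ← eC_add, add_comm])
    rw [tsum_eq_single 0 (by intro n hn; simp [hn])] at this
    simpa [eC_zero] using this

def sL (x : ℂ) : ℂ := eC x + eC (-x) - 2

theorem g1_FSl : FSl (fun τ x _ => g1 τ x) (fun x _ => sL x + 2) := by
  have hn : ∀ n : ℤ, (((n * (n + 1)).natAbs : ℕ) : ℂ) = n * (n + 1) := by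
    intro n
    rw [natAbs_c _ (by
      rcases le_or_gt 0 n with h | h
      · positivity
      · nlinarith)]
    push_cast; rfl
  constructor
  · refine FS_of (J := ℤ) (fun _ => 1) (fun n => ((n * (n + 1)).natAbs, 2 * n + 1, 0)) ?_
    intro τ x y hτ
    refine (congrArg (fun F => HasSum F _) (funext fun n => ?_)).mpr (g1_hasSum hτ x)
    rw [chi, one_mul]
    congr 1
    simp only [hn]; push_cast; ring
  · intro x y
    have := IsR_of (J := ℤ) (fun n => eC ((2 * n + 1) * x)) (fun n => (n * (n + 1)).natAbs) (f := fun τ => g1 τ x) (by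
      intro τ hτ
      refine (congrArg (fun F => HasSum F _) (funext fun n => ?_)).mpr (g1_hasSum hτ x)
      rw [hn, ← eC_add, add_comm])
    rw [tsum_eq_sum (s := {0, -1}) (by
      intro n hn
      have : n ≠ 0 ∧ n + 1 ≠ 0 := by
        simp at hn; constructor
        · exact hn.1
        · intro h; exact hn.2 (by linarith)
      simp [this])] at this
    rw [Finset.sum_pair (by norm_num)] at this
    convert this using 1
    simp [sL]
    norm_num

theorem sL_diff : Differentiable ℂ sL := by
  have := eC_diff
  unfold sL; fun_prop
theorem sL_zero : sL 0 = 0 := by simp [sL, eC_zero]; norm_num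
theorem sL_even (x : ℂ) : sL (-x) = sL x := by simp [sL]; ring
theorem deriv_eC (c : ℂ) : deriv (fun z => eC (c * z)) = fun z => (2 * Real.pi * I * c) * eC (c * z) := by
  ext z; exact (eC_hasDerivAt c z).deriv
theorem d2_eC (c : ℂ) : d2 (fun z => eC (c * z)) = (2 * Real.pi * I * c) ^ 2 := by
  rw [d2, deriv_eC, deriv_const_mul_field, deriv_eC]
  simp [eC_zero]; ring
theorem d2_sL : d2 sL = 2 * (2 * Real.pi * I) ^ 2 := by
  have he := eC_diff
  have : sL = fun z => (eC (1 * z) + eC ((-1) * z)) + (fun _ : ℂ => (-2 : ℂ)) z := by ext z; simp [sL]; ring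
  rw [this, d2_add (by fun_prop) (by fun_prop), d2_add (by fun_prop) (by fun_prop), d2_eC, d2_eC]
  simp [d2]; ring

theorem tpi_ne : (2 * (Real.pi : ℂ) * I) ≠ 0 := Complex.two_pi_I_ne_zero

theorem g0z_R : IsR (fun τ => g0 τ 0) 1 := g0_FSl.lim 0 0
theorem g1z_R : IsR (fun τ => g1 τ 0) 2 := by have := g1_FSl.lim 0 0; simpa [sL_zero] using this
theorem g0d_R : IsR (fun τ => d2 (g0 τ)) 0 := by
  have := g0_FSl.d2 0
  simpa [d2] using this
theorem g1d_R : IsR (fun τ => d2 (g1 τ)) (2 * (2 * Real.pi * I) ^ 2) := by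
  have := g1_FSl.d2 0
  have e : d2 (fun x => sL x + 2) = 2 * (2 * Real.pi * I) ^ 2 := by
    rw [d2_add sL_diff (by fun_prop), d2_sL]; simp [d2]
  rw [e] at this; exact this
theorem Wd_R : IsR Wd (2 * (2 * Real.pi * I) ^ 2) := by
  have := (g0z_R.mul g1d_R).add ((g1z_R.mul g0d_R).const_mul (-1))
  have e : 1 * (2 * (2 * (Real.pi:ℂ) * I) ^ 2) + -1 * (2 * 0) = 2 * (2 * Real.pi * I) ^ 2 := by ring
  rw [e] at this
  exact this.congr fun τ _ => by rw [Wd]; ring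
theorem Wdi_R : IsR (fun τ => (Wd τ)⁻¹) (2 * (2 * Real.pi * I) ^ 2)⁻¹ :=
  Wd_R.inv (fun _ h => Wd_ne h) (mul_ne_zero two_ne_zero (pow_ne_zero 2 tpi_ne))

def kap : ℂ := ((2 * (Real.pi : ℂ) * I) ^ 2)⁻¹
theorem kap_ne : kap ≠ 0 := inv_ne_zero (pow_ne_zero 2 tpi_ne)

theorem aT_FSl : FSl (fun τ x _ => aT τ x) (fun x _ => kap * sL x) := by
  have h1 := (FSl_of_R ((g0z_R.const_mul 2).mul Wdi_R)).mul g1_FSl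
  have h2 := (FSl_of_R (((g1z_R.const_mul 2).mul Wdi_R).const_mul (-1))).mul g0_FSl
  have h3 := h1.add h2
  have := tpi_ne
  have e : (fun x (_ : ℂ) => kap * sL x) = fun x _ => 2 * 1 * (2 * (2 * (Real.pi:ℂ) * I) ^ 2)⁻¹ * (sL x + 2) +
      -1 * (2 * 2 * (2 * (2 * (Real.pi:ℂ) * I) ^ 2)⁻¹) * 1 := by
    ext x y; rw [kap]; field_simp; ring
  rw [e]
  have e2 : (fun τ x (_ : ℂ) => aT τ x) = fun τ x _ => 2 * g0 τ 0 * (Wd τ)⁻¹ * g1 τ x + -1 * (2 * g1 τ 0 * (Wd τ)⁻¹) * g0 τ x := by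
    ext τ x y; rw [aT]; ring
  rw [e2]; exact h3

theorem bT_FSl : FSl (fun τ x _ => bT τ x) (fun _ _ => 1) := by
  have h1 := (FSl_of_R (g1d_R.mul Wdi_R)).mul g0_FSl
  have h2 := (FSl_of_R ((g0d_R.mul Wdi_R).const_mul (-1))).mul g1_FSl
  have h3 := h1.add h2
  have := tpi_ne
  have e : (fun (_ : ℂ) (_ : ℂ) => (1:ℂ)) = fun x _ => 2 * (2 * (Real.pi:ℂ) * I) ^ 2 * (2 * (2 * (Real.pi:ℂ) * I) ^ 2)⁻¹ * 1 +
      -1 * (0 * (2 * (2 * (Real.pi:ℂ) * I) ^ 2)⁻¹) * (sL x + 2) := by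
    ext x y; field_simp; ring
  rw [e]
  have e2 : (fun τ x (_ : ℂ) => bT τ x) = fun τ x _ => d2 (g1 τ) * (Wd τ)⁻¹ * g0 τ x + -1 * (d2 (g0 τ) * (Wd τ)⁻¹) * g1 τ x := by
    ext τ x y; rw [bT]; ring
  rw [e2]; exact h3

theorem bas_FSl (m i : ℕ) : FSl (fun τ x _ => bas m i τ x) (fun x _ => (kap * sL x) ^ i) := by
  have h3 := (aT_FSl.pow i).mul (bT_FSl.pow (m - i))
  simpa [bas] using h3

theorem FC_eC_mul (r s : ℤ) (f : ℂ → ℂ) : FC r (fun z => eC (s * z) * f z) = FC (r - s) f := by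
  unfold FC
  refine intervalIntegral.integral_congr fun x _ => ?_
  simp only
  rw [show (-(((r - s : ℤ) : ℂ) * x)) = s * x + (-(r * x)) by push_cast; ring, eC_add]; ring

theorem FC_one (r : ℤ) : FC r (fun _ => 1) = if r = 0 then 1 else 0 := by
  have := FC_hasSum (ι := Unit) (fun _ => 1) (fun _ => 0) (fun _ => 1) (by
    intro x
    simp [eC_zero]) r
  have h2 := this.unique (hasSum_fintype _)
  rw [h2]; simp [eq_comm]

theorem FC_sL_mul (r : ℤ) (f : ℂ → ℂ) (hf : Differentiable ℂ f) :
    FC r (fun z => sL z * f z) = FC (r - 1) f + FC (r + 1) f - 2 * FC r f := by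
  have he := eC_diff
  have e : (fun z => sL z * f z) = fun z => (eC ((1:ℤ) * z) * f z + eC ((-1:ℤ) * z) * f z) + (-2) * f z := by
    ext z; simp [sL]; ring
  rw [e, FC_add _ _ _ (by fun_prop) (by fun_prop), FC_add _ _ _ (by fun_prop) (by fun_prop), FC_eC_mul, FC_eC_mul, FC_const_mul]
  rw [sub_neg_eq_add]; ring

theorem FC_sL_pow (i : ℕ) : (∀ r : ℤ, i < r → FC r (fun z => sL z ^ i) = 0) ∧ FC i (fun z => sL z ^ i) = 1 := by
  have hs := sL_diff
  induction i with
  | zero =>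
    simp only [pow_zero, FC_one]
    refine ⟨fun r hr => ?_, by simp⟩
    rw [if_neg]; simp at hr; omega
  | succ i ih =>
    have e : (fun z => sL z ^ (i + 1)) = fun z => sL z * sL z ^ i := by ext z; ring
    simp only [e]
    have key := fun r => FC_sL_mul r (fun z => sL z ^ i) (by fun_prop)
    simp only [key]
    refine ⟨fun r hr => ?_, ?_⟩
    · push_cast at hr
      rw [ih.1 _ (by omega), ih.1 _ (by omega), ih.1 _ (by omega)]; ring
    · push_cast
      rw [add_sub_cancel_right, ih.2, ih.1 _ (by omega), ih.1 _ (by omega)]; ring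

def MatL (m : ℕ) : Matrix (Fin (m + 1)) (Fin (m + 1)) ℂ := Matrix.of fun r i => FC ((r:ℕ):ℤ) (fun z => (kap * sL z) ^ (i:ℕ))

theorem MatL_entry (m : ℕ) (r i : Fin (m + 1)) : MatL m r i = kap ^ (i:ℕ) * FC ((r:ℕ):ℤ) (fun z => sL z ^ (i:ℕ)) := by
  rw [← FC_const_mul]; simp only [MatL, Matrix.of_apply, mul_pow]

theorem MatL_det (m : ℕ) : (MatL m).det ≠ 0 := by
  rw [Matrix.det_of_upperTriangular]
  · rw [Finset.prod_ne_zero_iff]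
    intro i _
    rw [MatL_entry, (FC_sL_pow i).2, mul_one]
    exact pow_ne_zero _ kap_ne
  · intro r i h
    rw [MatL_entry, (FC_sL_pow i).1, mul_zero]
    simpa using h

theorem Mat_R (m : ℕ) (r i : Fin (m + 1)) : IsR (fun τ => Mat m τ r i) (MatL m r i) :=
  (bas_FSl m i).FC ((r:ℕ):ℤ) 0

theorem coefV_R {m : ℕ} (hm : 0 < m) {ψ : ℂ → ℂ → ℂ} (hF : FS (fun τ x _ => ψ τ x)) (i : Fin (m + 1)) :
    ∃ l, IsR (fun τ => coefV m τ (ψ τ) i) l := by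
  obtain ⟨lψ, -, h2, -⟩ := hF.lim
  have hdet := IsR.det (Mat m) (MatL m) (Mat_R m)
  have hinv := hdet.inv (fun τ h => Mat_det_ne hm h) (MatL_det m)
  have hadj : ∀ r, IsR (fun τ => (Mat m τ).adjugate i r) ((MatL m).adjugate i r) := by
    intro r
    simp only [Matrix.adjugate_apply]
    refine IsR.det (fun τ => (Mat m τ).updateRow r (Pi.single i 1)) ((MatL m).updateRow r (Pi.single i 1)) ?_
    intro a b
    by_cases h : a = r
    · subst h; simp only [Matrix.updateRow_self]; exact IsR.const _
    · simp only [Matrix.updateRow_ne h]; exact Mat_R m a b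
  have := hinv.mul (IsR.sum Finset.univ _ _ fun r _ => (hadj r).mul (h2 ((r:ℕ):ℤ) 0))
  refine ⟨_, this.congr fun τ _ => ?_⟩
  simp [coefV, Matrix.mulVec, dotProduct]

theorem FC_congr (a : ℤ) {f g : ℂ → ℂ} (h : ∀ x : ℝ, f x = g x) : FC a f = FC a g := by
  unfold FC
  exact intervalIntegral.integral_congr fun x _ => by simp only [h x]

def FC3 (n a b : ℤ) (F : ℂ → ℂ → ℂ → ℂ) : ℂ :=
  FC n (fun t => FC a (fun x => FC b (fun y => F (t + I) x y)))

theorem FC3_hasSum {J : Type} [Countable J] (w : J → ℂ) (N A B : J → ℤ) (F : ℂ → ℂ → ℂ → ℂ)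
    (h : ∀ τ x y, UHP τ → HasSum (fun j => w j * eC (N j * τ + A j * x + B j * y)) (F τ x y)) (n a b : ℤ) :
    HasSum (fun j => if N j = n ∧ A j = a ∧ B j = b then w j * eC (N j * I) else 0) (FC3 n a b F) := by
  have h1 := FC_hasSum (fun j => if A j = a then if B j = b then w j * eC (N j * I) else 0 else 0) N
    (fun t => FC a (fun x => FC b (fun y => F (t + I) x y))) (fun t => by
      have h2 := FC_hasSum (fun j => if B j = b then w j * eC (N j * (t + I)) else 0) A
        (fun x => FC b (fun y => F (t + I) x y)) (fun x => by
          have h3 := FC_hasSum (fun j => w j * eC (N j * (t + I) + A j * x)) B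
            (fun y => F (t + I) x y) (fun y => by
              have := h (t + I) x y (by simp [UHP])
              refine (congrArg (fun F => HasSum F _) (funext fun k => ?_)).mpr this
              rw [mul_assoc, ← eC_add]) b
          refine (congrArg (fun F => HasSum F _) (funext fun k => ?_)).mpr h3
          split_ifs
          · rw [eC_add]; ring
          · simp) a
      refine (congrArg (fun F => HasSum F _) (funext fun k => ?_)).mpr h2
      split_ifs
      · rw [mul_add, eC_add]; ring
      · simp
      · simp) n
  refine (congrArg (fun F => HasSum F _) (funext fun k => ?_)).mpr h1
  by_cases h1 : N k = n <;> by_cases h2 : A k = a <;> by_cases h3 : B k = b <;> simp [h1, h2, h3]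

def ct (c : ℕ × ℤ × ℤ → ℂ) (n a b : ℤ) : ℂ := if 0 ≤ n then c (n.toNat, a, b) else 0

theorem ct_shift (c : ℕ × ℤ × ℤ → ℂ) (F : ℂ → ℂ → ℂ → ℂ)
    (hc : ∀ τ x y, UHP τ → HasSum (fun i => c i * chi i τ x y) (F τ x y))
    (hx : ∀ τ x y, UHP τ → F τ (x + τ) y = eC (-2 * (τ + 2 * x)) * F τ x y) (n a b : ℤ) :
    ct c n (a + 4) b = ct c (n - 2 - a) a b := by
  have h1 := FC3_hasSum c (fun i => i.1 + i.2.1) (fun i => i.2.1) (fun i => i.2.2) (fun τ x y => F τ (x + τ) y)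
    (by
      intro τ x y hτ
      refine (congrArg (fun F => HasSum F _) (funext fun k => ?_)).mpr (hc τ (x + τ) y hτ)
      rw [chi]; congr 2; push_cast; ring) (n - 2) a b
  have h2 := FC3_hasSum c (fun i => i.1 - 2) (fun i => i.2.1 - 4) (fun i => i.2.2) (fun τ x y => F τ (x + τ) y)
    (by
      intro τ x y hτ
      simp only [hx τ x y hτ]
      refine (congrArg (fun F => HasSum F _) (funext fun k => ?_)).mpr ((hc τ x y hτ).mul_left (eC (-2 * (τ + 2 * x))))
      rw [chi, mul_left_comm, ← eC_add]; congr 2; push_cast; ring) (n - 2) a b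
  have e1 : FC3 (n - 2) a b (fun τ x y => F τ (x + τ) y) = ct c (n - 2 - a) a b * eC ((n - 2 : ℤ) * I) := by
    refine h1.unique ?_
    have := hasSum_ite_eq (((n - 2 - a).toNat, a, b) : ℕ × ℤ × ℤ) (ct c (n - 2 - a) a b * eC ((n - 2 : ℤ) * I))
    refine (congrArg (fun F => HasSum F _) (funext fun k => ?_)).mpr this
    obtain ⟨p, q, r⟩ := k
    simp only [Prod.mk.injEq, ct]
    by_cases h0 : 0 ≤ n - 2 - a
    · have : ((p:ℤ) + q = n - 2 ∧ q = a ∧ r = b) ↔ (p = (n - 2 - a).toNat ∧ q = a ∧ r = b) := by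
        constructor <;> rintro ⟨h1, h2, h3⟩ <;> refine ⟨by omega, h2, h3⟩
      simp only [this, h0, if_true]
      split_ifs with h
      · obtain ⟨h1, h2, h3⟩ := this.mpr h
        rw [h1, ← h.1, h2, h3]
      · rfl
    · have : ¬ ((p:ℤ) + q = n - 2 ∧ q = a ∧ r = b) := by rintro ⟨h1, h2, h3⟩; omega
      rw [if_neg this, if_neg h0]; simp
  have e2 : FC3 (n - 2) a b (fun τ x y => F τ (x + τ) y) = ct c n (a + 4) b * eC ((n - 2 : ℤ) * I) := by
    refine h2.unique ?_
    have := hasSum_ite_eq ((n.toNat, a + 4, b) : ℕ × ℤ × ℤ) (ct c n (a + 4) b * eC ((n - 2 : ℤ) * I))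
    refine (congrArg (fun F => HasSum F _) (funext fun k => ?_)).mpr this
    obtain ⟨p, q, r⟩ := k
    simp only [Prod.mk.injEq, ct]
    by_cases h0 : 0 ≤ n
    · have : ((p:ℤ) - 2 = n - 2 ∧ q - 4 = a ∧ r = b) ↔ (p = n.toNat ∧ q = a + 4 ∧ r = b) := by
        constructor <;> rintro ⟨h1, h2, h3⟩ <;> refine ⟨by omega, by omega, h3⟩
      simp only [this, h0, if_true]
      split_ifs with h
      · obtain ⟨h1, h2, h3⟩ := this.mpr h
        rw [h.1, h.2.1, h3, ← h1, h.1]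
      · rfl
    · have : ¬ ((p:ℤ) - 2 = n - 2 ∧ q - 4 = a ∧ r = b) := by rintro ⟨h1, h2, h3⟩; omega
      rw [if_neg this, if_neg h0]; simp
  exact mul_right_cancel₀ (eC_ne _) (e2.symm.trans e1)

theorem supp_aux (C : ℤ → ℤ → ℂ) (h : ∀ n a, C n (a + 4) = C (n - 2 - a) a) (n a : ℤ) :
    ∃ n' a', C n a = C n' a' ∧ a' ^ 2 ≤ 4 ∧ 8 * n - a ^ 2 = 8 * n' - a' ^ 2 := by
  obtain ⟨K, hK⟩ : ∃ K : ℕ, a.natAbs ≤ K := ⟨_, le_rfl⟩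
  induction K using Nat.strong_induction_on generalizing n a with
  | _ K ih =>
    by_cases ha : a.natAbs ≤ 2
    · refine ⟨n, a, rfl, ?_, rfl⟩
      have h1 : -2 ≤ a := by omega
      have h2 : a ≤ 2 := by omega
      nlinarith
    · rcases le_or_gt 0 a with h0 | h0
      · obtain ⟨n', a', h1, h2, h3⟩ := ih (a - 4).natAbs (by omega) (n - 2 - (a - 4)) (a - 4) le_rfl
        refine ⟨n', a', ?_, h2, ?_⟩
        · rw [← h1, ← h n (a - 4)]; congr 1; ring
        · rw [← h3]; ring
      · obtain ⟨n', a', h1, h2, h3⟩ := ih (a + 4).natAbs (by omega) (n + 2 + a) (a + 4) le_rfl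
        refine ⟨n', a', ?_, h2, ?_⟩
        · rw [← h1, h (n + 2 + a) a]; congr 1; ring
        · rw [← h3]; ring

theorem lim_zero (c : ℕ × ℤ × ℤ → ℂ) (F : ℂ → ℂ → ℂ → ℂ)
    (hc : ∀ τ x y, UHP τ → HasSum (fun i => c i * chi i τ x y) (F τ x y)) (l : ℂ)
    (hl : ∀ x y, IsR (fun τ => F τ x y) l) (a b : ℤ) (hab : a ≠ 0 ∨ b ≠ 0) : c (0, a, b) = 0 := by
  have hI : UHP I := by simp [UHP]
  have key : ∀ x y, HasSum (fun i : ℕ × ℤ × ℤ => if i.1 = 0 then c i * eC (i.2.1 * x + i.2.2 * y) else 0) l := by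
    intro x y
    have h1 : ∑' i : ℕ × ℤ × ℤ, (if i.1 = 0 then c i * eC (i.2.1 * x + i.2.2 * y) else 0) = l := by
      refine IsR.lim_unique ?_ (hl x y)
      refine IsR_of (fun i : ℕ × ℤ × ℤ => c i * eC (i.2.1 * x + i.2.2 * y)) (fun i => i.1) ?_
      intro τ hτ
      refine (congrArg (fun F => HasSum F _) (funext fun k => ?_)).mpr (hc τ x y hτ)
      rw [chi, mul_assoc, ← eC_add]; congr 2; ring
    rw [← h1]
    apply Summable.hasSum
    refine Summable.of_norm_bounded (hc I x y hI).summable.norm ?_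
    intro i
    split_ifs with h
    · apply le_of_eq; simp [chi, h]
    · simp only [norm_zero]; positivity
  have h1 := FC_hasSum (fun i : ℕ × ℤ × ℤ => if i.2.2 = b then if i.1 = 0 then c i else 0 else 0) (fun i => i.2.1)
    (fun x => FC b (fun _ => l)) (fun x => by
      have h3 := FC_hasSum (fun i : ℕ × ℤ × ℤ => if i.1 = 0 then c i * eC (i.2.1 * x) else 0) (fun i => i.2.2)
        (fun _ => l) (fun y => by
          refine (congrArg (fun F => HasSum F _) (funext fun k => ?_)).mpr (key x y)
          split_ifs
          · rw [eC_add]; ring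
          · simp) b
      refine (congrArg (fun F => HasSum F _) (funext fun k => ?_)).mpr h3
      split_ifs <;> simp) a
  have h4 : c (0, a, b) = FC a (fun _ => FC b (fun _ => l)) := by
    refine HasSum.unique ?_ h1
    have := hasSum_ite_eq ((0, a, b) : ℕ × ℤ × ℤ) (c (0, a, b))
    refine (congrArg (fun F => HasSum F _) (funext fun k => ?_)).mpr this
    obtain ⟨p, q, r⟩ := k
    simp only [Prod.mk.injEq]
    split_ifs <;> simp_all
  have h5 : ∀ (a : ℤ) (l : ℂ), FC a (fun _ => l) = l * if a = 0 then 1 else 0 := by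
    intro a l
    rw [← FC_one, ← FC_const_mul]; simp
  rw [h4, h5, h5]
  rcases hab with h | h <;> simp [h]

theorem supp_main {F : ℂ → ℂ → ℂ → ℂ} (hF : FS F) (l : ℂ) (hl : ∀ x y, IsR (fun τ => F τ x y) l)
    (hx : ∀ τ x y, UHP τ → F τ (x + τ) y = eC (-2 * (τ + 2 * x)) * F τ x y) :
    ∃ c : ℕ × ℤ × ℤ → ℂ, (∀ τ x y, UHP τ → HasSum (fun i => c i * chi i τ x y) (F τ x y)) ∧
      (∀ (n : ℕ) (a b : ℤ), 8 * (n:ℤ) < a ^ 2 → c (n, a, b) = 0) ∧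
      ((∀ τ x y, UHP τ → F τ x (y + τ) = eC (-2 * (τ + 2 * y)) * F τ x y) →
        ∀ (n : ℕ) (a b : ℤ), 8 * (n:ℤ) < a ^ 2 + b ^ 2 → c (n, a, b) = 0) := by
  obtain ⟨c, hc⟩ := hF
  have hcn : ∀ (n : ℕ) a b, c (n, a, b) = ct c n a b := by intro n a b; simp [ct]
  have hz : ∀ n a b : ℤ, n ≤ 0 → (n = 0 → a ≠ 0 ∨ b ≠ 0) → ct c n a b = 0 := by
    intro n a b hn hab
    rcases hn.lt_or_eq with h | h
    · rw [ct, if_neg (by omega)]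
    · subst h; simpa [ct] using lim_zero c F hc l hl a b (hab rfl)
  have hX := fun b => supp_aux (fun n a => ct c n a b) (fun n a => ct_shift c F hc hx n a b)
  refine ⟨c, hc, ?_, ?_⟩
  · intro n a b h
    obtain ⟨n', a', h1, h2, h3⟩ := hX b n a
    rw [hcn]
    refine h1.trans (hz _ _ _ (by omega) fun hn => Or.inl ?_)
    rintro rfl
    subst hn
    omega
  · intro hy n a b h
    obtain ⟨n', a', h1, h2, h3⟩ := hX b n a
    have hY : ∀ n a b, ct c n a (b + 4) = ct c (n - 2 - b) a b := by
      intro n a b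
      exact ct_shift (fun i => c (i.1, i.2.2, i.2.1)) (fun τ x y => F τ y x) (by
        intro τ x y hτ
        have := hc τ y x hτ
        let e : ℕ × ℤ × ℤ ≃ ℕ × ℤ × ℤ := ⟨fun i => (i.1, i.2.2, i.2.1), fun i => (i.1, i.2.2, i.2.1), fun _ => rfl, fun _ => rfl⟩
        rw [← e.hasSum_iff] at this
        refine (congrArg (fun F => HasSum F _) (funext fun k => ?_)).mpr this
        simp only [Function.comp, e, Equiv.coe_fn_mk, chi]
        congr 2; ring) (fun τ x y hτ => hy τ y x hτ) n b a
    obtain ⟨n'', b', h4, h5, h6⟩ := supp_aux (fun n b => ct c n a' b) (fun n b => hY n a' b) n' b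
    rw [hcn]
    refine (h1.trans h4).trans (hz _ _ _ (by omega) fun hn => ?_)
    by_contra! hc
    obtain ⟨rfl, rfl⟩ := hc
    subst hn
    omega

theorem M1 : Ma 1 = 1 ∧ Mb 1 = 0 ∧ Mc 1 = 0 ∧ Md 1 = 1 := by simp [Ma, Mb, Mc, Md]
theorem Mm1 : Ma (-1) = -1 ∧ Mb (-1) = 0 ∧ Mc (-1) = 0 ∧ Md (-1) = -1 := by simp [Ma, Mb, Mc, Md]

theorem IsJF.V {k m ψ} (h : IsJF k m ψ) {τ : ℂ} (hτ : UHP τ) : IsV m τ (ψ τ) where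
  diff := by
    intro z
    have h1 : DifferentiableAt ℂ (fun p : ℂ × ℂ => ψ p.1 p.2) (τ, z) :=
      h.holo.differentiableAt ((UHP_open.preimage continuous_fst).mem_nhds hτ)
    exact DifferentiableAt.comp (f := fun z => (τ, z)) (g := fun p : ℂ × ℂ => ψ p.1 p.2) z h1 (by fun_prop)
  per z := by
    have := h.ellip 0 1 τ z hτ
    simpa [eC_zero] using this
  qper z := by
    have := h.ellip 1 0 τ z hτ
    simpa using this

theorem IsJF.even {k m ψ} (h : IsJF k m ψ) (hk : k % 4 = 0) {τ : ℂ} (hτ : UHP τ) (z : ℂ) : ψ τ (-z) = ψ τ z := by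
  have h1 := h.transf (-1) τ z hτ
  obtain ⟨h2, h3, h4, h5⟩ := Mm1
  have he : Even k := Nat.even_iff.mpr (by omega)
  simpa [h2, h3, h4, h5, he.neg_one_pow, eC_zero, div_neg] using h1

theorem IsJF.FS {k m ψ} (h : IsJF k m ψ) : FS (fun τ x _ => ψ τ x) := by
  obtain ⟨c, -, hc⟩ := h.fourier
  refine FS_of (J := ℕ × ℤ) (fun p => c p.1 p.2) (fun p => (p.1, p.2, 0)) ?_
  intro τ x y hτ
  simpa [chi] using hc τ x hτ

def cF (φ : ℂ → ℂ → ℂ → ℂ) (τ x y : ℂ) : ℂ := φ τ (x + I * y) (x - I * y)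

theorem cF_diff {k m φ} (h : IsHJF k m φ) : DifferentiableOn ℂ (fun p : ℂ × ℂ × ℂ => cF φ p.1 p.2.1 p.2.2) {p | UHP p.1} :=
  DifferentiableOn.comp (g := fun p : ℂ × ℂ × ℂ => φ p.1 p.2.1 p.2.2)
    (f := fun p : ℂ × ℂ × ℂ => (p.1, p.2.1 + I * p.2.2, p.2.1 - I * p.2.2)) h.holo (by fun_prop) (fun p hp => hp)

theorem cF_rot {k m φ} (h : IsHJF k m φ) (hk : k % 4 = 0) {τ : ℂ} (hτ : UHP τ) (x y : ℂ) :
    cF φ τ (-y) x = cF φ τ x y := by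
  have h1 := h.transf I (by simp) 1 τ (x + I * y) (x - I * y) hτ
  obtain ⟨h2, h3, h4, h5⟩ := M1
  have hI : I ^ k = 1 := by
    obtain ⟨j, rfl⟩ : ∃ j, k = 4 * j := ⟨k / 4, by omega⟩
    rw [pow_mul, I_pow_four, one_pow]
  simp only [h2, h3, h4, h5, hI, Complex.conj_I] at h1
  have e1 : I * (x + I * y) = -y + I * x := by linear_combination y * I_sq
  have e2 : -I * (x - I * y) = -y - I * x := by linear_combination y * I_sq
  rw [e1, e2] at h1
  simpa [eC_zero, cF] using h1

theorem cF_V {k φ} (h : IsHJF k 2 φ) {τ : ℂ} (hτ : UHP τ) (y : ℂ) : IsV 2 τ (fun x => cF φ τ x y) where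
  diff := by
    intro x
    have h1 : DifferentiableAt ℂ (fun p : ℂ × ℂ × ℂ => cF φ p.1 p.2.1 p.2.2) (τ, x, y) :=
      (cF_diff h).differentiableAt ((UHP_open.preimage continuous_fst).mem_nhds hτ)
    exact DifferentiableAt.comp (f := fun x => (τ, x, y)) (g := fun p : ℂ × ℂ × ℂ => cF φ p.1 p.2.1 p.2.2) x h1 (by fun_prop)
  per x := by
    have := h.ellip 0 0 1 0 τ (x + I * y) (x - I * y) hτ
    simp [eC_zero] at this
    simp only [cF]
    rw [← this]; ring_nf
  qper x := by
    have := h.ellip 1 0 0 0 τ (x + I * y) (x - I * y) hτ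
    simp at this
    simp only [cF]
    rw [show x + τ + I * y = x + I * y + τ by ring, show x + τ - I * y = x - I * y + τ by ring, this]
    congr 2
    push_cast; ring

theorem cF_even_sym {k φ} (h : IsHJF k 2 φ) (hk : k % 4 = 0) {τ : ℂ} (hτ : UHP τ) :
    (∀ x y, cF φ τ (-x) y = cF φ τ x y) ∧ (∀ x y, cF φ τ x y = cF φ τ y x) := by
  have hr := cF_rot h hk hτ
  have hneg : ∀ x y, cF φ τ (-x) (-y) = cF φ τ x y := fun x y => by
    rw [hr (-y) x |>.symm.symm, ← hr x y]
  have hV := cF_V h hτ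
  let G : ℂ → ℂ → ℂ := fun x y => cF φ τ x y - cF φ τ (-x) y
  have hGV : ∀ y, IsV 2 τ (fun x => G x y) := by
    intro y
    have h1 := (hV y).sub (hV (-y))
    refine (congrArg (IsV 2 τ) (funext fun x => ?_)).mp h1
    simp only [G]
    rw [← hneg x (-y), neg_neg]
  have hGo : ∀ y x, G (-x) y = - G x y := by intro y x; simp [G]
  have hGs : ∀ x y, G y x = - G x y := by
    intro x y
    simp only [G]
    have e1 : cF φ τ y x = cF φ τ (-x) y := by
      have := hr (-x) (y); rw [← hneg, ← this]
    have e2 : cF φ τ (-y) x = cF φ τ x y := hr x y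
    rw [e1, e2]; ring
  have hprop : ∀ x y, G x y * G x y = 0 := by
    intro x y
    -- slices in the same one-dimensional space
    have key : ∀ y y' x, FC 1 (fun x => G x y') * G x y - FC 1 (fun x => G x y) * G x y' = 0 := by
      intro y y'
      refine IsV.inj_odd (((hGV y).const_mul _).sub ((hGV y').const_mul _)) ?_ ?_
      · intro z; simp only [hGo]; ring
      · have h1 := FC_add 1 (fun x => FC 1 (fun x => G x y') * G x y) (fun x => (-FC 1 (fun x => G x y)) * G x y')
          ((hGV y).const_mul _).diff ((hGV y').const_mul _).diff
        rw [FC_const_mul, FC_const_mul] at h1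
        have e : (fun z => FC 1 (fun x => G x y') * G z y - FC 1 (fun x => G x y) * G z y') =
          fun z => FC 1 (fun x => G x y') * G z y + (-FC 1 (fun x => G x y)) * G z y' := by ext z; ring
        rw [e, h1]; ring
    by_cases hy : FC 1 (fun x => G x y) = 0
    · have : G x y = 0 := IsV.inj_odd (hGV y) (hGo y) hy x
      rw [this]; ring
    · have k1 := key y x x
      have k2 := key y x y
      have d1 : G x x = 0 := by have := hGs x x; linear_combination (1/2) * this
      have d2 : G y y = 0 := by have := hGs y y; linear_combination (1/2) * this
      rw [d1] at k1; rw [d2] at k2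
      have k3 : G y x = 0 := by
        have : FC 1 (fun x => G x y) * G y x = 0 := by linear_combination -k2
        exact (mul_eq_zero.mp this).resolve_left hy
      rw [hGs] at k3
      linear_combination -G x y * k3
  have hev : ∀ x y, cF φ τ (-x) y = cF φ τ x y := by
    intro x y
    have := mul_self_eq_zero.mp (hprop x y)
    simp only [G] at this
    linear_combination -this
  refine ⟨hev, fun x y => ?_⟩
  rw [← hr x y, hev]

theorem part1a {k φ} (h : IsHJF k 2 φ) : IsJF k 2 (fun τ z => φ τ z z) where
  holo := DifferentiableOn.comp (g := fun p : ℂ × ℂ × ℂ => φ p.1 p.2.1 p.2.2)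
    (f := fun p : ℂ × ℂ => (p.1, p.2, p.2)) h.holo (by fun_prop) (fun p hp => hp)
  transf M τ z hτ := by
    have := h.transf 1 (by simp) M τ z z hτ
    simp only [map_one, one_mul, one_pow] at this
    rw [this]; congr 3; ring
  ellip p q τ z hτ := by
    have := h.ellip p 0 q 0 τ z z hτ
    simp only [Int.cast_zero, zero_mul, add_zero, sub_zero] at this
    rw [this]; congr 2; ring
  fourier := by
    obtain ⟨c, hc0, hc⟩ := h.fourier
    obtain ⟨e, he0, he⟩ := regroup (J := ℕ × ℤ × ℤ) (X := ℂ × ℂ) (fun p => c p.1 p.2.1 p.2.2) (fun p => (p.1, p.2.1))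
      (fun i p => eC (i.1 * p.1 + i.2 * p.2)) {p | UHP p.1} (fun p => φ p.1 p.2 p.2) (by
        rintro ⟨τ, z⟩ hτ
        refine (congrArg (fun F => HasSum F _) (funext fun k => ?_)).mpr (hc τ z z hτ)
        congr 2; simp only; ring)
    refine ⟨fun n r => e (n, r), ?_, fun τ z hτ => he (τ, z) hτ⟩
    intro n r hr
    refine he0 _ ?_
    rintro ⟨n', a, b⟩ hj
    simp only [Prod.mk.injEq] at hj
    obtain ⟨rfl, rfl⟩ := hj
    refine hc0 _ _ _ ?_
    simp only
    nlinarith [sq_nonneg b]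

theorem part1b {k φ} (h : IsHJF k 2 φ) :
    IsJF k 4 (fun τ z => φ τ ((1 + Complex.I) * z) ((1 - Complex.I) * z)) where
  holo := DifferentiableOn.comp (g := fun p : ℂ × ℂ × ℂ => φ p.1 p.2.1 p.2.2)
    (f := fun p : ℂ × ℂ => (p.1, (1 + I) * p.2, (1 - I) * p.2)) h.holo (by fun_prop) (fun p hp => hp)
  transf M τ z hτ := by
    have := h.transf 1 (by simp) M τ ((1 + I) * z) ((1 - I) * z) hτ
    simp only [map_one, one_mul, one_pow] at this
    simp only [← mul_div_assoc]
    rw [this]; congr 3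
    push_cast
    linear_combination (-2 * Mc M * z ^ 2 / (Mc M * τ + Md M)) * I_sq
  ellip p q τ z hτ := by
    have := h.ellip p p q q τ ((1 + I) * z) ((1 - I) * z) hτ
    rw [show (1 + I) * (z + p * τ + q) = (1 + I) * z + (p + p * I) * τ + (q + q * I) by ring,
      show (1 - I) * (z + p * τ + q) = (1 - I) * z + (p - p * I) * τ + (q - q * I) by ring, this]
    congr 2
    push_cast
    linear_combination (4 * p * z) * I_sq
  fourier := by
    obtain ⟨c, hc0, hc⟩ := h.fourier
    obtain ⟨e, he0, he⟩ := regroup (J := ℕ × ℤ × ℤ) (X := ℂ × ℂ) (fun p => c p.1 p.2.1 p.2.2) (fun p => (p.1, p.2.1 - p.2.2))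
      (fun i p => eC (i.1 * p.1 + i.2 * p.2)) {p | UHP p.1} (fun p => φ p.1 ((1 + I) * p.2) ((1 - I) * p.2)) (by
        rintro ⟨τ, z⟩ hτ
        refine (congrArg (fun F => HasSum F _) (funext fun k => ?_)).mpr (hc τ _ _ hτ)
        congr 2; simp only; push_cast
        linear_combination (-k.2.2 * z) * I_sq)
    refine ⟨fun n r => e (n, r), ?_, fun τ z hτ => he (τ, z) hτ⟩
    intro n r hr
    refine he0 _ ?_
    rintro ⟨n', a, b⟩ hj
    simp only [Prod.mk.injEq] at hj
    obtain ⟨rfl, rfl⟩ := hj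
    refine hc0 _ _ _ ?_
    simp only
    push_cast at hr ⊢
    nlinarith [sq_nonneg (a + b)]

theorem cF_inv (φ : ℂ → ℂ → ℂ → ℂ) (τ z₁ z₂ : ℂ) : φ τ z₁ z₂ = cF φ τ ((z₁ + z₂) / 2) (-I * (z₁ - z₂) / 2) := by
  have e : I * (-I * (z₁ - z₂) / 2) = (z₁ - z₂) / 2 := by linear_combination (-(z₁ - z₂) / 2) * I_sq
  rw [cF, e]; congr 1 <;> ring

theorem cF_pi1 (φ : ℂ → ℂ → ℂ → ℂ) (τ z : ℂ) : cF φ τ z 0 = φ τ z z := by simp [cF]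
theorem cF_pi2 (φ : ℂ → ℂ → ℂ → ℂ) (τ z : ℂ) : cF φ τ z z = φ τ ((1 + I) * z) ((1 - I) * z) := by
  rw [cF]; congr 1 <;> ring

theorem part2 {k φ φ'} (hk : k % 4 = 0) (h : IsHJF k 2 φ) (h' : IsHJF k 2 φ')
    (h1 : ∀ τ z : ℂ, UHP τ → φ τ z z = φ' τ z z)
    (h2 : ∀ τ z : ℂ, UHP τ → φ τ ((1 + Complex.I) * z) ((1 - Complex.I) * z)
          = φ' τ ((1 + Complex.I) * z) ((1 - Complex.I) * z)) (τ z₁ z₂ : ℂ) (hτ : UHP τ) : φ τ z₁ z₂ = φ' τ z₁ z₂ := by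
  obtain ⟨e1, s1⟩ := cF_even_sym h hk hτ
  obtain ⟨e2, s2⟩ := cF_even_sym h' hk hτ
  have := uniq_two hτ (fun x y => cF φ τ x y - cF φ' τ x y) (fun x y => by simp only [s1 x y, s2 x y])
    (fun y => (cF_V h hτ y).sub (cF_V h' hτ y)) (fun x y => by simp only [e1, e2])
    (fun x => by simp only [cF_pi1, h1 τ x hτ, sub_self]) (fun x => by simp only [cF_pi2, h2 τ x hτ, sub_self])
  rw [cF_inv φ, cF_inv φ']
  exact sub_eq_zero.mp (this _ _)

theorem cF_d2 {k φ} (h : IsHJF k 2 φ) (hk : k % 4 = 0) {τ : ℂ} (hτ : UHP τ) :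
    d2 (fun z => cF φ τ z z) = 2 * d2 (fun z => cF φ τ z 0) := by
  obtain ⟨he, hs⟩ := cF_even_sym h hk hτ
  obtain ⟨c, -, hc⟩ := h.fourier
  have hF : ∀ x y, HasSum (fun i : ℕ × ℤ × ℤ => c i.1 i.2.1 i.2.2 * eC (i.1 * τ + i.2.1 * x - i.2.2 * y)) (cF φ τ x y) := by
    intro x y
    refine (congrArg (fun F => HasSum F _) (funext fun k => ?_)).mpr (hc τ (x + I * y) (x - I * y) hτ)
    congr 2
    linear_combination (-k.2.2 * y) * I_sq
  have gen : ∀ (p q : ℤ) (f : ℂ → ℂ), (∀ z, f z = cF φ τ (p * z) (q * z)) →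
      HasSum (fun i : ℕ × ℤ × ℤ => c i.1 i.2.1 i.2.2 * eC (i.1 * τ) * (2 * Real.pi * I * (p * i.2.1 - q * i.2.2)) ^ 2) (d2 f) := by
    intro p q f hf
    have := hasSum_d2 (fun i : ℕ × ℤ × ℤ => c i.1 i.2.1 i.2.2 * eC (i.1 * τ)) (fun i => p * i.2.1 - q * i.2.2) f (by
      intro z
      rw [hf]
      refine (congrArg (fun F => HasSum F _) (funext fun k => ?_)).mpr (hF (p * z) (q * z))
      rw [mul_assoc, ← eC_add]; congr 2; push_cast; ring)
    refine (congrArg (fun F => HasSum F _) (funext fun k => ?_)).mpr this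
    push_cast; rfl
  have h1 := gen 1 1 (fun z => cF φ τ z z) (by simp)
  have h2 := gen (-1) 1 (fun z => cF φ τ z z) (by simp [he])
  have h3 := gen 1 0 (fun z => cF φ τ z 0) (by simp)
  have h4 := gen 0 1 (fun z => cF φ τ z 0) (by intro z; rw [hs]; simp)
  have e := (h1.add h2).unique ((congrArg (fun F => HasSum F _) (funext fun k => ?_)).mpr ((h3.add h4).mul_left 2))
  · linear_combination (1/2) * e
  · push_cast; ring

theorem D_iff {k : ℕ} (hk : 0 < k) {ψ₁ ψ₂ : ℂ → ℂ → ℂ} (h0 : ∀ τ, UHP τ → ψ₁ τ 0 = ψ₂ τ 0) {τ : ℂ} (hτ : UHP τ) :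
    (2 / 2 : ℂ) * D2J k 2 ψ₁ τ = (2 / 4 : ℂ) * D2J k 4 ψ₂ τ ↔ d2 (ψ₂ τ) = 2 * d2 (ψ₁ τ) := by
  have hd : deriv (fun t => ψ₁ t 0) τ = deriv (fun t => ψ₂ t 0) τ := by
    apply Filter.EventuallyEq.deriv_eq
    filter_upwards [UHP_open.mem_nhds hτ] with t ht using h0 t ht
  have hk' : (k : ℂ) ≠ 0 := by exact_mod_cast hk.ne'
  have hp := tpi_ne
  simp only [D2J, iteratedDeriv_two_eq, hd]
  have hq : (k : ℂ) / (2 * Real.pi * I) ^ 2 ≠ 0 := div_ne_zero hk' (pow_ne_zero 2 hp)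
  constructor
  · intro h
    have : (k : ℂ) / (2 * Real.pi * I) ^ 2 * (d2 (ψ₂ τ) - 2 * d2 (ψ₁ τ)) = 0 := by
      push_cast at h
      linear_combination -2 * h
    exact sub_eq_zero.mp ((mul_eq_zero.mp this).resolve_left hq)
  · intro h
    have h' : d2 (fun z => ψ₂ τ z) = 2 * d2 (ψ₁ τ) := h
    rw [h']
    push_cast
    ring

theorem part3r {k : ℕ} (hk : 0 < k) (hk4 : k % 4 = 0) {ψ₁ ψ₂ : ℂ → ℂ → ℂ} {φ : ℂ → ℂ → ℂ → ℂ} (h : IsHJF k 2 φ)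
    (h1 : ∀ τ z : ℂ, UHP τ → φ τ z z = ψ₁ τ z)
    (h2 : ∀ τ z : ℂ, UHP τ → φ τ ((1 + Complex.I) * z) ((1 - Complex.I) * z) = ψ₂ τ z) :
    ((∀ τ : ℂ, UHP τ → D0J ψ₁ τ = D0J ψ₂ τ) ∧
        (∀ τ : ℂ, UHP τ → (2 / 2 : ℂ) * D2J k 2 ψ₁ τ = (2 / 4 : ℂ) * D2J k 4 ψ₂ τ)) := by
  have h0 : ∀ τ, UHP τ → ψ₁ τ 0 = ψ₂ τ 0 := by
    intro τ hτ
    rw [← h1 τ 0 hτ, ← h2 τ 0 hτ]; simp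
  refine ⟨h0, fun τ hτ => (D_iff hk h0 hτ).mpr ?_⟩
  have e1 : ψ₁ τ = fun z => cF φ τ z 0 := by ext z; rw [cF_pi1, h1 τ z hτ]
  have e2 : ψ₂ τ = fun z => cF φ τ z z := by ext z; rw [cF_pi2, h2 τ z hτ]
  rw [e1, e2, cF_d2 h hk4 hτ]

theorem d2_pow_b {τ : ℂ} (h : UHP τ) (n : ℕ) : d2 (fun z => bT τ z ^ n) = 0 := by
  have hb := (bT_V h).diff
  induction n with
  | zero => simp [d2]
  | succ n ih =>
    simp only [pow_succ]
    rw [d2_mul_even (by fun_prop) hb (by intro z; rw [bT_even]), ih]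
    have := bT_d2 h
    simp [this]

theorem d2_bas {τ : ℂ} (h : UHP τ) (m i : ℕ) : d2 (bas m i τ) = if i = 1 then 2 else 0 := by
  have ha := (aT_V h).diff
  have hb := (bT_V h).diff
  have ha2 : d2 (aT τ) = 2 := aT_d2 h
  have e : bas m i τ = fun z => aT τ z ^ i * bT τ z ^ (m - i) := by ext z; rfl
  rw [e]
  rcases i with _ | _ | i
  · simpa using d2_pow_b h m
  · simp only [zero_add, pow_one]
    rw [d2_mul_even ha (by fun_prop) (aT_even τ)]
    simp [ha2, bT_zero h, aT_zero]
  · have e2 : (fun z => aT τ z ^ (i + 1 + 1) * bT τ z ^ (m - (i + 1 + 1))) = fun z => aT τ z * (aT τ z ^ (i + 1) * bT τ z ^ (m - (i + 1 + 1))) := by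
      ext z; ring
    rw [e2, d2_mul_even ha (by fun_prop) (aT_even τ)]
    simp [aT_zero]

theorem coef_zero {m : ℕ} (hm : 0 < m) {τ : ℂ} (h : UHP τ) {v : ℂ → ℂ} (hv : IsV m τ v)
    (he : ∀ z, v (-z) = v z) : v 0 = coefV m τ v 0 := by
  rw [coefV_spec hm h hv he 0, Finset.sum_eq_single 0]
  · simp [bas, bT_zero h]
  · intro i _ hi
    have : (i:ℕ) ≠ 0 := fun h => hi (Fin.ext h)
    simp [bas, aT_zero, this]
  · simp

theorem coef_one {m : ℕ} (hm : 0 < m) {τ : ℂ} (h : UHP τ) {v : ℂ → ℂ} (hv : IsV m τ v)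
    (he : ∀ z, v (-z) = v z) : d2 v = 2 * coefV m τ v ⟨1, by omega⟩ := by
  have hb : ∀ i : Fin (m + 1), Differentiable ℂ (bas m i τ) := fun i => (bas_V (by omega) h).diff
  have e : v = fun z => ∑ i : Fin (m + 1), coefV m τ v i * bas m i τ z := funext (coefV_spec hm h hv he)
  have hsum : ∀ (s : Finset (Fin (m + 1))) (w : Fin (m + 1) → ℂ), d2 (fun z => ∑ i ∈ s, w i * bas m i τ z) = ∑ i ∈ s, w i * d2 (bas m i τ) := by
    intro s w
    classical
    induction s using Finset.induction_on with
    | empty => simp [d2]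
    | insert a s ha ih =>
      simp only [Finset.sum_insert ha]
      rw [d2_add (by have := hb a; fun_prop) (by fun_prop), ih, d2_const_mul _ (hb a)]
  conv_lhs => rw [e]
  rw [hsum, Finset.sum_eq_single ⟨1, by omega⟩]
  · rw [d2_bas h]; simp; ring
  · intro i _ hi
    rw [d2_bas h, if_neg (fun h => hi (Fin.ext h)), mul_zero]
  · simp

theorem IsJF.lim {k m ψ} (h : IsJF k m ψ) : ∃ l : ℂ, ∀ x, IsR (fun τ => ψ τ x) l := by
  obtain ⟨c, hc0, hc⟩ := h.fourier
  refine ⟨c 0 0, fun x => ?_⟩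
  have := IsR_of (J := ℕ × ℤ) (fun p => c p.1 p.2 * eC (p.2 * x)) (fun p => p.1) (f := fun τ => ψ τ x) (by
    intro τ hτ
    refine (congrArg (fun F => HasSum F _) (funext fun k => ?_)).mpr (hc τ x hτ)
    rw [mul_assoc, ← eC_add, add_comm])
  rw [tsum_eq_single (0, 0)] at this
  · simpa [eC_zero] using this
  · rintro ⟨n, r⟩ hne
    simp only
    split_ifs with hn
    · subst hn
      have hr : r ≠ 0 := by rintro rfl; exact hne rfl
      rw [hc0 0 r (by simpa using (by positivity : 0 < r ^ 2)), zero_mul]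
    · rfl

theorem sL_ne : ∃ z, kap * sL z ≠ 0 := by
  refine ⟨1 / 2, mul_ne_zero kap_ne ?_⟩
  have : eC (1 / 2) = -1 := by
    rw [eC, show 2 * (Real.pi:ℂ) * I * (1 / 2) = Real.pi * I by ring, Complex.exp_pi_mul_I]
  rw [sL, eC_neg, this]; norm_num

theorem lim_poly {m : ℕ} (p : Fin (m + 1) → ℂ) (l : ℂ) (h : ∀ x, ∑ i : Fin (m + 1), p i * (kap * sL x) ^ (i:ℕ) = l) :
    ∀ i, i ≠ 0 → p i = 0 := by
  have hs := sL_diff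
  have := poly_indep (a := fun z => kap * sL z) (b := fun _ => 1) (by fun_prop) (by fun_prop) (by simp [sL_zero]) rfl sL_ne m
    (fun i => p i - if i = 0 then l else 0) (by
      intro z
      simp only [one_pow, mul_one, sub_mul, Finset.sum_sub_distrib, h z]
      simp)
  intro i hi
  have := congrFun this i
  simpa [hi] using this

theorem JF_coef {k m ψ} (hm : 0 < m) (hk : k % 4 = 0) (h : IsJF k m ψ) : ∃ l : Fin (m + 1) → ℂ,
    (∀ i, IsR (fun τ => coefV m τ (ψ τ) i) (l i)) ∧ ∀ i, i ≠ 0 → l i = 0 := by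
  choose l hl using fun i => coefV_R hm h.FS i
  refine ⟨l, hl, ?_⟩
  obtain ⟨L, hL⟩ := h.lim
  apply lim_poly l L
  intro x
  refine IsR.lim_unique ?_ (hL x)
  have := IsR.sum Finset.univ _ _ fun i _ => (hl i).mul ((bas_FSl m i).lim x 0)
  exact this.congr fun τ hτ => coefV_spec hm hτ (h.V hτ) (h.even hk hτ) x

theorem S3_open : IsOpen {p : ℂ × ℂ × ℂ | UHP p.1} := UHP_open.preimage continuous_fst
theorem S2_open : IsOpen {p : ℂ × ℂ | UHP p.1} := UHP_open.preimage continuous_fst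

theorem jT2_diff {f g : ℂ × ℂ → ℂ} {p : ℂ × ℂ} (hf : DifferentiableAt ℂ f p) (hg : DifferentiableAt ℂ g p) (h : 0 < (g p).im) :
    DifferentiableAt ℂ (fun p => jacobiTheta₂ (f p) (g p)) p :=
  DifferentiableAt.comp (g := fun q : ℂ × ℂ => jacobiTheta₂ q.1 q.2) (f := fun p => (f p, g p)) p
    (hasFDerivAt_jacobiTheta₂ (f p) h).differentiableAt (hf.prodMk hg)

theorem comp_fst {f : ℂ → ℂ} (hf : DifferentiableOn ℂ f {τ | UHP τ}) : DifferentiableOn ℂ (fun p : ℂ × ℂ => f p.1) {p | UHP p.1} :=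
  hf.comp (f := fun p : ℂ × ℂ => p.1) (by fun_prop) (fun p hp => hp)

theorem g0_jh : DifferentiableOn ℂ (fun p : ℂ × ℂ => g0 p.1 p.2) {p | UHP p.1} := fun p hp =>
  (jT2_diff (by fun_prop) (by fun_prop) (UHP_two hp)).differentiableWithinAt
theorem g1_jh : DifferentiableOn ℂ (fun p : ℂ × ℂ => g1 p.1 p.2) {p | UHP p.1} := fun p hp => by
  have he := eC_diff
  have h1 : DifferentiableAt ℂ (fun p : ℂ × ℂ => jacobiTheta₂ (2 * p.2 + p.1) (2 * p.1)) p := jT2_diff (by fun_prop) (by fun_prop) (UHP_two hp)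
  have h2 : DifferentiableAt ℂ (fun p : ℂ × ℂ => eC p.2 * jacobiTheta₂ (2 * p.2 + p.1) (2 * p.1)) p := by fun_prop
  exact h2.differentiableWithinAt
theorem aT_jh : DifferentiableOn ℂ (fun p : ℂ × ℂ => aT p.1 p.2) {p | UHP p.1} := by
  have h1 := comp_fst ((g0z_R.const_mul 2).mul Wdi_R).holo
  have h2 := comp_fst (((g1z_R.const_mul 2).mul Wdi_R).const_mul (-1)).holo
  refine ((h1.mul g1_jh).add (h2.mul g0_jh)).congr fun p _ => ?_
  simp only [aT, Pi.add_apply, Pi.mul_apply]; ring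
theorem bT_jh : DifferentiableOn ℂ (fun p : ℂ × ℂ => bT p.1 p.2) {p | UHP p.1} := by
  have h1 := comp_fst (g1d_R.mul Wdi_R).holo
  have h2 := comp_fst ((g0d_R.mul Wdi_R).const_mul (-1)).holo
  refine ((h1.mul g0_jh).add (h2.mul g1_jh)).congr fun p _ => ?_
  simp only [bT, Pi.add_apply, Pi.mul_apply]; ring

def FF (C : Fin 6 → ℂ → ℂ) (τ x y : ℂ) : ℂ :=
  C 0 τ * (bT τ x ^ 2 * bT τ y ^ 2) + C 1 τ * (aT τ x * bT τ x * bT τ y ^ 2 + bT τ x ^ 2 * (aT τ y * bT τ y))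
  + C 2 τ * (aT τ x ^ 2 * bT τ y ^ 2 + bT τ x ^ 2 * aT τ y ^ 2) + C 3 τ * (aT τ x * bT τ x * (aT τ y * bT τ y))
  + C 4 τ * (aT τ x ^ 2 * (aT τ y * bT τ y) + aT τ x * bT τ x * aT τ y ^ 2) + C 5 τ * (aT τ x ^ 2 * aT τ y ^ 2)

theorem FF_sym (C τ x y) : FF C τ x y = FF C τ y x := by simp only [FF]; ring
theorem FF_even (C τ x y) : FF C τ (-x) y = FF C τ x y := by simp only [FF, aT_even, bT_even]
theorem FF_V (C) {τ} (hτ : UHP τ) (y : ℂ) : IsV 2 τ (fun x => FF C τ x y) := by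
  have h0 := bas_V (m := 2) (i := 0) (by omega) hτ
  have h1 := bas_V (m := 2) (i := 1) (by omega) hτ
  have h2 := bas_V (m := 2) (i := 2) (by omega) hτ
  have := ((h0.const_mul (C 0 τ * bT τ y ^ 2 + C 1 τ * (aT τ y * bT τ y) + C 2 τ * aT τ y ^ 2)).add
    (h1.const_mul (C 1 τ * bT τ y ^ 2 + C 3 τ * (aT τ y * bT τ y) + C 4 τ * aT τ y ^ 2))).add
    (h2.const_mul (C 2 τ * bT τ y ^ 2 + C 4 τ * (aT τ y * bT τ y) + C 5 τ * aT τ y ^ 2))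
  refine (congrArg (IsV 2 τ) (funext fun x => ?_)).mp this
  simp only [FF, bas]
  norm_num
  ring

theorem FF_holo_aux {S : Set (ℂ × ℂ × ℂ)} {c0 c1 c2 c3 c4 c5 a b a' b' : ℂ × ℂ × ℂ → ℂ} (h0 : DifferentiableOn ℂ c0 S)
    (h1 : DifferentiableOn ℂ c1 S) (h2 : DifferentiableOn ℂ c2 S) (h3 : DifferentiableOn ℂ c3 S) (h4 : DifferentiableOn ℂ c4 S)
    (h5 : DifferentiableOn ℂ c5 S) (ha : DifferentiableOn ℂ a S) (hb : DifferentiableOn ℂ b S) (ha' : DifferentiableOn ℂ a' S)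
    (hb' : DifferentiableOn ℂ b' S) : DifferentiableOn ℂ (fun p => c0 p * (b p ^ 2 * b' p ^ 2) + c1 p * (a p * b p * b' p ^ 2 + b p ^ 2 * (a' p * b' p))
    + c2 p * (a p ^ 2 * b' p ^ 2 + b p ^ 2 * a' p ^ 2) + c3 p * (a p * b p * (a' p * b' p))
    + c4 p * (a p ^ 2 * (a' p * b' p) + a p * b p * a' p ^ 2) + c5 p * (a p ^ 2 * a' p ^ 2)) S := by
  fun_prop

theorem FF_holo (C : Fin 6 → ℂ → ℂ) (hC : ∀ i, DifferentiableOn ℂ (C i) {τ | UHP τ}) :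
    DifferentiableOn ℂ (fun p : ℂ × ℂ × ℂ => FF C p.1 p.2.1 p.2.2) {p | UHP p.1} := by
  have hc : ∀ i, DifferentiableOn ℂ (fun p : ℂ × ℂ × ℂ => C i p.1) {p | UHP p.1} := fun i =>
    (hC i).comp (f := fun p : ℂ × ℂ × ℂ => p.1) (by fun_prop) (fun p hp => hp)
  have hc0 := hc 0
  have hc1 := hc 1
  have hc2 := hc 2
  have hc3 := hc 3
  have hc4 := hc 4
  have hc5 := hc 5
  have ha : DifferentiableOn ℂ (fun p : ℂ × ℂ × ℂ => aT p.1 p.2.1) {p | UHP p.1} :=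
    aT_jh.comp (f := fun p : ℂ × ℂ × ℂ => (p.1, p.2.1)) (by fun_prop) (fun p hp => hp)
  have ha' : DifferentiableOn ℂ (fun p : ℂ × ℂ × ℂ => aT p.1 p.2.2) {p | UHP p.1} :=
    aT_jh.comp (f := fun p : ℂ × ℂ × ℂ => (p.1, p.2.2)) (by fun_prop) (fun p hp => hp)
  have hb : DifferentiableOn ℂ (fun p : ℂ × ℂ × ℂ => bT p.1 p.2.1) {p | UHP p.1} :=
    bT_jh.comp (f := fun p : ℂ × ℂ × ℂ => (p.1, p.2.1)) (by fun_prop) (fun p hp => hp)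
  have hb' : DifferentiableOn ℂ (fun p : ℂ × ℂ × ℂ => bT p.1 p.2.2) {p | UHP p.1} :=
    bT_jh.comp (f := fun p : ℂ × ℂ × ℂ => (p.1, p.2.2)) (by fun_prop) (fun p hp => hp)
  exact FF_holo_aux hc0 hc1 hc2 hc3 hc4 hc5 ha hb ha' hb'

theorem FF_FSl (C : Fin 6 → ℂ → ℂ) (l : ℂ) (h0 : IsR (C 0) l) (hC : ∀ i, i ≠ 0 → IsR (C i) 0) :
    FSl (FF C) (fun _ _ => l) := by
  have ha := aT_FSl
  have hb := bT_FSl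
  have ha' := aT_FSl.swap
  have hb' := bT_FSl.swap
  have H := ((((((FSl_of_R h0).mul ((hb.pow 2).mul (hb'.pow 2))).add
    ((FSl_of_R (hC 1 (by decide))).mul (((ha.mul hb).mul (hb'.pow 2)).add ((hb.pow 2).mul (ha'.mul hb'))))).add
    ((FSl_of_R (hC 2 (by decide))).mul (((ha.pow 2).mul (hb'.pow 2)).add ((hb.pow 2).mul (ha'.pow 2))))).add
    ((FSl_of_R (hC 3 (by decide))).mul ((ha.mul hb).mul (ha'.mul hb')))).add
    ((FSl_of_R (hC 4 (by decide))).mul (((ha.pow 2).mul (ha'.mul hb')).add ((ha.mul hb).mul (ha'.pow 2))))).add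
    ((FSl_of_R (hC 5 (by decide))).mul ((ha.pow 2).mul (ha'.pow 2)))
  refine (congrArg (FSl (FF C)) (funext fun x => funext fun y => ?_)).mp H
  simp

theorem FF_slash (C : Fin 6 → ℂ → ℂ) {k : ℕ} {ψ₁ ψ₂ : ℂ → ℂ → ℂ} (h1 : IsJF k 2 ψ₁) (h2 : IsJF k 4 ψ₂)
    (e1 : ∀ τ x, UHP τ → FF C τ x 0 = ψ₁ τ x) (e2 : ∀ τ x, UHP τ → FF C τ x x = ψ₂ τ x)
    (M : Matrix.SpecialLinearGroup (Fin 2) ℤ) {τ : ℂ} (hτ : UHP τ) (x y : ℂ) :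
    FF C ((Ma M * τ + Mb M) / (Mc M * τ + Md M)) (x / (Mc M * τ + Md M)) (y / (Mc M * τ + Md M))
      = (Mc M * τ + Md M) ^ k * eC (2 * Mc M * (x ^ 2 + y ^ 2) / (Mc M * τ + Md M)) * FF C τ x y := by
  have hM := UHP_smul M hτ
  have hj := Mj_ne M hτ
  have t1 := h1.transf M τ
  have t2 := h2.transf M τ
  have sl := fun y => IsV.slash (m := 2) M hτ (FF_V C hM (y / (Mc M * τ + Md M)))
  set j := Mc M * τ + Md M with hjd
  set T := (Ma M * τ + Mb M) / j with hT
  have := uniq_two hτ (fun x y => (j ^ k)⁻¹ * eC (-2 * Mc M * (x ^ 2 + y ^ 2) / j) * FF C T (x / j) (y / j) - FF C τ x y)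
    (fun x y => by simp only [FF_sym C T (x / j), FF_sym C τ x, add_comm (x ^ 2)])
    (fun y => by
      have := ((sl y).const_mul ((j ^ k)⁻¹ * eC (-2 * Mc M * y ^ 2 / j))).sub (FF_V C hτ y)
      refine (congrArg (IsV 2 τ) (funext fun x => ?_)).mp this
      rw [← mul_assoc, mul_assoc _ (eC _) (eC _), ← eC_add]
      congr 4; push_cast; ring)
    (fun x y => by simp only [neg_div, FF_even, neg_sq])
    (fun x => by
      rw [zero_div, e1 _ _ hM, e1 _ _ hτ, t1 x hτ]
      have e : eC (-2 * Mc M * (x ^ 2 + 0 ^ 2) / j) * eC (((2:ℕ):ℂ) * Mc M * x ^ 2 / j) = 1 := by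
        rw [← eC_add, ← eC_zero]; congr 1; push_cast; ring
      have e' : (j ^ k)⁻¹ * j ^ k = 1 := inv_mul_cancel₀ (pow_ne_zero _ hj)
      linear_combination (j ^ k)⁻¹ * j ^ k * ψ₁ τ x * e + ψ₁ τ x * e')
    (fun x => by
      rw [e2 _ _ hM, e2 _ _ hτ, t2 x hτ]
      have e : eC (-2 * Mc M * (x ^ 2 + x ^ 2) / j) * eC (((4:ℕ):ℂ) * Mc M * x ^ 2 / j) = 1 := by
        rw [← eC_add, ← eC_zero]; congr 1; push_cast; ring
      have e' : (j ^ k)⁻¹ * j ^ k = 1 := inv_mul_cancel₀ (pow_ne_zero _ hj)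
      linear_combination (j ^ k)⁻¹ * j ^ k * ψ₂ τ x * e + ψ₂ τ x * e') x y
  have e : eC (-2 * Mc M * (x ^ 2 + y ^ 2) / j) * eC (2 * Mc M * (x ^ 2 + y ^ 2) / j) = 1 := by
    rw [← eC_add, ← eC_zero]; congr 1; push_cast; ring
  have e' : j ^ k * (j ^ k)⁻¹ = 1 := mul_inv_cancel₀ (pow_ne_zero _ hj)
  linear_combination (j ^ k * eC (2 * Mc M * (x ^ 2 + y ^ 2) / j)) * this - FF C T (x / j) (y / j) * j ^ k * (j ^ k)⁻¹ * e
    - FF C T (x / j) (y / j) * e'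

theorem FF_HJF (C : Fin 6 → ℂ → ℂ) {k : ℕ} (hk : k % 4 = 0) {ψ₁ ψ₂ : ℂ → ℂ → ℂ} (h1 : IsJF k 2 ψ₁) (h2 : IsJF k 4 ψ₂)
    (e1 : ∀ τ x, UHP τ → FF C τ x 0 = ψ₁ τ x) (e2 : ∀ τ x, UHP τ → FF C τ x x = ψ₂ τ x)
    (l : ℂ) (h0 : IsR (C 0) l) (hC : ∀ i, i ≠ 0 → IsR (C i) 0) :
    IsHJF k 2 (fun τ z₁ z₂ => FF C τ ((z₁ + z₂) / 2) (-I * (z₁ - z₂) / 2)) where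
  holo := by
    have hd : ∀ i, DifferentiableOn ℂ (C i) {τ | UHP τ} := fun i => by
      by_cases hi : i = 0
      · subst hi; exact h0.holo
      · exact (hC i hi).holo
    exact DifferentiableOn.comp (g := fun p : ℂ × ℂ × ℂ => FF C p.1 p.2.1 p.2.2)
      (f := fun p : ℂ × ℂ × ℂ => (p.1, (p.2.1 + p.2.2) / 2, -I * (p.2.1 - p.2.2) / 2)) (FF_holo C hd) (by fun_prop) (fun p hp => hp)
  transf := by
    intro ε hε M τ z₁ z₂ hτ
    have hI : I ^ k = 1 := by
      obtain ⟨j, rfl⟩ : ∃ j, k = 4 * j := ⟨k / 4, by omega⟩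
      rw [pow_mul, I_pow_four, one_pow]
    have hev : Even k := Nat.even_iff.mpr (by omega)
    have ey : ∀ τ x y, FF C τ x (-y) = FF C τ x y := fun τ x y => by rw [FF_sym, FF_even, FF_sym]
    have key := FF_slash C h1 h2 e1 e2 M hτ ((z₁ + z₂) / 2) (-I * (z₁ - z₂) / 2)
    have hexp : 2 * Mc M * (((z₁ + z₂) / 2) ^ 2 + (-I * (z₁ - z₂) / 2) ^ 2) / (Mc M * τ + Md M) = ((2:ℕ):ℂ) * Mc M * z₁ * z₂ / (Mc M * τ + Md M) := by
      push_cast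
      linear_combination (2 * Mc M * ((z₁ - z₂) / 2) ^ 2 / (Mc M * τ + Md M)) * I_sq
    rw [hexp] at key
    simp only [Set.mem_insert_iff, Set.mem_singleton_iff] at hε
    rcases hε with rfl | rfl | rfl | rfl
    · simp only [one_pow, map_one, one_mul]
      rw [← key]; congr 1 <;> ring
    · simp only [hev.neg_one_pow, map_neg, map_one, one_mul]
      rw [← key, ← FF_even, ← ey]; congr 1 <;> ring
    · simp only [hI, Complex.conj_I, one_mul]
      rw [← key, FF_sym, ← ey]; congr 1
      · linear_combination (-(z₁ + z₂) / 2 / (Mc M * τ + Md M)) * I_sq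
      · ring
    · simp only [hev.neg_pow, hI, map_neg, Complex.conj_I, one_mul]
      rw [← key, FF_sym, ← FF_even]; congr 1
      · linear_combination (-(z₁ + z₂) / 2 / (Mc M * τ + Md M)) * I_sq
      · ring
  ellip := by
    intro p q u v τ z₁ z₂ hτ
    have l1 := fun y => (FF_V C hτ y).law p u ((z₁ + z₂) / 2)
    have l2 := fun x => (FF_V C hτ x).law q v (-I * (z₁ - z₂) / 2)
    beta_reduce at l1 l2
    have a1 : (z₁ + ((p : ℂ) + (q : ℂ) * I) * τ + ((u : ℂ) + (v : ℂ) * I) + (z₂ + ((p : ℂ) - (q : ℂ) * I) * τ + ((u : ℂ) - (v : ℂ) * I))) / 2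
      = (z₁ + z₂) / 2 + p * τ + u := by ring
    have a2 : -I * (z₁ + ((p : ℂ) + (q : ℂ) * I) * τ + ((u : ℂ) + (v : ℂ) * I) - (z₂ + ((p : ℂ) - (q : ℂ) * I) * τ + ((u : ℂ) - (v : ℂ) * I))) / 2
      = -I * (z₁ - z₂) / 2 + q * τ + v := by linear_combination (-(q * τ) - v) * I_sq
    rw [a1, a2, l1, FF_sym, l2, FF_sym, ← mul_assoc, ← eC_add]
    congr 2
    push_cast; ring
  fourier := by
    have H := FF_FSl C l h0 hC
    obtain ⟨c, hc, -, hc2⟩ := supp_main H.fs l H.lim (fun τ x y hτ => by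
      have := (FF_V C hτ y).qper x; exact_mod_cast this)
    have hc2 := hc2 (fun τ x y hτ => by
      rw [FF_sym, FF_sym C τ x]
      have := (FF_V C hτ x).qper y; exact_mod_cast this)
    refine ⟨fun n a b => c (n, a, -b), fun n a b h => hc2 _ _ _ (by push_cast at h; linarith [neg_sq b]), ?_⟩
    intro τ z₁ z₂ hτ
    let e : ℕ × ℤ × ℤ ≃ ℕ × ℤ × ℤ := Equiv.prodCongr (Equiv.refl _) (Equiv.prodCongr (Equiv.refl _) (Equiv.neg ℤ))
    have := e.hasSum_iff.mpr (hc τ ((z₁ + z₂) / 2) (-I * (z₁ - z₂) / 2) hτ)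
    refine (congrArg (fun F => HasSum F _) (funext fun i => ?_)).mpr this
    simp only [Function.comp, e, Equiv.prodCongr_apply, Prod.map, Equiv.refl_apply, Equiv.neg_apply, chi]
    congr 2
    push_cast; ring

theorem part3 {k : ℕ} (hk : 0 < k) (hk4 : k % 4 = 0) {ψ₁ ψ₂ : ℂ → ℂ → ℂ} (h1 : IsJF k 2 ψ₁) (h2 : IsJF k 4 ψ₂)
    (h0 : ∀ τ : ℂ, UHP τ → D0J ψ₁ τ = D0J ψ₂ τ)
    (hd : ∀ τ : ℂ, UHP τ → (2 / 2 : ℂ) * D2J k 2 ψ₁ τ = (2 / 4 : ℂ) * D2J k 4 ψ₂ τ) :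
    ∃ φ : ℂ → ℂ → ℂ → ℂ, IsHJF k 2 φ ∧ (∀ τ z : ℂ, UHP τ → φ τ z z = ψ₁ τ z) ∧
      (∀ τ z : ℂ, UHP τ → φ τ ((1 + Complex.I) * z) ((1 - Complex.I) * z) = ψ₂ τ z) := by
  obtain ⟨l, hl, hl0⟩ := JF_coef (by omega) hk4 h1
  obtain ⟨l', hl', hl0'⟩ := JF_coef (by omega) hk4 h2
  let C : Fin 6 → ℂ → ℂ := ![fun τ => coefV 2 τ (ψ₁ τ) 0, fun τ => coefV 2 τ (ψ₁ τ) 1, fun τ => coefV 2 τ (ψ₁ τ) 2,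
    fun τ => coefV 4 τ (ψ₂ τ) 2 + (-2) * coefV 2 τ (ψ₁ τ) 2, fun τ => (1 / 2) * coefV 4 τ (ψ₂ τ) 3, fun τ => coefV 4 τ (ψ₂ τ) 4]
  have s1 : ∀ τ x, UHP τ → FF C τ x 0 = ψ₁ τ x := by
    intro τ x hτ
    rw [coefV_spec (by omega) hτ (h1.V hτ) (h1.even hk4 hτ) x]
    simp [FF, C, Fin.sum_univ_succ, bas, aT_zero, bT_zero hτ]
    ring
  have s2 : ∀ τ x, UHP τ → FF C τ x x = ψ₂ τ x := by
    intro τ x hτ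
    have c0 := h0 τ hτ
    have c1 := (D_iff hk h0 hτ).mp (hd τ hτ)
    simp only [D0J] at c0
    rw [coef_zero (by omega) hτ (h1.V hτ) (h1.even hk4 hτ), coef_zero (by omega) hτ (h2.V hτ) (h2.even hk4 hτ)] at c0
    rw [coef_one (by omega) hτ (h1.V hτ) (h1.even hk4 hτ), coef_one (by omega) hτ (h2.V hτ) (h2.even hk4 hτ)] at c1
    rw [coefV_spec (by omega) hτ (h2.V hτ) (h2.even hk4 hτ) x]
    have c1' : coefV 4 τ (ψ₂ τ) 1 = 2 * coefV 2 τ (ψ₁ τ) 1 := by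
      have : 2 * coefV 4 τ (ψ₂ τ) 1 = 2 * (2 * coefV 2 τ (ψ₁ τ) 1) := c1
      linear_combination (1/2) * this
    rw [show (∑ i : Fin (4 + 1), coefV 4 τ (ψ₂ τ) i * bas 4 i τ x) = _ from Fin.sum_univ_five _]
    rw [c1', ← c0]
    simp [FF, C, bas]
    ring
  refine ⟨_, FF_HJF C hk4 h1 h2 s1 s2 (l 0) (hl 0) ?_, ?_, ?_⟩
  · have z1 : ∀ i, i ≠ 0 → IsR (fun τ => coefV 2 τ (ψ₁ τ) i) 0 := fun i hi => hl0 i hi ▸ hl i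
    have z2 : ∀ i, i ≠ 0 → IsR (fun τ => coefV 4 τ (ψ₂ τ) i) 0 := fun i hi => hl0' i hi ▸ hl' i
    intro i hi
    fin_cases i
    · exact absurd rfl hi
    · exact z1 1 (by decide)
    · exact z1 2 (by decide)
    · have := (z2 2 (by decide)).add ((z1 2 (by decide)).const_mul (-2))
      rw [mul_zero, add_zero] at this
      exact this
    · have := ((z2 3 (by decide)).const_mul (1 / 2))
      rw [mul_zero] at this
      exact this
    · exact z2 4 (by decide)
  · intro τ z hτ
    rw [← s1 τ z hτ]; congr 1 <;> ring
  · intro τ z hτ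
    rw [← s2 τ z hτ]; congr 1
    · ring
    · linear_combination (-z) * I_sq

theorem oc_smul (M : Matrix.SpecialLinearGroup (Fin 2) ℤ) {τ : ℂ} (hτ : UHP τ) :
    UpperHalfPlane.ofComplex ((Ma M * τ + Mb M) / (Mc M * τ + Md M)) = M • (⟨τ, hτ⟩ : UpperHalfPlane) := by
  rw [UpperHalfPlane.ofComplex_apply_of_im_pos (UHP_smul M hτ), UpperHalfPlane.specialLinearGroup_apply]
  ext
  simp [Ma, Mb, Mc, Md]

theorem MT : Ma ModularGroup.T = 1 ∧ Mb ModularGroup.T = 1 ∧ Mc ModularGroup.T = 0 ∧ Md ModularGroup.T = 1 := by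
  simp [Ma, Mb, Mc, Md, ModularGroup.T]

theorem R_of_bdd (g : UpperHalfPlane → ℂ) (hp : ∀ τ, UHP τ → g (UpperHalfPlane.ofComplex (τ + 1)) = g (UpperHalfPlane.ofComplex τ))
    (h2 : MDifferentiable (modelWithCornersSelf ℂ ℂ) (modelWithCornersSelf ℂ ℂ) g) (h3 : UpperHalfPlane.IsBoundedAtImInfty g) :
    IsR (fun τ => g (UpperHalfPlane.ofComplex τ)) ((UpperHalfPlane.qExpansion 1 g).coeff 0) := by
  have h1 : Function.Periodic (g ∘ UpperHalfPlane.ofComplex) ((1:ℝ):ℂ) := by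
    intro t
    simp only [Function.comp]
    by_cases ht : UHP t
    · simpa using hp t ht
    · have ht' : t.im ≤ 0 := not_lt.mp ht
      rw [UpperHalfPlane.ofComplex_apply_of_im_nonpos ht', UpperHalfPlane.ofComplex_apply_of_im_nonpos (by simpa using ht')]
  have := IsR_of (J := ℕ) (fun n => (UpperHalfPlane.qExpansion 1 g).coeff n) (fun n => n) (f := fun τ => g (UpperHalfPlane.ofComplex τ)) (by
    intro τ hτ
    have := UpperHalfPlane.hasSum_qExpansion (f := g) one_pos h1 h2 h3 ⟨τ, hτ⟩
    rw [UpperHalfPlane.ofComplex_apply_of_im_pos hτ]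
    refine (congrArg (fun F => HasSum F _) (funext fun k => ?_)).mpr this
    rw [smul_eq_mul, eC_nat_mul]
    congr 2
    simp [eC, Function.Periodic.qParam])
  rwa [tsum_ite_eq] at this

theorem exists_e : ∃ (e : ℂ → ℂ) (E : ℂ), IsR e E ∧ ∀ (M : Matrix.SpecialLinearGroup (Fin 2) ℤ) (τ : ℂ), UHP τ →
    e ((Ma M * τ + Mb M) / (Mc M * τ + Md M)) = (Mc M * τ + Md M) ^ 2 * e τ + 2 * Real.pi * I * Mc M * (Mc M * τ + Md M) := by
  have law : ∀ (M : Matrix.SpecialLinearGroup (Fin 2) ℤ) (τ : ℂ) (hτ : UHP τ),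
    EisensteinSeries.E2 (UpperHalfPlane.ofComplex ((Ma M * τ + Mb M) / (Mc M * τ + Md M))) = (Mc M * τ + Md M) ^ 2 * EisensteinSeries.E2 (UpperHalfPlane.ofComplex τ) - (1 / (2 * riemannZeta 2)) * (2 * Real.pi * I * Mc M * (Mc M * τ + Md M)) := by
    intro M τ hτ
    have h := congrFun (EisensteinSeries.E2_slash_action M) ⟨τ, hτ⟩
    have hj := Mj_ne M hτ
    rw [oc_smul M hτ, UpperHalfPlane.ofComplex_apply_of_im_pos hτ]
    rw [ModularForm.SL_slash_apply, ModularGroup.denom_apply] at h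
    simp only [Pi.sub_apply, Pi.smul_apply, EisensteinSeries.D2, smul_eq_mul] at h
    change _ * (Mc M * τ + Md M) ^ (-2 : ℤ) = _ - 1 / (2 * riemannZeta 2) * (2 * Real.pi * I * Mc M / (Mc M * τ + Md M)) at h
    generalize Mc M * τ + Md M = j at *
    rw [zpow_neg, ← div_eq_mul_inv, div_eq_iff (zpow_ne_zero _ hj)] at h
    rw [h, zpow_ofNat, sub_mul]
    field_simp
  have hz : 1 / (2 * riemannZeta 2) ≠ 0 := by
    rw [riemannZeta_two]
    have := Real.pi_ne_zero
    simp [this]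
  set μ := 1 / (2 * riemannZeta 2) with hμ
  have hR := R_of_bdd EisensteinSeries.E2 (by
    intro τ hτ
    have := law ModularGroup.T τ hτ
    obtain ⟨h1, h2, h3, h4⟩ := MT
    simpa [h1, h2, h3, h4] using this) E2_mdifferentiable EisensteinSeries.isBoundedAtImInfty_E2
  refine ⟨_, _, hR.const_mul (-μ⁻¹), ?_⟩
  intro M τ hτ
  simp only [law M τ hτ]
  have : μ⁻¹ * μ = 1 := inv_mul_cancel₀ hz
  linear_combination (2 * Real.pi * I * Mc M * (Mc M * τ + Md M)) * this

theorem exists_G {k : ℕ} (hk : 3 ≤ k) (hk2 : Even k) : ∃ (e : ℂ → ℂ), IsR e 1 ∧ ∀ (M : Matrix.SpecialLinearGroup (Fin 2) ℤ) (τ : ℂ), UHP τ →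
    e ((Ma M * τ + Mb M) / (Mc M * τ + Md M)) = (Mc M * τ + Md M) ^ k * e τ := by
  have law : ∀ (M : Matrix.SpecialLinearGroup (Fin 2) ℤ) (τ : ℂ) (hτ : UHP τ),
    ModularForm.E hk (UpperHalfPlane.ofComplex ((Ma M * τ + Mb M) / (Mc M * τ + Md M))) = (Mc M * τ + Md M) ^ k * ModularForm.E hk (UpperHalfPlane.ofComplex τ) := by
    intro M τ hτ
    rw [oc_smul M hτ, UpperHalfPlane.ofComplex_apply_of_im_pos hτ]
    have := SlashInvariantForm.slash_action_eqn'' (ModularForm.E hk) (γ := Matrix.SpecialLinearGroup.mapGL ℝ M) (by simp) ⟨τ, hτ⟩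
    refine Eq.trans this ?_
    have e : UpperHalfPlane.denom (Matrix.SpecialLinearGroup.mapGL ℝ M) τ = Mc M * τ + Md M := by
      exact ModularGroup.denom_apply M ⟨τ, hτ⟩
    rw [zpow_natCast]
    congr 2
  have hR := R_of_bdd (ModularForm.E hk) (by
    intro τ hτ
    have := law ModularGroup.T τ hτ
    obtain ⟨h1, h2, h3, h4⟩ := MT
    simpa [h1, h2, h3, h4] using this) (ModularFormClass.holo _) (ModularFormClass.bdd_at_infty _)
  rw [EisensteinSeries.E_qExpansion_coeff_zero hk hk2] at hR
  exact ⟨_, hR, law⟩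

theorem IsMF.R {k f} (h : IsMF k f) : ∃ l, IsR f l := by
  have hR := R_of_bdd (fun z => f z) (by
    intro τ hτ
    have := h.transf ModularGroup.T τ hτ
    obtain ⟨h1, h2, h3, h4⟩ := MT
    rw [UpperHalfPlane.ofComplex_apply_of_im_pos hτ, UpperHalfPlane.ofComplex_apply_of_im_pos (UHP_add1 hτ)]
    simpa [h1, h2, h3, h4] using this) (by
    rw [UpperHalfPlane.mdifferentiable_iff]
    refine h.holo.congr ?_
    intro t ht
    simp only [Function.comp]
    rw [UpperHalfPlane.ofComplex_apply_of_im_pos ht]) (by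
    rw [UpperHalfPlane.isBoundedAtImInfty_iff]
    obtain ⟨A, B, hAB⟩ := h.bounded
    exact ⟨A, B, fun z hz => hAB _ hz⟩)
  exact ⟨_, hR.congr fun τ hτ => by rw [UpperHalfPlane.ofComplex_apply_of_im_pos hτ]⟩

theorem IsCF.R {k g} (h : IsCF k g) : IsR g 0 where
  holo := h.holo
  per τ hτ := by
    have := h.transf ModularGroup.T τ hτ
    obtain ⟨h1, h2, h3, h4⟩ := MT
    simpa [h1, h2, h3, h4] using this
  lim := by
    rw [Metric.tendsto_nhds]
    intro ε hε
    obtain ⟨B, hB⟩ := h.decay (ε / 2) (by positivity)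
    filter_upwards [Filter.preimage_mem_comap (Filter.eventually_ge_atTop B)] with τ hτ
    rw [dist_zero_right]
    exact (hB τ hτ).trans_lt (by linarith)

theorem IsR.deriv {f l} (h : IsR f l) : IsR (deriv f) 0 where
  holo := h.holo.deriv UHP_open
  per τ hτ := by
    rw [← deriv_comp_add_const]
    apply Filter.EventuallyEq.deriv_eq
    filter_upwards [UHP_open.mem_nhds hτ] with t ht using h.per t ht
  lim := by
    rw [Metric.tendsto_nhds]
    intro ε hε
    have h1 := Metric.tendsto_nhds.mp h.lim (ε / 2) (by positivity)
    rw [Filter.eventually_comap] at h1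
    obtain ⟨B, hB⟩ := Filter.eventually_atTop.mp h1
    filter_upwards [Filter.preimage_mem_comap (Filter.eventually_ge_atTop (max B 0 + 2))] with τ hτ
    rw [dist_zero_right]
    have hτ' : max B 0 + 2 ≤ τ.im := hτ
    have him : ∀ z ∈ Metric.closedBall τ 1, max B 0 < z.im := by
      intro z hz
      have h2 : |(z - τ).im| ≤ 1 := (Complex.abs_im_le_norm _).trans (by simpa [dist_eq_norm] using hz)
      rw [Complex.sub_im, abs_le] at h2
      linarith [h2.1]
    have h3 := Complex.norm_deriv_le_of_forall_mem_sphere_norm_le (c := τ) (R := 1) (C := ε / 2) (f := fun z => f z - l) one_pos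
      (by
        have : DifferentiableOn ℂ (fun z => f z - l) (Metric.closedBall τ 1) :=
          (h.holo.mono fun z hz => lt_of_le_of_lt (le_max_right B 0) (him z hz)).sub_const l
        exact this.diffContOnCl_ball (subset_refl _))
      (by
        intro z hz
        have := hB z.im ((le_max_left B 0).trans (him z (Metric.sphere_subset_closedBall hz)).le) z rfl
        rw [dist_eq_norm] at this
        exact this.le)
    rw [deriv_sub_const] at h3
    linarith

theorem deriv_law {k f} (h : IsMF k f) (M : Matrix.SpecialLinearGroup (Fin 2) ℤ) {τ : ℂ} (hτ : UHP τ) :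
    deriv f ((Ma M * τ + Mb M) / (Mc M * τ + Md M)) = (Mc M * τ + Md M) ^ (k + 2) * deriv f τ + k * Mc M * (Mc M * τ + Md M) ^ (k + 1) * f τ := by
  have hj := Mj_ne M hτ
  have hd := Mdet M
  have d0 : HasDerivAt (fun t => Mc M * t + Md M) (Mc M) τ := by
    simpa using ((hasDerivAt_id τ).const_mul (Mc M)).add_const (Md M)
  have d0' : HasDerivAt (fun t => Ma M * t + Mb M) (Ma M) τ := by
    simpa using ((hasDerivAt_id τ).const_mul (Ma M)).add_const (Mb M)
  have d1 := d0'.div d0 hj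
  have df := (h.holo.differentiableAt (UHP_open.mem_nhds hτ)).hasDerivAt
  have df' := (h.holo.differentiableAt (UHP_open.mem_nhds (UHP_smul M hτ))).hasDerivAt
  have L := HasDerivAt.comp τ (h₂ := f) df' d1
  have R := (d0.pow k).mul df
  have e : (f ∘ fun t => (Ma M * t + Mb M) / (Mc M * t + Md M)) =ᶠ[nhds τ] ((fun t => Mc M * t + Md M) ^ k * f) := by
    filter_upwards [UHP_open.mem_nhds hτ] with t ht using h.transf M t ht
  have key := (L.congr_of_eventuallyEq e.symm).unique R
  simp only [Pi.pow_apply] at key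
  have e2 : Ma M * (Mc M * τ + Md M) - (Ma M * τ + Mb M) * Mc M = 1 := by linear_combination hd
  rw [e2] at key
  have hk' : (k:ℂ) * (Mc M * τ + Md M) ^ (k - 1) * (Mc M * τ + Md M) = k * (Mc M * τ + Md M) ^ k := by
    rcases k with _ | k
    · simp
    · simp [pow_succ]; ring
  have e3 : (1 / (Mc M * τ + Md M) ^ 2) * (Mc M * τ + Md M) ^ 2 = 1 := by field_simp
  generalize Mc M * τ + Md M = j at *
  generalize deriv f ((Ma M * τ + Mb M) / j) = D at *
  linear_combination j ^ 2 * key - D * e3 + Mc M * f τ * j * hk'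

theorem d2_eC_sq (κ : ℂ) : d2 (fun z => eC (κ * z ^ 2)) = 2 * (2 * Real.pi * I * κ) := by
  have h1 : deriv (fun z => eC (κ * z ^ 2)) = fun z => (2 * Real.pi * I * κ) * (2 * z) * eC (κ * z ^ 2) := by
    ext z
    have : HasDerivAt (fun z : ℂ => 2 * (Real.pi : ℂ) * I * (κ * z ^ 2)) (2 * (Real.pi : ℂ) * I * (κ * (2 * z))) z := by
      have := (((hasDerivAt_pow 2 z).const_mul κ).const_mul (2 * (Real.pi : ℂ) * I))
      simpa using this
    have := this.cexp.deriv
    simp only [eC]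
    rw [this]; ring
  have he := eC_diff
  have h2 : HasDerivAt (fun z : ℂ => (2 * Real.pi * I * κ) * (2 * z) * eC (κ * z ^ 2)) (2 * (2 * Real.pi * I * κ)) 0 := by
    have a1 : HasDerivAt (fun z : ℂ => (2 * Real.pi * I * κ) * (2 * z)) ((2 * Real.pi * I * κ) * (2 * 1)) 0 :=
      ((hasDerivAt_id (0:ℂ)).const_mul 2).const_mul _
    have a2 : DifferentiableAt ℂ (fun z : ℂ => eC (κ * z ^ 2)) 0 := by fun_prop
    have := a1.mul a2.hasDerivAt
    refine HasDerivAt.congr_deriv this ?_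
    simp only [mul_zero, zero_mul, add_zero, ne_eq, OfNat.ofNat_ne_zero, not_false_eq_true, zero_pow, eC_zero]; ring
  simp only [d2]
  rw [h1, h2.deriv]

theorem eC_sq_cancel (c j z : ℂ) : eC (c * z ^ 2 / j) * eC (-((1:ℕ):ℂ) * c * z ^ 2 / j) = 1 := by
  rw [← eC_add, ← eC_zero]; congr 1; push_cast; ring

theorem slash1 (M : Matrix.SpecialLinearGroup (Fin 2) ℤ) {τ : ℂ} (hτ : UHP τ) {v : ℂ → ℂ}
    (hv : IsV 1 ((Ma M * τ + Mb M) / (Mc M * τ + Md M)) v) (he : ∀ z, v (-z) = v z) (z : ℂ) :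
    v (z / (Mc M * τ + Md M)) = eC (Mc M * z ^ 2 / (Mc M * τ + Md M)) * (v 0 * bT τ z +
      ((((Mc M * τ + Md M)⁻¹) ^ 2 * d2 v) / 2 - 2 * Real.pi * I * Mc M * (Mc M * τ + Md M)⁻¹ * v 0) * aT τ z) := by
  have hs := IsV.slash M hτ hv
  have := V1_taylor hτ hs (by intro z; simp only [neg_sq, neg_div, he]) z
  generalize Mc M * τ + Md M = j at *
  have hd : d2 (fun z => eC (-((1:ℕ):ℂ) * Mc M * z ^ 2 / j) * v (z / j)) = 2 * (2 * Real.pi * I * (-Mc M * j⁻¹)) * v 0 + (j⁻¹) ^ 2 * d2 v := by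
    have e1 : (fun z => eC (-((1:ℕ):ℂ) * Mc M * z ^ 2 / j) * v (z / j)) = fun z => eC ((-Mc M * j⁻¹) * z ^ 2) * v (j⁻¹ * z) := by
      ext z; congr 2
      · push_cast; rw [div_eq_mul_inv]; ring
      · rw [div_eq_mul_inv, mul_comm]
    have := hv.diff
    have hE := eC_diff
    rw [e1, d2_mul_even (by fun_prop) (by fun_prop) (by intro z; simp), d2_eC_sq, d2_comp_mul]
    simp [eC_zero]
  rw [hd] at this
  have hc := eC_sq_cancel (Mc M) j z
  simp only [zero_div, ne_eq, OfNat.ofNat_ne_zero, not_false_eq_true, zero_pow, mul_zero, eC_zero, one_mul] at this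
  linear_combination eC (Mc M * z ^ 2 / j) * this - v (z / j) * hc

theorem aT_slash (M : Matrix.SpecialLinearGroup (Fin 2) ℤ) {τ : ℂ} (hτ : UHP τ) (z : ℂ) :
    aT ((Ma M * τ + Mb M) / (Mc M * τ + Md M)) (z / (Mc M * τ + Md M)) =
      eC (Mc M * z ^ 2 / (Mc M * τ + Md M)) * ((Mc M * τ + Md M)⁻¹ ^ 2 * aT τ z) := by
  have hM := UHP_smul M hτ
  rw [slash1 M hτ (aT_V hM) (aT_even _), aT_zero, aT_d2 hM]
  ring

theorem bT_slash (M : Matrix.SpecialLinearGroup (Fin 2) ℤ) {τ : ℂ} (hτ : UHP τ) (z : ℂ) :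
    bT ((Ma M * τ + Mb M) / (Mc M * τ + Md M)) (z / (Mc M * τ + Md M)) =
      eC (Mc M * z ^ 2 / (Mc M * τ + Md M)) * (bT τ z - 2 * Real.pi * I * Mc M * (Mc M * τ + Md M)⁻¹ * aT τ z) := by
  have hM := UHP_smul M hτ
  rw [slash1 M hτ (bT_V hM) (bT_even _), bT_zero hM, bT_d2 hM]
  ring

def PS (f A1 A2 e : ℂ → ℂ) (τ z : ℂ) : ℂ :=
  f τ * (bT τ z + e τ * aT τ z) ^ 2 + A1 τ * (aT τ z * (bT τ z + e τ * aT τ z)) + A2 τ * aT τ z ^ 2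

theorem PS_eq (f A1 A2 e τ) : PS f A1 A2 e τ = fun z => f τ * bas 2 0 τ z + (2 * e τ * f τ + A1 τ) * bas 2 1 τ z +
    (f τ * e τ ^ 2 + A1 τ * e τ + A2 τ) * bas 2 2 τ z := by
  ext z
  simp only [PS, bas]
  norm_num
  ring

theorem PS_V (f A1 A2 e) {τ} (hτ : UHP τ) : IsV 2 τ (PS f A1 A2 e τ) := by
  have h0 := bas_V (m := 2) (i := 0) (by omega) hτ
  have h1 := bas_V (m := 2) (i := 1) (by omega) hτ
  have h2 := bas_V (m := 2) (i := 2) (by omega) hτ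
  rw [PS_eq]
  exact ((h0.const_mul _).add (h1.const_mul _)).add (h2.const_mul _)

theorem PS_d2 (f A1 A2 e) {τ} (hτ : UHP τ) : d2 (PS f A1 A2 e τ) = 2 * (2 * e τ * f τ + A1 τ) := by
  have h0 := (bas_V (m := 2) (i := 0) (by omega) hτ).diff
  have h1 := (bas_V (m := 2) (i := 1) (by omega) hτ).diff
  have h2 := (bas_V (m := 2) (i := 2) (by omega) hτ).diff
  rw [PS_eq, d2_add (by fun_prop) (by fun_prop), d2_add (by fun_prop) (by fun_prop), d2_const_mul _ h0, d2_const_mul _ h1, d2_const_mul _ h2]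
  have e0 := d2_bas hτ 2 0
  have e1 := d2_bas hτ 2 1
  have e2 := d2_bas hτ 2 2
  norm_num at e0 e1 e2
  rw [show d2 (bas 2 0 τ) = 0 from e0, show d2 (bas 2 1 τ) = 2 from e1, show d2 (bas 2 2 τ) = 0 from e2]
  ring

theorem PS_zero (f A1 A2 e) {τ} (hτ : UHP τ) : PS f A1 A2 e τ 0 = f τ := by
  simp [PS, aT_zero, bT_zero hτ]

theorem PS_holo_aux {S : Set (ℂ × ℂ)} {f A1 A2 e a b : ℂ × ℂ → ℂ} (h0 : DifferentiableOn ℂ f S) (h1 : DifferentiableOn ℂ A1 S)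
    (h2 : DifferentiableOn ℂ A2 S) (h3 : DifferentiableOn ℂ e S) (ha : DifferentiableOn ℂ a S) (hb : DifferentiableOn ℂ b S) :
    DifferentiableOn ℂ (fun p => f p * (b p + e p * a p) ^ 2 + A1 p * (a p * (b p + e p * a p)) + A2 p * a p ^ 2) S := by
  fun_prop

theorem PS_JF {k : ℕ} {f A1 A2 e : ℂ → ℂ} {l E : ℂ} (hf : IsR f l) (h1 : IsR A1 (-2 * E * l)) (h2 : IsR A2 (l * E ^ 2)) (he : IsR e E)
    (tf : ∀ (M : Matrix.SpecialLinearGroup (Fin 2) ℤ) (τ : ℂ), UHP τ → f ((Ma M * τ + Mb M) / (Mc M * τ + Md M)) = (Mc M * τ + Md M) ^ k * f τ)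
    (t1 : ∀ (M : Matrix.SpecialLinearGroup (Fin 2) ℤ) (τ : ℂ), UHP τ → A1 ((Ma M * τ + Mb M) / (Mc M * τ + Md M)) = (Mc M * τ + Md M) ^ (k + 2) * A1 τ)
    (t2 : ∀ (M : Matrix.SpecialLinearGroup (Fin 2) ℤ) (τ : ℂ), UHP τ → A2 ((Ma M * τ + Mb M) / (Mc M * τ + Md M)) = (Mc M * τ + Md M) ^ (k + 4) * A2 τ)
    (te : ∀ (M : Matrix.SpecialLinearGroup (Fin 2) ℤ) (τ : ℂ), UHP τ →
    e ((Ma M * τ + Mb M) / (Mc M * τ + Md M)) = (Mc M * τ + Md M) ^ 2 * e τ + 2 * Real.pi * I * Mc M * (Mc M * τ + Md M)) :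
    IsJF k 2 (PS f A1 A2 e) where
  holo := PS_holo_aux (comp_fst hf.holo) (comp_fst h1.holo) (comp_fst h2.holo) (comp_fst he.holo) aT_jh bT_jh
  transf := by
    intro M τ z hτ
    have hj := Mj_ne M hτ
    have ha := aT_slash M hτ z
    have hb := bT_slash M hτ z
    have tf := tf M τ hτ
    have t1 := t1 M τ hτ
    have t2 := t2 M τ hτ
    have te := te M τ hτ
    have hE : eC (((2:ℕ):ℂ) * Mc M * z ^ 2 / (Mc M * τ + Md M)) = eC (Mc M * z ^ 2 / (Mc M * τ + Md M)) ^ 2 := by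
      rw [pow_two (eC _), ← eC_add]; congr 1; push_cast; ring
    simp only [PS]
    rw [hE, ha, hb, tf, t1, t2, te]
    generalize Mc M * τ + Md M = j at *
    generalize eC (Mc M * z ^ 2 / j) = X at *
    have hB : X * (bT τ z - 2 * Real.pi * I * Mc M * j⁻¹ * aT τ z) + (j ^ 2 * e τ + 2 * Real.pi * I * Mc M * j) * (X * (j⁻¹ ^ 2 * aT τ z))
      = X * (bT τ z + e τ * aT τ z) := by
      field_simp
      ring
    rw [hB]
    field_simp
    ring
  ellip := fun p q τ z hτ => (PS_V f A1 A2 e hτ).law p q z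
  fourier := by
    have hbh := bT_FSl.add ((FSl_of_R he).mul aT_FSl)
    have H := (((FSl_of_R hf).mul (hbh.pow 2)).add ((FSl_of_R h1).mul (aT_FSl.mul hbh))).add ((FSl_of_R h2).mul (aT_FSl.pow 2))
    have H : FSl (fun τ x _ => PS f A1 A2 e τ x) (fun _ _ => l) := by
      refine (congrArg (FSl (fun τ x _ => PS f A1 A2 e τ x)) (funext fun x => funext fun y => ?_)).mp H
      ring
    obtain ⟨c, hc, hc1, -⟩ := supp_main H.fs l H.lim (fun τ x y hτ => by
      have := (PS_V f A1 A2 e hτ).qper x; exact_mod_cast this)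
    obtain ⟨d, hd0, hd⟩ := regroup (J := ℕ × ℤ × ℤ) (X := ℂ × ℂ) c (fun p => (p.1, p.2.1))
      (fun i p => eC (i.1 * p.1 + i.2 * p.2)) {p | UHP p.1} (fun p => PS f A1 A2 e p.1 p.2) (by
        rintro ⟨τ, z⟩ hτ
        refine (congrArg (fun F => HasSum F _) (funext fun k => ?_)).mpr (hc τ z 0 hτ)
        simp only [chi]
        congr 2; ring)
    refine ⟨fun n r => d (n, r), ?_, fun τ z hτ => hd (τ, z) hτ⟩
    intro n r hr
    refine hd0 _ ?_
    rintro ⟨n', a, b⟩ hj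
    simp only [Prod.mk.injEq] at hj
    obtain ⟨rfl, rfl⟩ := hj
    refine hc1 _ _ _ ?_
    push_cast at hr
    linarith

theorem zero_JF (k m : ℕ) : IsJF k m (fun _ _ => 0) where
  holo := by fun_prop
  transf := by simp
  ellip := by simp
  fourier := ⟨fun _ _ => 0, by simp, by intro τ z _; simpa using hasSum_zero⟩

theorem part4 {k : ℕ} (hk : 0 < k) (hk4 : k % 4 = 0) {f g : ℂ → ℂ} (hf : IsMF k f) (hg : IsCF (k + 2) g) :
      ∃ ψ₁ ψ₂ : ℂ → ℂ → ℂ, IsJF k 2 ψ₁ ∧ IsJF k 4 ψ₂ ∧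
        (∀ τ : ℂ, UHP τ → D0J ψ₁ τ - D0J ψ₂ τ = f τ) ∧
        (∀ τ : ℂ, UHP τ →
          (2 / 2 : ℂ) * D2J k 2 ψ₁ τ - (2 / 4 : ℂ) * D2J k 4 ψ₂ τ = g τ) := by
  obtain ⟨l, hl⟩ := hf.R
  obtain ⟨e, E, he, te⟩ := exists_e
  obtain ⟨G, hG, tG⟩ := exists_G (k := k + 4) (by omega) (Nat.even_iff.mpr (by omega))
  have hk' : (k : ℂ) ≠ 0 := by exact_mod_cast hk.ne'
  have hp := tpi_ne
  let A1 : ℂ → ℂ := fun τ => (2 * Real.pi * I) ^ 2 / (2 * k) * g τ + (-2) * (e τ * f τ) + (2 * (2 * Real.pi * I) / k) * deriv f τ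
  have hA1 : IsR A1 (-2 * E * l) := by
    have := ((hg.R.const_mul ((2 * Real.pi * I) ^ 2 / (2 * k))).add ((he.mul hl).const_mul (-2))).add (hl.deriv.const_mul (2 * (2 * Real.pi * I) / k))
    refine (congrArg (IsR A1) ?_).mp this
    ring
  have hA2 : IsR (fun τ => (l * E ^ 2) * G τ) (l * E ^ 2) := by simpa using hG.const_mul (l * E ^ 2)
  refine ⟨PS f A1 (fun τ => (l * E ^ 2) * G τ) e, fun _ _ => 0, PS_JF hl hA1 hA2 he hf.transf ?_ ?_ te, zero_JF k 4, ?_, ?_⟩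
  · intro M τ hτ
    have hj := Mj_ne M hτ
    simp only [A1]
    rw [hg.transf M τ hτ, te M τ hτ, hf.transf M τ hτ, deriv_law hf M hτ]
    field_simp
    ring
  · intro M τ hτ
    simp only [tG M τ hτ]; ring
  · intro τ hτ
    simp [D0J, PS_zero _ _ _ _ hτ]
  · intro τ hτ
    have hd : deriv (fun t => PS f A1 (fun τ => (l * E ^ 2) * G τ) e t 0) τ = deriv f τ := by
      apply Filter.EventuallyEq.deriv_eq
      filter_upwards [UHP_open.mem_nhds hτ] with t ht using PS_zero _ _ _ _ ht
    simp only [D2J, iteratedDeriv_two_eq, hd]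
    rw [show d2 (fun z => PS f A1 (fun τ => (l * E ^ 2) * G τ) e τ z) = _ from PS_d2 f A1 (fun τ => (l * E ^ 2) * G τ) e hτ]
    rw [show d2 (fun _ : ℂ => (0:ℂ)) = 0 by simp [d2]]
    simp only [A1, deriv_const]
    generalize 2 * (Real.pi:ℂ) * I = p at *
    push_cast
    field_simp
    ring

/-- for `k ≡ 0 (mod 4)` the sequence
`0 → J_{k,2}(O_K) →(π₁ × π_{1+i}) J_{k,2} × J_{k,4} →(Λ(2) − Λ(4)) M_k × S_{k+2} → 0`
is exact, where `Λ(m) = (D₀, (2/m) D₂)`. -/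
theorem stmt16 (k : ℕ) (hk : 0 < k) (hk4 : k % 4 = 0) :
    (∀ φ : ℂ → ℂ → ℂ → ℂ, IsHJF k 2 φ →
      IsJF k 2 (fun τ z => φ τ z z) ∧
      IsJF k 4 (fun τ z => φ τ ((1 + Complex.I) * z) ((1 - Complex.I) * z))) ∧
    (∀ φ φ' : ℂ → ℂ → ℂ → ℂ, IsHJF k 2 φ → IsHJF k 2 φ' →
      (∀ τ z : ℂ, UHP τ → φ τ z z = φ' τ z z) →
      (∀ τ z : ℂ, UHP τ →
        φ τ ((1 + Complex.I) * z) ((1 - Complex.I) * z)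
          = φ' τ ((1 + Complex.I) * z) ((1 - Complex.I) * z)) →
      ∀ τ z₁ z₂ : ℂ, UHP τ → φ τ z₁ z₂ = φ' τ z₁ z₂) ∧
    (∀ ψ₁ : ℂ → ℂ → ℂ, ∀ ψ₂ : ℂ → ℂ → ℂ, IsJF k 2 ψ₁ → IsJF k 4 ψ₂ →
      (((∀ τ : ℂ, UHP τ → D0J ψ₁ τ = D0J ψ₂ τ) ∧
        (∀ τ : ℂ, UHP τ → (2 / 2 : ℂ) * D2J k 2 ψ₁ τ = (2 / 4 : ℂ) * D2J k 4 ψ₂ τ))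
      ↔ ∃ φ : ℂ → ℂ → ℂ → ℂ, IsHJF k 2 φ ∧
          (∀ τ z : ℂ, UHP τ → φ τ z z = ψ₁ τ z) ∧
          (∀ τ z : ℂ, UHP τ →
            φ τ ((1 + Complex.I) * z) ((1 - Complex.I) * z) = ψ₂ τ z))) ∧
    (∀ f g : ℂ → ℂ, IsMF k f → IsCF (k + 2) g →
      ∃ ψ₁ ψ₂ : ℂ → ℂ → ℂ, IsJF k 2 ψ₁ ∧ IsJF k 4 ψ₂ ∧
        (∀ τ : ℂ, UHP τ → D0J ψ₁ τ - D0J ψ₂ τ = f τ) ∧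
        (∀ τ : ℂ, UHP τ →
          (2 / 2 : ℂ) * D2J k 2 ψ₁ τ - (2 / 4 : ℂ) * D2J k 4 ψ₂ τ = g τ)) := by
  refine ⟨fun φ h => ⟨part1a h, part1b h⟩,
    fun φ φ' h h' h1 h2 τ z₁ z₂ hτ => part2 hk4 h h' h1 h2 τ z₁ z₂ hτ,
    fun ψ₁ ψ₂ h1 h2 => ⟨fun h => part3 hk hk4 h1 h2 h.1 h.2, fun ⟨φ, h, e1, e2⟩ => part3r hk hk4 h e1 e2⟩,
    fun f g hf hg => part4 hk hk4 hf hg⟩
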